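/- For all sufficiently small ε > 0 the following holds. Let (γ_b, γ_w) be a BW-decomposition of some queenon, and set N = ⌊ε^{−1/3}⌋. Then limsup as n → ∞ of |B_n((γ_b,γ_w), ε)|^{1/n} / n is at most exp(G^N(γ_b,γ_w) + ε^{1/100}). -/

import Mathlib

open MeasureTheory Filter Topology
open scoped ENNReal

noncomputable section

/-- The square `[-1/2,1/2]²`. -/
def unitSq : Set (ℝ × ℝ) :=
  Set.Icc (-(1:ℝ)/2) (1/2) ×ˢ Set.Icc (-(1:ℝ)/2) (1/2)

/-- The square `σ_{i,j}^N` (for `i, j ∈ [N]`). -/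
def gridSq (N i j : ℕ) : Set (ℝ × ℝ) :=
  Set.Icc (-(1:ℝ)/2 + ((i:ℝ) - 1)/N) (-(1:ℝ)/2 + (i:ℝ)/N) ×ˢ
    Set.Icc (-(1:ℝ)/2 + ((j:ℝ) - 1)/N) (-(1:ℝ)/2 + (j:ℝ)/N)

/-- The cell of the partition `I_N` with index `i, j ∈ [2N]`. -/
def INcell (N i j : ℕ) : Set (ℝ × ℝ) :=
  {p ∈ unitSq | (-1 + ((i:ℝ) - 1)/N ≤ p.1 + p.2 ∧ p.1 + p.2 ≤ -1 + (i:ℝ)/N) ∧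
    (-1 + ((j:ℝ) - 1)/N ≤ p.2 - p.1 ∧ p.2 - p.1 ≤ -1 + (j:ℝ)/N)}

/-- The interval of the partition `J_N` of `[-1,1]` with index `i ∈ [2N]`. -/
def JNcell (N i : ℕ) : Set ℝ :=
  Set.Icc (-1 + ((i:ℝ) - 1)/N) (-1 + (i:ℝ)/N)

/-- A member of the family `R` of subsets of the square. -/
def Rset (a₁ b₁ a₂ b₂ : ℝ) : Set (ℝ × ℝ) :=
  {p ∈ unitSq | (a₁ ≤ p.1 + p.2 ∧ p.1 + p.2 ≤ b₁) ∧ (a₂ ≤ p.2 - p.1 ∧ p.2 - p.1 ≤ b₂)}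

/-- The distance `d` between two Borel measures on the square: the supremum of
`|γ₁(α) − γ₂(α)|` over `α ∈ R`. -/
def qdist (μ ν : Measure (ℝ × ℝ)) : ℝ :=
  sSup {t : ℝ | ∃ a₁ b₁ a₂ b₂ : ℝ, a₁ ∈ Set.Icc (-1:ℝ) 1 ∧ b₁ ∈ Set.Icc (-1:ℝ) 1 ∧
    a₂ ∈ Set.Icc (-1:ℝ) 1 ∧ b₂ ∈ Set.Icc (-1:ℝ) 1 ∧
    t = |(μ (Rset a₁ b₁ a₂ b₂)).toReal - (ν (Rset a₁ b₁ a₂ b₂)).toReal|}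

/-- A permuton: a Borel probability measure on the square with uniform marginals. -/
def IsPermuton (μ : Measure (ℝ × ℝ)) : Prop :=
  IsProbabilityMeasure μ ∧ μ unitSqᶜ = 0 ∧
  ∀ a b : ℝ, -(1:ℝ)/2 ≤ a → a ≤ b → b ≤ 1/2 →
    μ (Set.Icc a b ×ˢ Set.Icc (-(1:ℝ)/2) (1/2)) = ENNReal.ofReal (b - a) ∧
    μ (Set.Icc (-(1:ℝ)/2) (1/2) ×ˢ Set.Icc a b) = ENNReal.ofReal (b - a)

/-- An `N`-step permuton: a permuton with constant density on each square `σ_{i,j}^N`. -/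
def IsStepPermutonN (N : ℕ) (μ : Measure (ℝ × ℝ)) : Prop :=
  IsPermuton μ ∧
  ∀ i ∈ Finset.Icc 1 N, ∀ j ∈ Finset.Icc 1 N, ∃ c : ℝ≥0∞,
    ∀ s : Set (ℝ × ℝ), s ⊆ gridSq N i j → MeasurableSet s → μ s = c * volume s

/-- A step permuton. -/
def IsStepPermuton (μ : Measure (ℝ × ℝ)) : Prop :=
  ∃ N : ℕ, 0 < N ∧ IsStepPermutonN N μ

/-- Sub-uniform diagonal marginals. -/
def SubUniformDiag (μ : Measure (ℝ × ℝ)) : Prop :=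
  ∀ a b : ℝ, -1 ≤ a → a ≤ b → b ≤ 1 →
    μ {p ∈ unitSq | a ≤ p.1 + p.2 ∧ p.1 + p.2 ≤ b} ≤ ENNReal.ofReal (b - a) ∧
    μ {p ∈ unitSq | a ≤ p.2 - p.1 ∧ p.2 - p.1 ≤ b} ≤ ENNReal.ofReal (b - a)

/-- The set `Γ` of queenons: the closure, in the topology of weak convergence of Borel
probability measures, of the set of step permutons with sub-uniform diagonal marginals. -/
def queenons : Set (ProbabilityMeasure (ℝ × ℝ)) :=
  closure {μ : ProbabilityMeasure (ℝ × ℝ) |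
    IsStepPermuton μ.toMeasure ∧ SubUniformDiag μ.toMeasure}

/-- The pushforward `γ⁺` of `γ` under `(x,y) ↦ x+y`. -/
def diagPlus (γ : Measure (ℝ × ℝ)) : Measure ℝ := γ.map fun p => p.1 + p.2

/-- The pushforward `γ⁻` of `γ` under `(x,y) ↦ y−x`. -/
def diagMinus (γ : Measure (ℝ × ℝ)) : Measure ℝ := γ.map fun p => p.2 - p.1

/-- The measure `γ̄⁺` on `[-1,1]`, with `γ̄⁺([a,b]) = (b−a) − γ⁺([a,b])`. -/
def barPlus (γ : Measure (ℝ × ℝ)) : Measure ℝ :=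
  volume.restrict (Set.Icc (-1:ℝ) 1) - diagPlus γ

/-- The measure `γ̄⁻` on `[-1,1]`, with `γ̄⁻([a,b]) = (b−a) − γ⁻([a,b])`. -/
def barMinus (γ : Measure (ℝ × ℝ)) : Measure ℝ :=
  volume.restrict (Set.Icc (-1:ℝ) 1) - diagMinus γ

/-- The uniform probability measure on `[-1,1]` (density `1/2`). -/
def unif11 : Measure ℝ := (2 : ℝ≥0∞)⁻¹ • volume.restrict (Set.Icc (-1:ℝ) 1)

open Classical in
/-- The Kullback–Leibler divergence of `μ` with respect to `ν`, as an extended real: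
`∫ log (dμ/dν) dμ` if `μ ≪ ν` and the integrand is integrable, and `+∞` otherwise. -/
def DKL {X : Type*} [MeasurableSpace X] (μ ν : Measure X) : EReal :=
  if μ ≪ ν ∧ Integrable (fun x => Real.log (μ.rnDeriv ν x).toReal) μ then
    ((∫ x, Real.log (μ.rnDeriv ν x).toReal ∂μ : ℝ) : EReal)
  else ⊤

/-- The Q-entropy `H_q(γ) = −D_KL(γ) − D_KL(γ̄⁺) − D_KL(γ̄⁻) + 2 log 2 − 3`. -/
def Hq (γ : Measure (ℝ × ℝ)) : EReal :=
  -DKL γ (volume.restrict unitSq) - DKL (barPlus γ) unif11 - DKL (barMinus γ) unif11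
    + ((2 * Real.log 2 - 3 : ℝ) : EReal)

/-- The discrete approximation `H_q^N` of the Q-entropy. -/
def HqN (N : ℕ) (γ : Measure (ℝ × ℝ)) : ℝ :=
  -(∑ i ∈ Finset.Icc 1 (2*N), ∑ j ∈ Finset.Icc 1 (2*N),
      (γ (INcell N i j)).toReal *
        Real.log ((γ (INcell N i j)).toReal / (volume (INcell N i j)).toReal))
  - (∑ i ∈ Finset.Icc 1 (2*N),
      (barPlus γ (JNcell N i)).toReal *
        Real.log ((2*N : ℝ) * (barPlus γ (JNcell N i)).toReal))
  - (∑ i ∈ Finset.Icc 1 (2*N),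
      (barMinus γ (JNcell N i)).toReal *
        Real.log ((2*N : ℝ) * (barMinus γ (JNcell N i)).toReal))
  + 2 * Real.log 2 - 3

/-- An `n`-queens configuration: a subset of `[n]² = {1,…,n}²` with exactly one element in
each row and column and at most one element in each plus- and minus-diagonal. -/
def IsQueensConfig (n : ℕ) (q : Finset (ℕ × ℕ)) : Prop :=
  (∀ p ∈ q, p.1 ∈ Finset.Icc 1 n ∧ p.2 ∈ Finset.Icc 1 n) ∧
  (∀ y ∈ Finset.Icc 1 n, ∃! x : ℕ, (x, y) ∈ q) ∧
  (∀ x ∈ Finset.Icc 1 n, ∃! y : ℕ, (x, y) ∈ q) ∧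
  (∀ p ∈ q, ∀ p' ∈ q, p.1 + p.2 = p'.1 + p'.2 → p = p') ∧
  (∀ p ∈ q, ∀ p' ∈ q, (p.2 : ℤ) - (p.1 : ℤ) = (p'.2 : ℤ) - (p'.1 : ℤ) → p = p')

/-- `Q(n)`, the number of `n`-queens configurations. -/
def numQueens (n : ℕ) : ℕ :=
  Set.ncard {q : Finset (ℕ × ℕ) | IsQueensConfig n q}

/-- The measure `γ_q` associated to an `n`-queens configuration `q`: density `n` on each
square `σ_{i,j}^n` with `(i,j) ∈ q`, and `0` elsewhere. -/
def gammaOf (n : ℕ) (q : Finset (ℕ × ℕ)) : Measure (ℝ × ℝ) :=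
  volume.withDensity ((⋃ ij ∈ q, gridSq n ij.1 ij.2).indicator fun _ => (n : ℝ≥0∞))

/-- The set `B_n(γ,ε)` of `n`-queens configurations `q` with `d(γ_q, γ) < ε`. -/
def Bset (n : ℕ) (γ : Measure (ℝ × ℝ)) (ε : ℝ) : Set (Finset (ℕ × ℕ)) :=
  {q | IsQueensConfig n q ∧ qdist (gammaOf n q) γ < ε}

/-- `|B_n(γ,ε)|`. -/
def Bcard (n : ℕ) (γ : Measure (ℝ × ℝ)) (ε : ℝ) : ℕ := (Bset n γ ε).ncard

/-- The exponential of an extended real, with `exp(−∞) = 0`. -/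
def expEReal (x : EReal) : ℝ := if x = ⊥ then 0 else Real.exp x.toReal

/-- `(γb, γw)` is a BW-decomposition of `γ`. -/
def IsBWDecomp (γ γb γw : Measure (ℝ × ℝ)) : Prop :=
  γb + γw = γ ∧
  ∀ a b : ℝ, -1 ≤ a → a ≤ b → b ≤ 1 →
    (γb {p : ℝ × ℝ | a ≤ p.1 + p.2 ∧ p.1 + p.2 ≤ b} ≤ ENNReal.ofReal ((b - a)/2) ∧
     γb {p : ℝ × ℝ | a ≤ p.1 - p.2 ∧ p.1 - p.2 ≤ b} ≤ ENNReal.ofReal ((b - a)/2)) ∧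
    (γw {p : ℝ × ℝ | a ≤ p.1 + p.2 ∧ p.1 + p.2 ≤ b} ≤ ENNReal.ofReal ((b - a)/2) ∧
     γw {p : ℝ × ℝ | a ≤ p.1 - p.2 ∧ p.1 - p.2 ≤ b} ≤ ENNReal.ofReal ((b - a)/2))

/-- `(γb, γw)` belongs to `BW`: it is a BW-decomposition of some queenon. -/
def memBW (γb γw : Measure (ℝ × ℝ)) : Prop :=
  ∃ γ : ProbabilityMeasure (ℝ × ℝ), γ ∈ queenons ∧ IsBWDecomp γ.toMeasure γb γw

/-- The measure `γ̄_i⁺` on `[-1,1]`, with `γ̄_i⁺([a,b]) = (b−a)/2 − γ_i⁺([a,b])`,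
where `γ_i⁺` is the pushforward of `γ_i` under `(x,y) ↦ x+y`. -/
def bwBarPlus (γi : Measure (ℝ × ℝ)) : Measure ℝ :=
  (2 : ℝ≥0∞)⁻¹ • volume.restrict (Set.Icc (-1:ℝ) 1) - γi.map fun p => p.1 + p.2

/-- The measure `γ̄_i⁻` on `[-1,1]`, with `γ̄_i⁻([a,b]) = (b−a)/2 − γ_i⁻([a,b])`,
where `γ_i⁻` is the pushforward of `γ_i` under `(x,y) ↦ x−y`. -/
def bwBarMinus (γi : Measure (ℝ × ℝ)) : Measure ℝ :=
  (2 : ℝ≥0∞)⁻¹ • volume.restrict (Set.Icc (-1:ℝ) 1) - γi.map fun p => p.1 - p.2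

/-- The function `G^N` on BW-decompositions. -/
def GN (N : ℕ) (γb γw : Measure (ℝ × ℝ)) : ℝ :=
  -(∑ i ∈ Finset.Icc 1 (2*N), ∑ j ∈ Finset.Icc 1 (2*N),
      ((γb (INcell N i j)).toReal *
          Real.log (2 * (γb (INcell N i j)).toReal / (volume (INcell N i j)).toReal) +
        (γw (INcell N i j)).toReal *
          Real.log (2 * (γw (INcell N i j)).toReal / (volume (INcell N i j)).toReal)))
  - (∑ i ∈ Finset.Icc 1 (2*N),
      ((bwBarPlus γb (JNcell N i)).toReal *
          Real.log ((4*N : ℝ) * (bwBarPlus γb (JNcell N i)).toReal) +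
        (bwBarPlus γw (JNcell N i)).toReal *
          Real.log ((4*N : ℝ) * (bwBarPlus γw (JNcell N i)).toReal)))
  - (∑ i ∈ Finset.Icc 1 (2*N),
      ((bwBarMinus γb (JNcell N i)).toReal *
          Real.log ((4*N : ℝ) * (bwBarMinus γb (JNcell N i)).toReal) +
        (bwBarMinus γw (JNcell N i)).toReal *
          Real.log ((4*N : ℝ) * (bwBarMinus γw (JNcell N i)).toReal)))
  + 2 * Real.log 2 - 3

/-- The measure `γ_{q,b}` of the black queens of `q` (positions `(x,y)` with `x+y` even). -/
def gammaBlack (n : ℕ) (q : Finset (ℕ × ℕ)) : Measure (ℝ × ℝ) :=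
  volume.withDensity
    ((⋃ ij ∈ q.filter (fun ij => (ij.1 + ij.2) % 2 = 0), gridSq n ij.1 ij.2).indicator
      fun _ => (n : ℝ≥0∞))

/-- The measure `γ_{q,w}` of the white queens of `q` (positions `(x,y)` with `x+y` odd). -/
def gammaWhite (n : ℕ) (q : Finset (ℕ × ℕ)) : Measure (ℝ × ℝ) :=
  volume.withDensity
    ((⋃ ij ∈ q.filter (fun ij => (ij.1 + ij.2) % 2 = 1), gridSq n ij.1 ij.2).indicator
      fun _ => (n : ℝ≥0∞))

/-- The set `B_n((γb,γw), ε)` of `n`-queens configurations `q` with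
`d_BW((γ_{q,b}, γ_{q,w}), (γb, γw)) < ε`. -/
def BsetBW (n : ℕ) (γb γw : Measure (ℝ × ℝ)) (ε : ℝ) : Set (Finset (ℕ × ℕ)) :=
  {q | IsQueensConfig n q ∧
    max (qdist (gammaBlack n q) γb) (qdist (gammaWhite n q) γw) < ε}

section SequentialCounting

variable {R C : Type*} [Fintype C]

/-- The value `c` at `i` is not attacked by the part of `f` revealed before `i`. -/
def IsAvail {β : Type*} [LinearOrder β] (att : R → C → R → C → Prop) (τ : R → β)
    (f : R → C) (i : R) (c : C) : Prop :=
  ∀ j, τ j < τ i → ¬ att j (f j) i c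

open Classical in
/-- The total weight of the values at `i` not attacked by the part of `f` revealed before `i`. -/
def availWeight {β : Type*} [LinearOrder β] (att : R → C → R → C → Prop) (τ : R → β)
    (w : R → C → ℝ) (f : R → C) (i : R) : ℝ :=
  ∑ c : C, if IsAvail att τ f i c then w i c else 0

lemma availWeight_pos {β : Type*} [LinearOrder β] (att : R → C → R → C → Prop) (τ : R → β)
    (w : R → C → ℝ) (hw : ∀ i c, 0 < w i c) {f : R → C} {i : R}
    (hf : IsAvail att τ f i (f i)) : 0 < availWeight att τ w f i := by
  classical
  refine lt_of_lt_of_le (hw i (f i)) ?_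
  calc w i (f i) = if IsAvail att τ f i (f i) then w i (f i) else 0 := by rw [if_pos hf]
    _ ≤ _ := Finset.single_le_sum (f := fun c => if IsAvail att τ f i c then w i c else 0)
        (fun c _ => by split_ifs <;> simp [(hw i c).le]) (Finset.mem_univ (f i))

variable [Fintype R] [DecidableEq R]

/-- Resampling one coordinate of a function multiplies a sum over all functions by the number
of values. -/
lemma sum_sum_update (m : R) (g : (R → C) → ℝ) :
    ∑ f : R → C, ∑ c : C, g (Function.update f m c) = Fintype.card C * ∑ f : R → C, g f := by
  classical
  have h1 : ∑ f : R → C, ∑ c : C, g (Function.update f m c)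
      = ∑ z : (R → C) × C, g (Function.update z.1 m z.2) := by
    rw [Fintype.sum_prod_type]
  have h2 : ∑ z : (R → C) × C, g (Function.update z.1 m z.2) = ∑ z : (R → C) × C, g z.1 := by
    refine Finset.sum_nbij' (fun z => (Function.update z.1 m z.2, z.1 m))
      (fun z => (Function.update z.1 m z.2, z.1 m)) ?_ ?_ ?_ ?_ ?_ <;> simp
  rw [h1, h2, Fintype.sum_prod_type, Finset.sum_comm]
  simp

/-- The total weight of all runs of a sequential random procedure is at most one: the `i`-th
factor depends only on the coordinates revealed before `i` and on the coordinate `i`, and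
is sub-stochastic in the coordinate `i`. -/
lemma sum_prod_le_one [Nonempty C] {β : Type*} [LinearOrder β] (τ : R → β)
    (p : R → (R → C) → ℝ) (hp : ∀ i f, 0 ≤ p i f)
    (hdep : ∀ i m f c, m ≠ i → ¬ τ m < τ i → p i (Function.update f m c) = p i f)
    (hsum : ∀ i f, ∑ c : C, p i (Function.update f i c) ≤ 1) :
    ∑ f : R → C, ∏ i, p i f ≤ 1 := by
  classical
  have key : ∀ s : Finset R,
      (Fintype.card C : ℝ) ^ s.card * ∑ f : R → C, ∏ i ∈ s, p i f
        ≤ (Fintype.card C : ℝ) ^ Fintype.card R := by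
    intro s
    induction s using Finset.induction_on_max_value τ with
    | empty => simp
    | insert a s ha hmax ih =>
      refine le_trans ?_ ih
      rw [Finset.card_insert_of_notMem ha, pow_succ, mul_assoc]
      refine mul_le_mul_of_nonneg_left ?_ (by positivity)
      rw [← sum_sum_update a]
      refine Finset.sum_le_sum fun f _ => ?_
      have h : ∀ c : C, ∏ i ∈ insert a s, p i (Function.update f a c)
          = (∏ i ∈ s, p i f) * p a (Function.update f a c) := by
        intro c
        rw [Finset.prod_insert ha, mul_comm]
        congr 1
        refine Finset.prod_congr rfl fun i hi => hdep i a f c ?_ ?_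
        · rintro rfl; exact ha hi
        · exact not_lt.mpr (hmax i hi)
      simp_rw [h, ← Finset.mul_sum]
      exact mul_le_of_le_one_right (Finset.prod_nonneg fun i _ => hp i f) (hsum a f)
  have := key Finset.univ
  rw [Finset.card_univ] at this
  have hpos : (0:ℝ) < (Fintype.card C : ℝ) ^ Fintype.card R := by
    have := Fintype.card_pos (α := C); positivity
  nlinarith

lemma sum_prod_div_availWeight_le_one [Nonempty C] {β : Type*} [LinearOrder β]
    (att : R → C → R → C → Prop) (τ : R → β) (w : R → C → ℝ) (hw : ∀ i c, 0 < w i c)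
    (F : Finset (R → C)) (hF : ∀ f ∈ F, ∀ i j, j ≠ i → ¬ att j (f j) i (f i)) :
    ∑ f ∈ F, ∏ i, w i (f i) / availWeight att τ w f i ≤ 1 := by
  classical
  have hS0 : ∀ f i, 0 ≤ availWeight att τ w f i := fun f i =>
    Finset.sum_nonneg fun c _ => by split_ifs <;> simp [(hw i c).le]
  set p : R → (R → C) → ℝ := fun i f =>
    (if IsAvail att τ f i (f i) then w i (f i) else 0)
      / availWeight att τ w f i with hpdef
  have hp : ∀ i f, 0 ≤ p i f := fun i f =>
    div_nonneg (by split_ifs <;> simp [(hw i (f i)).le]) (hS0 f i)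
  have hupd : ∀ (i m : R) (f : R → C) (c d : C), ¬ τ m < τ i →
      (IsAvail att τ (Function.update f m c) i d ↔ IsAvail att τ f i d) := by
    intro i m f c d hm
    refine forall_congr' fun j => forall_congr' fun hj => ?_
    have : j ≠ m := by rintro rfl; exact hm hj
    rw [Function.update_of_ne this]
  have hSupd : ∀ (i m : R) (f : R → C) (c : C), ¬ τ m < τ i →
      availWeight att τ w (Function.update f m c) i = availWeight att τ w f i := by
    intro i m f c hm
    unfold availWeight
    refine Finset.sum_congr rfl fun d _ => ?_
    simp only [hupd i m f c d hm]
  have hle := sum_prod_le_one τ p hp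
    (by
      intro i m f c hmi hm
      simp only [hpdef, hSupd i m f c hm, Function.update_of_ne hmi.symm, hupd i m f c _ hm])
    (by
      intro i f
      simp only [hpdef, hSupd i i f _ (lt_irrefl _), Function.update_self,
        hupd i i f _ _ (lt_irrefl _)]
      rw [← Finset.sum_div]
      exact div_self_le_one _)
  refine le_trans ?_ hle
  refine le_trans (Finset.sum_le_sum fun f hf => ?_)
    (Finset.sum_le_univ_sum_of_nonneg (s := F) fun f => Finset.prod_nonneg fun i _ => hp i f)
  refine le_of_eq (Finset.prod_congr rfl fun i _ => ?_)
  have : IsAvail att τ f i (f i) := fun j hj =>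
    hF f hf i j (by rintro rfl; exact lt_irrefl _ hj)
  simp only [hpdef, if_pos this]

/-- Averaging over all clocks `τ : R → Fin M`. -/
lemma card_le_exp_of_avg [Nonempty C] {M : ℕ} (hM : 0 < M)
    (att : R → C → R → C → Prop) (W : R → C → Fin M → ℝ) (hW : ∀ i c k, 0 < W i c k)
    (F : Finset (R → C)) (hF : ∀ f ∈ F, ∀ i j, j ≠ i → ¬ att j (f j) i (f i)) (L : ℝ)
    (hL : ∀ f ∈ F, ∑ τ : R → Fin M, ∑ i,
        (Real.log (availWeight att τ (fun i c => W i c (τ i)) f i) - Real.log (W i (f i) (τ i)))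
        ≤ (M : ℝ) ^ Fintype.card R * L) :
    (F.card : ℝ) ≤ Real.exp L := by
  classical
  set K : ℝ := (M : ℝ) ^ Fintype.card R with hK
  have hKpos : 0 < K := by positivity
  have hKcard : (∑ _τ : R → Fin M, (1 : ℝ)) = K := by simp [hK]
  have hS : ∀ f ∈ F, ∀ (τ : R → Fin M) i,
      0 < availWeight att τ (fun i c => W i c (τ i)) f i := by
    intro f hf τ i
    exact availWeight_pos att τ _ (fun i c => hW i c (τ i)) fun j hj =>
      hF f hf i j (by rintro rfl; exact lt_irrefl _ hj)
  have hJ : ∀ f ∈ F, Real.exp (-L) ≤ ∑ τ : R → Fin M, K⁻¹ *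
      ∏ i, W i (f i) (τ i) / availWeight att τ (fun i c => W i c (τ i)) f i := by
    intro f hf
    have h := convexOn_exp.map_sum_le (t := (Finset.univ : Finset (R → Fin M)))
      (w := fun _ => K⁻¹)
      (p := fun τ => ∑ i, (Real.log (W i (f i) (τ i)) -
        Real.log (availWeight att τ (fun i c => W i c (τ i)) f i)))
      (fun _ _ => by positivity)
      (by rw [← mul_one K⁻¹, ← Finset.mul_sum, hKcard]; exact inv_mul_cancel₀ hKpos.ne')
      (fun _ _ => Set.mem_univ _)
    simp only [smul_eq_mul] at h
    refine le_trans (Real.exp_le_exp.mpr ?_) (h.trans (le_of_eq ?_))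
    · have := hL f hf
      rw [← Finset.mul_sum, ← div_eq_inv_mul, le_div_iff₀ hKpos]
      have h2 : ∑ τ : R → Fin M, ∑ i, (Real.log (W i (f i) (τ i)) -
          Real.log (availWeight att τ (fun i c => W i c (τ i)) f i))
          = -∑ τ : R → Fin M, ∑ i, (Real.log (availWeight att τ (fun i c => W i c (τ i)) f i)
            - Real.log (W i (f i) (τ i))) := by
        simp_rw [← Finset.sum_neg_distrib, neg_sub]
      rw [h2]; linarith
    · refine Finset.sum_congr rfl fun τ _ => ?_
      rw [Real.exp_sum]
      congr 1
      refine Finset.prod_congr rfl fun i _ => ?_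
      rw [Real.exp_sub, Real.exp_log (hW _ _ _), Real.exp_log (hS f hf τ i)]
  have h1 : (F.card : ℝ) * Real.exp (-L) ≤ 1 := by
    calc (F.card : ℝ) * Real.exp (-L) = ∑ f ∈ F, Real.exp (-L) := by simp
      _ ≤ ∑ f ∈ F, ∑ τ : R → Fin M, K⁻¹ *
            ∏ i, W i (f i) (τ i) / availWeight att τ (fun i c => W i c (τ i)) f i :=
          Finset.sum_le_sum hJ
      _ = ∑ τ : R → Fin M, K⁻¹ * ∑ f ∈ F,
            ∏ i, W i (f i) (τ i) / availWeight att τ (fun i c => W i c (τ i)) f i := by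
          rw [Finset.sum_comm]; simp_rw [Finset.mul_sum]
      _ ≤ ∑ τ : R → Fin M, K⁻¹ * 1 := by
          refine Finset.sum_le_sum fun τ _ => mul_le_mul_of_nonneg_left ?_ (by positivity)
          exact sum_prod_div_availWeight_le_one att τ (fun i c => W i c (τ i))
            (fun i c => hW _ _ _) F hF
      _ = 1 := by rw [← Finset.mul_sum, hKcard]; exact inv_mul_cancel₀ hKpos.ne'
  rw [Real.exp_neg, ← div_eq_mul_inv, div_le_one (Real.exp_pos _)] at h1
  exact h1

/-- The sum over clocks of a function of the clock of `i`, over the event that no `j ∈ A` rings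
before `i`. -/
lemma sum_clock_event {M : ℕ} (hM : 0 < M) (i : R) (A : Finset R) (hA : i ∉ A)
    (g : Fin M → ℝ) :
    ∑ τ : R → Fin M, (if ∀ j ∈ A, τ i ≤ τ j then g (τ i) else 0)
      = (M : ℝ) ^ Fintype.card R * ((M : ℝ)⁻¹ * ∑ k : Fin M, g k * (1 - (k : ℝ) / M) ^ A.card) := by
  classical
  have hM' : (M : ℝ) ≠ 0 := by positivity
  have hcard : ∀ k : Fin M, ((Finset.univ.filter fun τ : R → Fin M =>
      τ i = k ∧ ∀ j ∈ A, k ≤ τ j).card : ℝ)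
      = (M : ℝ) ^ Fintype.card R * (M : ℝ)⁻¹ * (1 - (k : ℝ) / M) ^ A.card := by
    intro k
    have h1 : (Finset.univ.filter fun τ : R → Fin M => τ i = k ∧ ∀ j ∈ A, k ≤ τ j)
        = Fintype.piFinset fun j => if j = i then {k} else if j ∈ A then Finset.Ici k
            else Finset.univ := by
      ext τ
      simp only [Finset.mem_filter, Finset.mem_univ, true_and, Fintype.mem_piFinset]
      constructor
      · rintro ⟨h1, h2⟩ j
        split_ifs with hj hj'
        · simp [hj, h1]
        · simpa using h2 j hj'
        · simp
      · intro h
        refine ⟨by simpa using h i, fun j hj => ?_⟩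
        have hji : j ≠ i := by rintro rfl; exact hA hj
        simpa [hji, hj] using h j
    rw [h1, Fintype.card_piFinset]
    have h2 : ∀ j : R, (((if j = i then {k} else if j ∈ A then Finset.Ici k
            else Finset.univ : Finset (Fin M)).card : ℕ) : ℝ)
        = M * ((if j = i then (M : ℝ)⁻¹ else 1) * (if j ∈ A then (1 - (k : ℝ) / M) else 1)) := by
      intro j
      split_ifs with hj hj' hj'
      · exact absurd (hj ▸ hj') hA
      · simp [hM']
      · rw [Fin.card_Ici, Nat.cast_sub k.2.le]; field_simp
      · simp
    push_cast
    simp_rw [h2]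
    rw [Finset.prod_mul_distrib, Finset.prod_mul_distrib, Finset.prod_ite_eq',
      Finset.prod_ite_mem]
    simp [mul_assoc]
  have h3 : ∀ τ : R → Fin M, (if ∀ j ∈ A, τ i ≤ τ j then g (τ i) else 0)
      = ∑ k : Fin M, if τ i = k ∧ ∀ j ∈ A, k ≤ τ j then g k else 0 := by
    intro τ
    rw [Finset.sum_eq_single (τ i)]
    · simp
    · intro k _ hk
      rw [if_neg]; rintro ⟨h, -⟩; exact hk h.symm
    · simp
  simp_rw [h3]
  rw [Finset.sum_comm, Finset.mul_sum, Finset.mul_sum]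
  refine Finset.sum_congr rfl fun k _ => ?_
  rw [← Finset.sum_filter, Finset.sum_const, nsmul_eq_mul, hcard k]
  ring

end SequentialCounting

section QueenFunctions

variable {n : ℕ}

/-- `f` describes an `n`-queens configuration with queens at `(x, f x)`. -/
structure IsQueenFun (f : Fin n → Fin n) : Prop where
  inj : Function.Injective f
  plus : Function.Injective fun x : Fin n => (x : ℕ) + f x
  minus : Function.Injective fun x : Fin n => (f x : ℕ) + n - x

open Classical in
/-- Indicator that the plus-diagonal with label `s` is occupied. -/
def plusOcc (f : Fin n → Fin n) (s : ℕ) : ℕ := if ∃ x : Fin n, (x : ℕ) + f x + 1 = s then 1 else 0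

open Classical in
/-- Indicator that the minus-diagonal with label `d` is occupied. -/
def minusOcc (f : Fin n → Fin n) (d : ℕ) : ℕ := if ∃ x : Fin n, (f x : ℕ) + n - x = d then 1 else 0

/-- Two squares `(j, c')` and `(i, c)` share a column or a diagonal. -/
def queenAttack (j c' i c : Fin n) : Prop :=
  c' = c ∨ (j : ℕ) + c' = i + c ∨ (c' : ℕ) + n - j = c + n - i

lemma IsQueenFun.not_queenAttack {f : Fin n → Fin n} (hf : IsQueenFun f) {i j : Fin n}
    (hij : j ≠ i) : ¬ queenAttack j (f j) i (f i) := by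
  rintro (h | h | h)
  · exact hij (hf.inj h)
  · exact hij (hf.plus h)
  · exact hij (hf.minus h)

open Classical in
/-- An empty square is attacked by at least as many queens as there are occupied lines
through it. -/
lemma IsQueenFun.occ_le_card_attackers {f : Fin n → Fin n} (hf : IsQueenFun f) {i c : Fin n}
    (hc : c ≠ f i) :
    1 + plusOcc f (i + c + 1) + minusOcc f (c + n - i)
      ≤ (Finset.univ.filter fun j => j ≠ i ∧ queenAttack j (f j) i c).card := by
  have hsurj : Function.Surjective f := Finite.surjective_of_injective hf.inj
  obtain ⟨x, hx⟩ := hsurj c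
  have hxi : x ≠ i := by rintro rfl; exact hc hx.symm
  set A := Finset.univ.filter fun j : Fin n => j ≠ i ∧ f j = c
  set B := Finset.univ.filter fun j : Fin n => j ≠ i ∧ (j : ℕ) + f j + 1 = i + c + 1
  set D := Finset.univ.filter fun j : Fin n => j ≠ i ∧ (f j : ℕ) + n - j = c + n - i
  have hA : 1 ≤ A.card := Finset.card_pos.mpr ⟨x, by simp [A, hx, hxi]⟩
  have hB : plusOcc f (i + c + 1) ≤ B.card := by
    unfold plusOcc
    split_ifs with h
    · obtain ⟨j, hj⟩ := h
      refine Finset.card_pos.mpr ⟨j, ?_⟩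
      simp only [B, Finset.mem_filter, Finset.mem_univ, true_and]
      refine ⟨?_, hj⟩
      rintro rfl
      exact hc (Fin.ext (by omega))
    · exact Nat.zero_le _
  have hD : minusOcc f (c + n - i) ≤ D.card := by
    unfold minusOcc
    split_ifs with h
    · obtain ⟨j, hj⟩ := h
      refine Finset.card_pos.mpr ⟨j, ?_⟩
      simp only [D, Finset.mem_filter, Finset.mem_univ, true_and]
      refine ⟨?_, hj⟩
      rintro rfl
      exact hc (Fin.ext (by omega))
    · exact Nat.zero_le _
  have hAB : Disjoint A B := by
    rw [Finset.disjoint_left]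
    intro j hj hj'
    simp only [A, B, Finset.mem_filter, Finset.mem_univ, true_and] at hj hj'
    obtain ⟨h1, rfl⟩ := hj
    exact h1 (Fin.ext (by omega))
  have hABD : Disjoint (A ∪ B) D := by
    rw [Finset.disjoint_left]
    intro j hj hj'
    simp only [A, B, D, Finset.mem_union, Finset.mem_filter, Finset.mem_univ, true_and] at hj hj'
    obtain ⟨h1, h2⟩ := hj'
    rcases hj with ⟨-, rfl⟩ | ⟨-, h3⟩
    · exact h1 (Fin.ext (by omega))
    · exact h1 (Fin.ext (by omega))
  calc 1 + plusOcc f (i + c + 1) + minusOcc f (c + n - i) ≤ A.card + B.card + D.card := by omega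
    _ = ((A ∪ B) ∪ D).card := by
        rw [Finset.card_union_of_disjoint hABD, Finset.card_union_of_disjoint hAB]
    _ ≤ _ := by
        refine Finset.card_le_card fun j hj => ?_
        simp only [A, B, D, Finset.mem_union, Finset.mem_filter, Finset.mem_univ, true_and]
          at hj
        rw [Finset.mem_filter]
        refine ⟨Finset.mem_univ _, ?_⟩
        rcases hj with (⟨h, h'⟩ | ⟨h, h'⟩) | ⟨h, h'⟩
        · exact ⟨h, Or.inl h'⟩
        · exact ⟨h, Or.inr (Or.inl (by omega))⟩
        · exact ⟨h, Or.inr (Or.inr h')⟩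

lemma one_sub_div_mem {M : ℕ} (k : Fin M) :
    0 < 1 - (k : ℝ) / M ∧ 1 - (k : ℝ) / M ≤ 1 := by
  have hM : (0:ℝ) < M := by have := k.pos; exact_mod_cast this
  have hk : (k : ℝ) < M := by exact_mod_cast k.2
  constructor
  · rw [sub_pos, div_lt_one hM]; exact hk
  · have : 0 ≤ (k : ℝ) / M := by positivity
    linarith

lemma IsQueenFun.sum_availWeight_le {M : ℕ} (hM : 0 < M) (W : Fin n → Fin n → Fin M → ℝ)
    (hW : ∀ i c k, 0 < W i c k) {f : Fin n → Fin n} (hf : IsQueenFun f) (i : Fin n) :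
    ∑ τ : Fin n → Fin M, availWeight queenAttack τ (fun i c => W i c (τ i)) f i
      ≤ (M : ℝ) ^ n * ((M : ℝ)⁻¹ * ∑ k : Fin M,
        (∑ c, W i c k * (1 - (k : ℝ) / M) ^ (1 + plusOcc f (i + c + 1) + minusOcc f (c + n - i))
          + W i (f i) k)) := by
  classical
  have hterm : ∀ c : Fin n, ∑ τ : Fin n → Fin M,
      (if IsAvail queenAttack τ f i c then W i c (τ i) else 0)
      ≤ (M : ℝ) ^ n * ((M : ℝ)⁻¹ * ∑ k : Fin M,
        (W i c k * (1 - (k : ℝ) / M) ^ (1 + plusOcc f (i + c + 1) + minusOcc f (c + n - i))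
          + if c = f i then W i c k else 0)) := by
    intro c
    set A := Finset.univ.filter fun j => j ≠ i ∧ queenAttack j (f j) i c with hA
    have h1 := sum_clock_event (R := Fin n) hM i A (by simp [hA]) (W i c)
    rw [Fintype.card_fin] at h1
    refine le_trans (Finset.sum_le_sum fun τ _ => ?_) (h1.le.trans ?_)
    · by_cases h : ∀ j ∈ A, τ i ≤ τ j
      · rw [if_pos h]; split_ifs
        · exact le_rfl
        · exact (hW _ _ _).le
      · rw [if_neg h, if_neg]
        push Not at h
        obtain ⟨j, hj, hlt⟩ := h
        intro h'
        exact h' j hlt (by simpa [hA] using (Finset.mem_filter.mp hj).2.2)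
    · refine mul_le_mul_of_nonneg_left (mul_le_mul_of_nonneg_left
        (Finset.sum_le_sum fun k _ => ?_) (by positivity)) (by positivity)
      obtain ⟨h0, h1⟩ := one_sub_div_mem k
      by_cases hc : c = f i
      · rw [if_pos hc]
        have := mul_le_of_le_one_right (hW i c k).le (pow_le_one₀ (n := A.card) h0.le h1)
        have : 0 ≤ W i c k * (1 - (k : ℝ) / M) ^
          (1 + plusOcc f (i + c + 1) + minusOcc f (c + n - i)) :=
            mul_nonneg (hW _ _ _).le (pow_nonneg h0.le _)
        linarith
      · rw [if_neg hc, add_zero]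
        exact mul_le_mul_of_nonneg_left
          (pow_le_pow_of_le_one h0.le h1 (hf.occ_le_card_attackers hc)) (hW _ _ _).le
  unfold availWeight
  rw [Finset.sum_comm]
  refine (Finset.sum_le_sum fun c _ => hterm c).trans (le_of_eq ?_)
  rw [← Finset.mul_sum, ← Finset.mul_sum, Finset.sum_comm]
  congr 2
  refine Finset.sum_congr rfl fun k _ => ?_
  rw [Finset.sum_add_distrib]
  simp

/-- The counting bound for families of queen configurations, in terms of an arbitrary weight
function. -/
lemma queens_card_le_exp (hn : 0 < n) {M : ℕ} (hM : 0 < M) (W : Fin n → Fin n → Fin M → ℝ)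
    (hW : ∀ i c k, 0 < W i c k) (F : Finset (Fin n → Fin n)) (hF : ∀ f ∈ F, IsQueenFun f) (L : ℝ)
    (hL : ∀ f ∈ F, (M : ℝ)⁻¹ * ∑ k : Fin M, (∑ x, -Real.log (W x (f x) k)
        + (n : ℝ)⁻¹ * (∑ x, ∑ y, W x y k *
            (1 - (k : ℝ) / M) ^ (1 + plusOcc f (x + y + 1) + minusOcc f (y + n - x))
          + ∑ x, W x (f x) k)) + n * Real.log n - n ≤ L) :
    (F.card : ℝ) ≤ Real.exp L := by
  classical
  have : Nonempty (Fin n) := ⟨⟨0, hn⟩⟩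
  have hn' : (0:ℝ) < n := by exact_mod_cast hn
  have hM' : (M : ℝ) ≠ 0 := by positivity
  refine card_le_exp_of_avg hM queenAttack W hW F
    (fun f hf i j hij => (hF f hf).not_queenAttack hij) L fun f hf => ?_
  rw [Fintype.card_fin]
  have hq := hF f hf
  have hlog : ∀ (τ : Fin n → Fin M) (i : Fin n),
      Real.log (availWeight queenAttack τ (fun i c => W i c (τ i)) f i)
      ≤ Real.log n - 1 + (n : ℝ)⁻¹ * availWeight queenAttack τ (fun i c => W i c (τ i)) f i := by
    intro τ i
    set S := availWeight queenAttack τ (fun i c => W i c (τ i)) f i with hS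
    have h : 0 < S := availWeight_pos _ τ _ (fun i c => hW i c (τ i)) fun j hj =>
      hq.not_queenAttack (by rintro rfl; exact lt_irrefl _ hj)
    have := Real.log_le_sub_one_of_pos (show 0 < (n : ℝ)⁻¹ * S by positivity)
    rw [Real.log_mul (by positivity) h.ne', Real.log_inv] at this
    linarith
  have hK : (∑ _τ : Fin n → Fin M, (1 : ℝ)) = (M : ℝ) ^ n := by simp
  have hlogW : ∀ i, ∑ τ : Fin n → Fin M, Real.log (W i (f i) (τ i))
      = (M : ℝ) ^ n * ((M : ℝ)⁻¹ * ∑ k : Fin M, Real.log (W i (f i) k)) := by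
    intro i
    have := sum_clock_event (R := Fin n) hM i ∅ (by simp) (fun k => Real.log (W i (f i) k))
    simpa using this
  calc ∑ τ : Fin n → Fin M, ∑ i,
        (Real.log (availWeight queenAttack τ (fun i c => W i c (τ i)) f i)
          - Real.log (W i (f i) (τ i)))
      ≤ ∑ τ : Fin n → Fin M, ∑ i, ((Real.log n - 1 + (n : ℝ)⁻¹ *
          availWeight queenAttack τ (fun i c => W i c (τ i)) f i)
          - Real.log (W i (f i) (τ i))) :=
        Finset.sum_le_sum fun τ _ => Finset.sum_le_sum fun i _ =>
          sub_le_sub_right (hlog τ i) _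
    _ = (M : ℝ) ^ n * (n * Real.log n - n) + ∑ i, ((n : ℝ)⁻¹ *
          ∑ τ : Fin n → Fin M, availWeight queenAttack τ (fun i c => W i c (τ i)) f i
          - ∑ τ : Fin n → Fin M, Real.log (W i (f i) (τ i))) := by
        rw [Finset.sum_comm]
        simp_rw [Finset.sum_sub_distrib, Finset.sum_add_distrib, ← Finset.mul_sum]
        simp
        ring
    _ ≤ (M : ℝ) ^ n * (n * Real.log n - n) + ∑ i : Fin n, ((n : ℝ)⁻¹ *
          ((M : ℝ) ^ n * ((M : ℝ)⁻¹ * ∑ k : Fin M,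
        (∑ c, W i c k * (1 - (k : ℝ) / M) ^ (1 + plusOcc f (i + c + 1) + minusOcc f (c + n - i))
          + W i (f i) k)))
          - (M : ℝ) ^ n * ((M : ℝ)⁻¹ * ∑ k : Fin M, Real.log (W i (f i) k))) := by
        gcongr with i _
        · exact hq.sum_availWeight_le hM W hW i
        · exact (hlogW i).ge
    _ = (M : ℝ) ^ n * ((M : ℝ)⁻¹ * ∑ k : Fin M, (∑ x, -Real.log (W x (f x) k)
        + (n : ℝ)⁻¹ * (∑ x : Fin n, ∑ y : Fin n, W x y k *
            (1 - (k : ℝ) / M) ^ (1 + plusOcc f (x + y + 1) + minusOcc f (y + n - x))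
          + ∑ x, W x (f x) k)) + n * Real.log n - n) := by
        have e1 : ∀ i : Fin n, (n : ℝ)⁻¹ *
          ((M : ℝ) ^ n * ((M : ℝ)⁻¹ * ∑ k : Fin M,
        (∑ c : Fin n, W i c k *
            (1 - (k : ℝ) / M) ^ (1 + plusOcc f (i + c + 1) + minusOcc f (c + n - i))
          + W i (f i) k)))
          - (M : ℝ) ^ n * ((M : ℝ)⁻¹ * ∑ k : Fin M, Real.log (W i (f i) k))
          = (M : ℝ) ^ n * (M : ℝ)⁻¹ * ∑ k : Fin M, (-Real.log (W i (f i) k) + (n : ℝ)⁻¹ *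
            (∑ c : Fin n, W i c k *
            (1 - (k : ℝ) / M) ^ (1 + plusOcc f (i + c + 1) + minusOcc f (c + n - i))
          + W i (f i) k)) := by
          intro i
          simp only [Finset.sum_add_distrib, ← Finset.mul_sum, Finset.sum_neg_distrib]
          ring
        simp_rw [e1]
        rw [← Finset.mul_sum, Finset.sum_comm]
        have e2 : ∀ k : Fin M, ∑ i : Fin n, (-Real.log (W i (f i) k) + (n : ℝ)⁻¹ *
            (∑ c : Fin n, W i c k *
            (1 - (k : ℝ) / M) ^ (1 + plusOcc f (i + c + 1) + minusOcc f (c + n - i))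
          + W i (f i) k)) = ∑ x, -Real.log (W x (f x) k)
        + (n : ℝ)⁻¹ * (∑ x : Fin n, ∑ y : Fin n, W x y k *
            (1 - (k : ℝ) / M) ^ (1 + plusOcc f (x + y + 1) + minusOcc f (y + n - x))
          + ∑ x, W x (f x) k) := by
          intro k
          rw [Finset.sum_add_distrib, ← Finset.mul_sum, Finset.sum_add_distrib]
        simp_rw [e2]
        ring
    _ ≤ (M : ℝ) ^ n * L := mul_le_mul_of_nonneg_left (hL f hf) (by positivity)

end QueenFunctions

section Strips

/-- Labels of the plus-diagonals of colour `c` in the `i`-th strip. -/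
def plusStrip (n N c i : ℕ) : Finset ℕ :=
  (Finset.range (2 * n)).filter fun s => (s + 1) % 2 = c ∧ s * N / n = i

/-- Labels of the minus-diagonals of colour `c` in the `j`-th strip. -/
def minusStrip (n N c j : ℕ) : Finset ℕ :=
  (Finset.range (2 * n)).filter fun d => (d + n) % 2 = c ∧ d * N / n = j

/-- A set of integers of equal parity and diameter less than `n / N` is small. -/
lemma card_le_of_same_parity {n N : ℕ} (hN : 0 < N) (T : Finset ℕ)
    (hpar : ∀ s ∈ T, ∀ s' ∈ T, s % 2 = s' % 2)
    (hdiam : ∀ s ∈ T, ∀ s' ∈ T, s ≤ s' → (s' - s) * N < n) :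
    (T.card : ℝ) ≤ n / (2 * N) + 1 := by
  rcases T.eq_empty_or_nonempty with rfl | hT
  · simp only [Finset.card_empty, Nat.cast_zero]; positivity
  obtain ⟨s₀, hs₀, hmin⟩ := T.exists_min_image id hT
  have hcard : T.card ≤ n / (2 * N) + 1 := by
    rw [← Finset.card_range (n / (2 * N) + 1)]
    refine Finset.card_le_card_of_injOn (fun s => (s - s₀) / 2) ?_ ?_
    · intro s hs
      simp only [Finset.coe_range, Set.mem_Iio, Nat.lt_succ_iff]
      have h1 := hdiam s₀ hs₀ s hs (hmin s hs)
      rw [Nat.le_div_iff_mul_le (by positivity)]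
      have h2 : (s - s₀) / 2 * 2 ≤ s - s₀ := Nat.div_mul_le_self _ _
      calc (s - s₀) / 2 * (2 * N) = ((s - s₀) / 2 * 2) * N := by ring
        _ ≤ (s - s₀) * N := Nat.mul_le_mul_right _ h2
        _ ≤ n := h1.le
    · intro s hs s' hs' h
      have h1 := hmin s hs
      have h2 := hmin s' hs'
      have h3 := hpar s hs s₀ hs₀
      have h4 := hpar s' hs' s₀ hs₀
      simp only [id] at h1 h2 h
      omega
  calc (T.card : ℝ) ≤ ((n / (2 * N) + 1 : ℕ) : ℝ) := by exact_mod_cast hcard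
    _ ≤ n / (2 * N) + 1 := by
        push_cast
        have : ((n / (2 * N) : ℕ) : ℝ) ≤ (n : ℝ) / ((2 * N : ℕ) : ℝ) := Nat.cast_div_le
        push_cast at this
        linarith

lemma sub_mul_lt_of_div_eq {n N s s' i : ℕ} (hn : 0 < n) (hs : s * N / n = i)
    (hs' : s' * N / n = i) : (s' - s) * N < n := by
  have h1 : i * n ≤ s * N := by rw [← hs]; exact Nat.div_mul_le_self _ _
  have h2 : s' * N < (i + 1) * n := by
    rw [← hs']; exact Nat.lt_mul_of_div_lt (Nat.lt_succ_self _) hn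
  rw [Nat.sub_mul]
  have : (i + 1) * n = i * n + n := by ring
  omega

lemma card_plusStrip_le {n N : ℕ} (hn : 0 < n) (hN : 0 < N) (c i : ℕ) :
    ((plusStrip n N c i).card : ℝ) ≤ n / (2 * N) + 1 := by
  refine card_le_of_same_parity hN _ ?_ ?_
  · intro s hs s' hs'
    simp only [plusStrip, Finset.mem_filter] at hs hs'
    omega
  · intro s hs s' hs' _
    simp only [plusStrip, Finset.mem_filter] at hs hs'
    exact sub_mul_lt_of_div_eq hn hs.2.2 hs'.2.2

lemma card_minusStrip_le {n N : ℕ} (hn : 0 < n) (hN : 0 < N) (c j : ℕ) :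
    ((minusStrip n N c j).card : ℝ) ≤ n / (2 * N) + 1 := by
  refine card_le_of_same_parity hN _ ?_ ?_
  · intro s hs s' hs'
    simp only [minusStrip, Finset.mem_filter] at hs hs'
    omega
  · intro s hs s' hs' _
    simp only [minusStrip, Finset.mem_filter] at hs hs'
    exact sub_mul_lt_of_div_eq hn hs.2.2 hs'.2.2

variable {n : ℕ}

lemma plusIndex_lt {N : ℕ} (hN : 0 < N) (x y : Fin n) :
    ((x : ℕ) + y + 1) * N / n < 2 * N := by
  have hx := x.2
  have hy := y.2
  rw [Nat.div_lt_iff_lt_mul (by omega)]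
  have : (x : ℕ) + y + 1 < 2 * n := by omega
  calc ((x : ℕ) + y + 1) * N < 2 * n * N := Nat.mul_lt_mul_of_pos_right this hN
    _ = 2 * N * n := by ring

lemma minusIndex_lt {N : ℕ} (hN : 0 < N) (x y : Fin n) :
    ((y : ℕ) + n - x) * N / n < 2 * N := by
  have hx := x.2
  have hy := y.2
  rw [Nat.div_lt_iff_lt_mul (by omega)]
  have : (y : ℕ) + n - x < 2 * n := by omega
  calc ((y : ℕ) + n - x) * N < 2 * n * N := Nat.mul_lt_mul_of_pos_right this hN
    _ = 2 * N * n := by ring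

/-- Sums over the board that depend on the cell and factor through the two diagonals are bounded
by sums over pairs of strips. -/
lemma board_sum_le {N : ℕ} (hN : 0 < N) (U : ℕ → ℕ → ℕ → ℝ) (g h : ℕ → ℝ)
    (hU : ∀ c i j, 0 ≤ U c i j) (hg : ∀ s, 0 ≤ g s) (hh : ∀ d, 0 ≤ h d) :
    ∑ x : Fin n, ∑ y : Fin n,
      U (((x : ℕ) + y) % 2) (((x : ℕ) + y + 1) * N / n) (((y : ℕ) + n - x) * N / n)
        * (g (x + y + 1) * h (y + n - x))
    ≤ ∑ c ∈ Finset.range 2, ∑ i ∈ Finset.range (2 * N), ∑ j ∈ Finset.range (2 * N),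
        U c i j * ((∑ s ∈ plusStrip n N c i, g s) * ∑ d ∈ minusStrip n N c j, h d) := by
  classical
  rw [← Fintype.sum_prod_type (f := fun z : Fin n × Fin n =>
    U (((z.1 : ℕ) + z.2) % 2) (((z.1 : ℕ) + z.2 + 1) * N / n) (((z.2 : ℕ) + n - z.1) * N / n)
        * (g (z.1 + z.2 + 1) * h (z.2 + n - z.1)))]
  have hmaps : ∀ z ∈ (Finset.univ : Finset (Fin n × Fin n)),
      ((((z.1 : ℕ) + z.2) % 2, ((z.1 : ℕ) + z.2 + 1) * N / n, ((z.2 : ℕ) + n - z.1) * N / n) :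
        ℕ × ℕ × ℕ)
      ∈ Finset.range 2 ×ˢ Finset.range (2 * N) ×ˢ Finset.range (2 * N) := by
    intro z _
    simp only [Finset.mem_product, Finset.mem_range]
    exact ⟨Nat.mod_lt _ (by norm_num), plusIndex_lt hN _ _, minusIndex_lt hN _ _⟩
  rw [← Finset.sum_fiberwise_of_maps_to hmaps, Finset.sum_product]
  simp_rw [Finset.sum_product]
  refine Finset.sum_le_sum fun c _ => Finset.sum_le_sum fun i _ => Finset.sum_le_sum fun j _ => ?_
  set Z := Finset.univ.filter fun z : Fin n × Fin n =>
    ((((z.1 : ℕ) + z.2) % 2, ((z.1 : ℕ) + z.2 + 1) * N / n, ((z.2 : ℕ) + n - z.1) * N / n) :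
        ℕ × ℕ × ℕ) = (c, i, j) with hZ
  have hZmem : ∀ z ∈ Z, ((z.1 : ℕ) + z.2) % 2 = c ∧ ((z.1 : ℕ) + z.2 + 1) * N / n = i ∧
      ((z.2 : ℕ) + n - z.1) * N / n = j := by
    intro z hz
    simpa [hZ, Prod.ext_iff] using hz
  calc _ = U c i j * ∑ z ∈ Z, g (z.1 + z.2 + 1) * h (z.2 + n - z.1) := by
        rw [Finset.mul_sum]
        refine Finset.sum_congr rfl fun z hz => ?_
        obtain ⟨h1, h2, h3⟩ := hZmem z hz
        rw [h1, h2, h3]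
    _ = U c i j * ∑ w ∈ Z.image fun z => ((z.1 : ℕ) + z.2 + 1, (z.2 : ℕ) + n - z.1),
          g w.1 * h w.2 := by
        rw [Finset.sum_image]
        intro z _ z' _ hzz
        simp only [Prod.mk.injEq] at hzz
        have := z.1.2
        have := z'.1.2
        refine Prod.ext (Fin.ext ?_) (Fin.ext ?_) <;> omega
    _ ≤ U c i j * ∑ w ∈ plusStrip n N c i ×ˢ minusStrip n N c j, g w.1 * h w.2 := by
        refine mul_le_mul_of_nonneg_left (Finset.sum_le_sum_of_subset_of_nonneg ?_
          fun w _ _ => mul_nonneg (hg _) (hh _)) (hU _ _ _)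
        intro w hw
        obtain ⟨z, hz, rfl⟩ := Finset.mem_image.mp hw
        obtain ⟨h1, h2, h3⟩ := hZmem z hz
        have hx := z.1.2
        have hy := z.2.2
        simp only [Finset.mem_product, plusStrip, minusStrip, Finset.mem_filter, Finset.mem_range]
        refine ⟨⟨by omega, by omega, h2⟩, by omega, by omega, h3⟩
    _ = _ := by rw [Finset.sum_product, Finset.sum_mul_sum]

/-- The number of queens of colour `c` in the `i`-th plus-strip. -/
def plusCount (N : ℕ) (f : Fin n → Fin n) (c i : ℕ) : ℕ :=
  (Finset.univ.filter fun x : Fin n =>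
    ((x : ℕ) + f x) % 2 = c ∧ ((x : ℕ) + f x + 1) * N / n = i).card

/-- The number of queens of colour `c` in the `j`-th minus-strip. -/
def minusCount (N : ℕ) (f : Fin n → Fin n) (c j : ℕ) : ℕ :=
  (Finset.univ.filter fun x : Fin n =>
    ((x : ℕ) + f x) % 2 = c ∧ ((f x : ℕ) + n - x) * N / n = j).card

/-- The number of queens of colour `c` in the cell `(i, j)`. -/
def cellCount (N : ℕ) (f : Fin n → Fin n) (c i j : ℕ) : ℕ :=
  (Finset.univ.filter fun x : Fin n =>
    ((x : ℕ) + f x) % 2 = c ∧ ((x : ℕ) + f x + 1) * N / n = i ∧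
      ((f x : ℕ) + n - x) * N / n = j).card

lemma sum_pow_indicator (T : Finset ℕ) (P : ℕ → Prop) [DecidablePred P] (t : ℝ) :
    ∑ s ∈ T, (1 - t) ^ (if P s then 1 else 0) = T.card - t * (T.filter P).card := by
  have : ∀ s ∈ T, (1 - t) ^ (if P s then 1 else 0) = 1 - t * (if P s then 1 else 0) := by
    intro s _; split_ifs <;> simp
  rw [Finset.sum_congr rfl this, Finset.sum_sub_distrib, ← Finset.mul_sum]
  simp

lemma IsQueenFun.sum_plusStrip_le {f : Fin n → Fin n} (hf : IsQueenFun f) (hn : 0 < n) {N : ℕ}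
    (hN : 0 < N) (c i : ℕ) {t : ℝ} (ht : 0 ≤ t) :
    ∑ s ∈ plusStrip n N c i, (1 - t) ^ plusOcc f s
      ≤ n / (2 * N) + 1 - t * plusCount N f c i := by
  classical
  unfold plusOcc
  rw [sum_pow_indicator]
  have h1 : plusCount N f c i ≤
      ((plusStrip n N c i).filter fun s => ∃ x : Fin n, (x : ℕ) + f x + 1 = s).card := by
    refine Finset.card_le_card_of_injOn (fun x : Fin n => (x : ℕ) + f x + 1) ?_ ?_
    · intro x hx
      simp only [Finset.coe_filter, Finset.mem_univ, true_and, Set.mem_ofPred_eq] at hx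
      simp only [Finset.coe_filter, plusStrip, Finset.mem_filter, Finset.mem_range,
        Set.mem_ofPred_eq]
      have := x.2
      have := (f x).2
      exact ⟨⟨by omega, by omega, hx.2⟩, x, rfl⟩
    · intro x _ y _ hxy
      exact hf.plus (by simpa using hxy)
  have h2 := card_plusStrip_le hn hN c i
  have h3 : t * (plusCount N f c i : ℝ) ≤ t * (((plusStrip n N c i).filter fun s =>
      ∃ x : Fin n, (x : ℕ) + f x + 1 = s).card : ℝ) :=
    mul_le_mul_of_nonneg_left (by exact_mod_cast h1) ht
  linarith

lemma IsQueenFun.sum_minusStrip_le {f : Fin n → Fin n} (hf : IsQueenFun f) (hn : 0 < n) {N : ℕ}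
    (hN : 0 < N) (c j : ℕ) {t : ℝ} (ht : 0 ≤ t) :
    ∑ d ∈ minusStrip n N c j, (1 - t) ^ minusOcc f d
      ≤ n / (2 * N) + 1 - t * minusCount N f c j := by
  classical
  unfold minusOcc
  rw [sum_pow_indicator]
  have h1 : minusCount N f c j ≤
      ((minusStrip n N c j).filter fun d => ∃ x : Fin n, (f x : ℕ) + n - x = d).card := by
    refine Finset.card_le_card_of_injOn (fun x : Fin n => (f x : ℕ) + n - x) ?_ ?_
    · intro x hx
      simp only [Finset.coe_filter, Finset.mem_univ, true_and, Set.mem_ofPred_eq] at hx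
      simp only [Finset.coe_filter, minusStrip, Finset.mem_filter, Finset.mem_range,
        Set.mem_ofPred_eq]
      have := x.2
      have := (f x).2
      exact ⟨⟨by omega, by omega, hx.2⟩, x, rfl⟩
    · intro x _ y _ hxy
      exact hf.minus (by simpa using hxy)
  have h2 := card_minusStrip_le hn hN c j
  have h3 : t * (minusCount N f c j : ℝ) ≤ t * (((minusStrip n N c j).filter fun d =>
      ∃ x : Fin n, (f x : ℕ) + n - x = d).card : ℝ) :=
    mul_le_mul_of_nonneg_left (by exact_mod_cast h1) ht
  linarith

/-- The weight used for the cell `(i, j)` of colour `c` at time `t`. -/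
def cellWeight (u : ℕ → ℕ → ℕ → ℝ) (P Q : ℕ → ℕ → ℝ) (t : ℝ) (c i j : ℕ) : ℝ :=
  u c i j / ((1 - t) * (1 - P c i * t) * (1 - Q c j * t))

lemma IsQueenFun.total_weight_le {f : Fin n → Fin n} (hf : IsQueenFun f) (hn : 0 < n) {N : ℕ}
    (hN : 0 < N) (u : ℕ → ℕ → ℕ → ℝ) (P Q : ℕ → ℕ → ℝ) (hu : ∀ c i j, 0 ≤ u c i j)
    (hP : ∀ c i, P c i ≤ 1) (hQ : ∀ c j, Q c j ≤ 1)
    {t κ : ℝ} (ht : 0 ≤ t) (ht1 : t < 1)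
    (hPκ : ∀ c ∈ Finset.range 2, ∀ i ∈ Finset.range (2 * N),
      n / (2 * N) + 1 - t * plusCount N f c i ≤ n / (2 * N) * (1 - P c i * t) * (1 + κ))
    (hQκ : ∀ c ∈ Finset.range 2, ∀ j ∈ Finset.range (2 * N),
      n / (2 * N) + 1 - t * minusCount N f c j ≤ n / (2 * N) * (1 - Q c j * t) * (1 + κ)) :
    ∑ x : Fin n, ∑ y : Fin n, cellWeight u P Q t (((x : ℕ) + y) % 2)
        (((x : ℕ) + y + 1) * N / n) (((y : ℕ) + n - x) * N / n)
        * (1 - t) ^ (1 + plusOcc f (x + y + 1) + minusOcc f (y + n - x))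
      ≤ (n / (2 * N)) ^ 2 * (1 + κ) ^ 2 * ∑ c ∈ Finset.range 2, ∑ i ∈ Finset.range (2 * N),
          ∑ j ∈ Finset.range (2 * N), u c i j := by
  have h1t : 0 < 1 - t := by linarith
  have hPt : ∀ c i, 0 < 1 - P c i * t := fun c i => by nlinarith [hP c i]
  have hQt : ∀ c i, 0 < 1 - Q c i * t := fun c i => by nlinarith [hQ c i]
  have hW : ∀ c i j, 0 ≤ cellWeight u P Q t c i j := fun c i j =>
    div_nonneg (hu c i j) (mul_pos (mul_pos h1t (hPt c i)) (hQt c j)).le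
  have hb := board_sum_le (n := n) hN (fun c i j => cellWeight u P Q t c i j * (1 - t))
    (fun s => (1 - t) ^ plusOcc f s) (fun d => (1 - t) ^ minusOcc f d)
    (fun c i j => mul_nonneg (hW c i j) h1t.le) (fun s => pow_nonneg h1t.le _)
    (fun s => pow_nonneg h1t.le _)
  refine le_trans (le_of_eq ?_) (hb.trans ?_)
  · refine Finset.sum_congr rfl fun x _ => Finset.sum_congr rfl fun y _ => ?_
    rw [pow_add, pow_add]; ring
  · simp_rw [Finset.mul_sum]
    refine Finset.sum_le_sum fun c hc => Finset.sum_le_sum fun i hi =>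
      Finset.sum_le_sum fun j hj => ?_
    simp_rw [← Finset.mul_sum]
    have hp := (hf.sum_plusStrip_le hn hN c i ht).trans (hPκ c hc i hi)
    have hq := (hf.sum_minusStrip_le hn hN c j ht).trans (hQκ c hc j hj)
    have hp0 : 0 ≤ ∑ s ∈ plusStrip n N c i, (1 - t) ^ plusOcc f s :=
      Finset.sum_nonneg fun s _ => pow_nonneg h1t.le _
    have hq0 : 0 ≤ ∑ d ∈ minusStrip n N c j, (1 - t) ^ minusOcc f d :=
      Finset.sum_nonneg fun s _ => pow_nonneg h1t.le _
    refine (mul_le_mul_of_nonneg_left (mul_le_mul hp hq hq0 (hp0.trans hp))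
      (mul_nonneg (hW c i j) h1t.le)).trans (le_of_eq ?_)
    unfold cellWeight
    have e1 := (hPt c i).ne'
    have e2 := (hQt c j).ne'
    have e3 := h1t.ne'
    generalize 1 - P c i * t = p at *
    generalize 1 - Q c j * t = q at *
    field_simp

end Strips

section RiemannSums

/-- The average of `log (1 - p t)` over the times `t = k / M`. -/
def logAvg (M : ℕ) (p : ℝ) : ℝ := (M : ℝ)⁻¹ * ∑ k : Fin M, Real.log (1 - p * ((k : ℝ) / M))

lemma mul_log_sub_le {A B : ℝ} (hB : 0 < B) (hBA : B ≤ A) :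
    (A - B) * Real.log B ≤ A * Real.log A - B * Real.log B - (A - B) := by
  have hA : 0 < A := hB.trans_le hBA
  have h := Real.one_sub_inv_le_log_of_pos (div_pos hA hB)
  rw [inv_div, Real.log_div hA.ne' hB.ne'] at h
  have h2 := mul_le_mul_of_nonneg_left h hA.le
  have h3 : A * (1 - B / A) = A - B := by field_simp
  nlinarith

lemma sum_log_le {p : ℝ} (hp0 : 0 ≤ p) (hp1 : p ≤ 1) {M : ℕ} (hM : 0 < M) (m : ℕ) (hm : m < M) :
    p / M * ∑ k ∈ Finset.range (m + 1), Real.log (1 - p * ((k : ℝ) / M))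
      ≤ -(1 - p * (m / M)) * Real.log (1 - p * (m / M)) - p * (m / M) := by
  have hM' : (0:ℝ) < M := by exact_mod_cast hM
  induction m with
  | zero => simp
  | succ m ih =>
    have ih := ih (by omega)
    rw [Finset.sum_range_succ, mul_add]
    have hlt : ((m + 1 : ℕ) : ℝ) / M < 1 := by
      rw [div_lt_one hM']; exact_mod_cast hm
    have hB : 0 < 1 - p * (((m + 1 : ℕ) : ℝ) / M) := by
      have : 0 ≤ ((m + 1 : ℕ) : ℝ) / M := by positivity
      nlinarith
    have hdiff : 1 - p * ((m : ℝ) / M) - (1 - p * (((m + 1 : ℕ) : ℝ) / M)) = p / M := by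
      push_cast; ring
    have h0 : 0 ≤ p / M := by positivity
    have h := mul_log_sub_le (A := 1 - p * ((m : ℝ) / M)) hB (by linarith)
    rw [hdiff] at h
    have hd : p * (((m + 1 : ℕ) : ℝ) / M) = p * (m / M) + p / M := by push_cast; ring
    linarith

lemma neg_mul_log_le_two_sqrt {h : ℝ} (h0 : 0 ≤ h) : -(h * Real.log h) ≤ 2 * √h := by
  rcases h0.eq_or_lt with rfl | hpos
  · simp
  have hs : 0 < √h := Real.sqrt_pos.mpr hpos
  have h1 := Real.log_le_sub_one_of_pos (inv_pos.mpr hs)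
  rw [Real.log_inv, Real.log_sqrt h0] at h1
  have h2 : h * (√h)⁻¹ = √h := by
    rw [← div_eq_mul_inv, Real.div_sqrt]
  nlinarith

lemma mul_log_sub_mul_log_add_le {A h : ℝ} (hA : 0 ≤ A) (hh : 0 ≤ h) :
    A * Real.log A - (A + h) * Real.log (A + h) ≤ -(h * Real.log h) := by
  rcases hA.eq_or_lt with rfl | hA
  · simp
  rcases hh.eq_or_lt with rfl | hh
  · simp
  have h1 := Real.log_le_log hA (by linarith : A ≤ A + h)
  have h2 := Real.log_le_log hh (by linarith : h ≤ A + h)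
  nlinarith

lemma mul_logAvg_le {p : ℝ} (hp0 : 0 ≤ p) (hp1 : p ≤ 1) {M : ℕ} (hM : 0 < M) :
    p * logAvg M p ≤ -(1 - p) * Real.log (1 - p) - p + 3 / √(M : ℝ) := by
  have hM' : (0:ℝ) < M := by exact_mod_cast hM
  obtain ⟨m, rfl⟩ : ∃ m, M = m + 1 := ⟨M - 1, by omega⟩
  have h := sum_log_le hp0 hp1 hM m (Nat.lt_succ_self m)
  have e1 : p * logAvg (m + 1) p = p / ((m + 1 : ℕ) : ℝ) *
      ∑ k ∈ Finset.range (m + 1), Real.log (1 - p * ((k : ℝ) / ((m + 1 : ℕ) : ℝ))) := by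
    unfold logAvg
    rw [Fin.sum_univ_eq_sum_range (fun k => Real.log (1 - p * ((k : ℝ) / ((m + 1 : ℕ) : ℝ))))]
    ring
  rw [e1]
  refine h.trans ?_
  set h' : ℝ := p / ((m + 1 : ℕ) : ℝ) with hh'
  have hh0 : 0 ≤ h' := by positivity
  have e2 : p * ((m : ℝ) / ((m + 1 : ℕ) : ℝ)) = p - h' := by
    rw [hh']; push_cast; field_simp; ring
  have hM1 : (1:ℝ) ≤ ((m + 1 : ℕ) : ℝ) := by exact_mod_cast Nat.le_add_left 1 m
  have hhM : h' ≤ (((m + 1 : ℕ) : ℝ))⁻¹ := by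
    rw [hh', div_eq_mul_inv]; exact mul_le_of_le_one_left (by positivity) hp1
  have hh1 : h' ≤ 1 := hhM.trans (inv_le_one_of_one_le₀ hM1)
  have hsq : √h' ≤ 1 / √((m + 1 : ℕ) : ℝ) := by
    rw [one_div, ← Real.sqrt_inv]; exact Real.sqrt_le_sqrt hhM
  have hle : h' ≤ √h' := Real.le_sqrt_of_sq_le (by nlinarith)
  have g1 := mul_log_sub_mul_log_add_le (sub_nonneg.mpr hp1) hh0
  have g2 := neg_mul_log_le_two_sqrt hh0
  rw [e2, show 1 - (p - h') = 1 - p + h' by ring]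
  have e3 : 3 / √((m + 1 : ℕ) : ℝ) = 3 * (1 / √((m + 1 : ℕ) : ℝ)) := by ring
  rw [e3]
  linarith

lemma neg_log_le_logAvg {p : ℝ} (hp1 : p ≤ 1) {M : ℕ} (hM : 0 < M) :
    -Real.log M ≤ logAvg M p := by
  have hM' : (0:ℝ) < M := by exact_mod_cast hM
  have h : ∀ k : Fin M, -Real.log M ≤ Real.log (1 - p * ((k : ℝ) / M)) := by
    intro k
    rw [← Real.log_inv]
    refine Real.log_le_log (by positivity) ?_
    have h1 : 0 ≤ (k : ℝ) / M := by positivity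
    have h2 : (k : ℝ) / M ≤ 1 - (M : ℝ)⁻¹ := by
      rw [div_le_iff₀ hM', sub_mul, inv_mul_cancel₀ hM'.ne', one_mul, le_sub_iff_add_le]
      exact_mod_cast k.2
    nlinarith
  unfold logAvg
  rw [← div_eq_inv_mul, le_div_iff₀ hM']
  calc -Real.log M * M = ∑ _k : Fin M, -Real.log M := by simp; ring
    _ ≤ _ := Finset.sum_le_sum fun k _ => h k

end RiemannSums

section CostEstimate

/-- The cell and strip masses of a pair of measures, abstractly. -/
structure CellData (N : ℕ) (a : ℕ → ℕ → ℕ → ℝ) (gP gM : ℕ → ℕ → ℝ) : Prop where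
  a_nonneg : ∀ c i j, 0 ≤ a c i j
  a_le_one : ∀ c i j, a c i j ≤ 1
  a_sum : ∑ c ∈ Finset.range 2, ∑ i ∈ Finset.range (2 * N), ∑ j ∈ Finset.range (2 * N), a c i j = 1
  gP_nonneg : ∀ c i, 0 ≤ gP c i
  gP_le : ∀ c i, 2 * N * gP c i ≤ 1
  gP_sum : 1 ≤ ∑ c ∈ Finset.range 2, ∑ i ∈ Finset.range (2 * N), gP c i
  gM_nonneg : ∀ c i, 0 ≤ gM c i
  gM_le : ∀ c i, 2 * N * gM c i ≤ 1
  gM_sum : 1 ≤ ∑ c ∈ Finset.range 2, ∑ i ∈ Finset.range (2 * N), gM c i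

variable {n : ℕ}

/-- The masses in the data exceed the corresponding densities of queens by at most `η`. -/
structure CloseTo (N : ℕ) (a : ℕ → ℕ → ℕ → ℝ) (gP gM : ℕ → ℕ → ℝ) (η : ℝ)
    (f : Fin n → Fin n) : Prop where
  cell : ∀ c ∈ Finset.range 2, ∀ i ∈ Finset.range (2 * N), ∀ j ∈ Finset.range (2 * N),
    a c i j ≤ cellCount N f c i j / n + η
  plus : ∀ c ∈ Finset.range 2, ∀ i ∈ Finset.range (2 * N), gP c i ≤ plusCount N f c i / n + η
  minus : ∀ c ∈ Finset.range 2, ∀ j ∈ Finset.range (2 * N), gM c j ≤ minusCount N f c j / n + η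

lemma sum_queens_cell {N : ℕ} (hN : 0 < N) (f : Fin n → Fin n) (g : ℕ → ℕ → ℕ → ℝ) :
    ∑ x : Fin n, g (((x : ℕ) + f x) % 2) (((x : ℕ) + f x + 1) * N / n) (((f x : ℕ) + n - x) * N / n)
      = ∑ c ∈ Finset.range 2, ∑ i ∈ Finset.range (2 * N), ∑ j ∈ Finset.range (2 * N),
        cellCount N f c i j * g c i j := by
  have hmaps : ∀ x ∈ (Finset.univ : Finset (Fin n)),
      ((((x : ℕ) + f x) % 2, ((x : ℕ) + f x + 1) * N / n, ((f x : ℕ) + n - x) * N / n) :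
        ℕ × ℕ × ℕ)
      ∈ Finset.range 2 ×ˢ Finset.range (2 * N) ×ˢ Finset.range (2 * N) := by
    intro x _
    simp only [Finset.mem_product, Finset.mem_range]
    exact ⟨Nat.mod_lt _ (by norm_num), plusIndex_lt hN _ _, minusIndex_lt hN _ _⟩
  rw [← Finset.sum_fiberwise_of_maps_to hmaps, Finset.sum_product]
  simp_rw [Finset.sum_product]
  refine Finset.sum_congr rfl fun c _ => Finset.sum_congr rfl fun i _ =>
    Finset.sum_congr rfl fun j _ => ?_
  unfold cellCount
  rw [← nsmul_eq_mul, ← Finset.sum_const]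
  simp only [Prod.mk.injEq]
  refine Finset.sum_congr rfl fun x hx => ?_
  obtain ⟨h1, h2, h3⟩ := (Finset.mem_filter.mp hx).2
  rw [h1, h2, h3]

lemma sum_queens_plus {N : ℕ} (hN : 0 < N) (f : Fin n → Fin n) (g : ℕ → ℕ → ℝ) :
    ∑ x : Fin n, g (((x : ℕ) + f x) % 2) (((x : ℕ) + f x + 1) * N / n)
      = ∑ c ∈ Finset.range 2, ∑ i ∈ Finset.range (2 * N), plusCount N f c i * g c i := by
  have hmaps : ∀ x ∈ (Finset.univ : Finset (Fin n)),
      ((((x : ℕ) + f x) % 2, ((x : ℕ) + f x + 1) * N / n) : ℕ × ℕ)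
      ∈ Finset.range 2 ×ˢ Finset.range (2 * N) := by
    intro x _
    simp only [Finset.mem_product, Finset.mem_range]
    exact ⟨Nat.mod_lt _ (by norm_num), plusIndex_lt hN _ _⟩
  rw [← Finset.sum_fiberwise_of_maps_to hmaps, Finset.sum_product]
  refine Finset.sum_congr rfl fun c _ => Finset.sum_congr rfl fun i _ => ?_
  unfold plusCount
  rw [← nsmul_eq_mul, ← Finset.sum_const]
  simp only [Prod.mk.injEq]
  refine Finset.sum_congr rfl fun x hx => ?_
  obtain ⟨h1, h2⟩ := (Finset.mem_filter.mp hx).2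
  rw [h1, h2]

lemma sum_queens_minus {N : ℕ} (hN : 0 < N) (f : Fin n → Fin n) (g : ℕ → ℕ → ℝ) :
    ∑ x : Fin n, g (((x : ℕ) + f x) % 2) (((f x : ℕ) + n - x) * N / n)
      = ∑ c ∈ Finset.range 2, ∑ j ∈ Finset.range (2 * N), minusCount N f c j * g c j := by
  have hmaps : ∀ x ∈ (Finset.univ : Finset (Fin n)),
      ((((x : ℕ) + f x) % 2, ((f x : ℕ) + n - x) * N / n) : ℕ × ℕ)
      ∈ Finset.range 2 ×ˢ Finset.range (2 * N) := by
    intro x _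
    simp only [Finset.mem_product, Finset.mem_range]
    exact ⟨Nat.mod_lt _ (by norm_num), minusIndex_lt hN _ _⟩
  rw [← Finset.sum_fiberwise_of_maps_to hmaps, Finset.sum_product]
  refine Finset.sum_congr rfl fun c _ => Finset.sum_congr rfl fun i _ => ?_
  unfold minusCount
  rw [← nsmul_eq_mul, ← Finset.sum_const]
  simp only [Prod.mk.injEq]
  refine Finset.sum_congr rfl fun x hx => ?_
  obtain ⟨h1, h2⟩ := (Finset.mem_filter.mp hx).2
  rw [h1, h2]

/-- Cost of the cells: `L¹`-closeness of the queen density to `a`. -/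
lemma cell_cost_le {ι : Type*} (s : Finset ι) (a b v : ι → ℝ) {η Λ : ℝ} (hη : 0 ≤ η)
    (hab : ∀ z ∈ s, a z ≤ b z + η) (hsum : ∑ z ∈ s, b z ≤ ∑ z ∈ s, a z)
    (hΛ : ∀ z ∈ s, |v z| ≤ Λ) (hΛ0 : 0 ≤ Λ) :
    ∑ z ∈ s, b z * v z ≤ ∑ z ∈ s, a z * v z + 2 * s.card * η * Λ := by
  have h1 : ∀ z ∈ s, b z * v z ≤ a z * v z + (b z - a z + 2 * η) * Λ := by
    intro z hz
    have h2 : |b z - a z| ≤ b z - a z + 2 * η := by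
      rw [abs_le]; constructor <;> linarith [hab z hz]
    have h3 : (b z - a z) * v z ≤ |b z - a z| * |v z| := by
      rw [← abs_mul]; exact le_abs_self _
    have h4 : |b z - a z| * |v z| ≤ (b z - a z + 2 * η) * Λ :=
      mul_le_mul h2 (hΛ z hz) (abs_nonneg _) ((abs_nonneg _).trans h2)
    linarith
  have h2 := Finset.sum_le_sum h1
  rw [Finset.sum_add_distrib, ← Finset.sum_mul, Finset.sum_add_distrib,
    Finset.sum_sub_distrib] at h2
  simp only [Finset.sum_const, nsmul_eq_mul] at h2
  nlinarith

/-- Cost of the diagonals. -/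
lemma diag_cost_le {N M : ℕ} (hN : 0 < N) (hM : 0 < M) (g b : ℕ → ℕ → ℝ) {η : ℝ} (hη : 0 ≤ η)
    (g_nonneg : ∀ c i, 0 ≤ g c i) (g_le : ∀ c i, 2 * N * g c i ≤ 1)
    (g_sum : 1 ≤ ∑ c ∈ Finset.range 2, ∑ i ∈ Finset.range (2 * N), g c i)
    (hgb : ∀ c ∈ Finset.range 2, ∀ i ∈ Finset.range (2 * N), g c i ≤ b c i + η) :
    ∑ c ∈ Finset.range 2, ∑ i ∈ Finset.range (2 * N), b c i * logAvg M (2 * N * g c i)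
      ≤ ∑ c ∈ Finset.range 2, ∑ i ∈ Finset.range (2 * N),
          -((1 - 2 * N * g c i) * Real.log (1 - 2 * N * g c i) / (2 * N)) - 1
        + 4 * N * η * Real.log M + 6 / √(M : ℝ) := by
  have hN' : (0:ℝ) < N := by exact_mod_cast hN
  have hM1 : (1:ℝ) ≤ M := by exact_mod_cast hM
  have hnonpos : ∀ c i, logAvg M (2 * N * g c i) ≤ 0 := by
    intro c i
    refine mul_nonpos_of_nonneg_of_nonpos (by positivity)
      (Finset.sum_nonpos fun k _ => Real.log_nonpos ?_ ?_)
    · obtain ⟨h1, h2⟩ := one_sub_div_mem k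
      have : 0 ≤ (k : ℝ) / M := by positivity
      nlinarith [g_le c i]
    · have : 0 ≤ 2 * N * g c i * ((k : ℝ) / M) := mul_nonneg (mul_nonneg (by positivity)
        (g_nonneg c i)) (by positivity)
      linarith
  have hterm : ∀ c ∈ Finset.range 2, ∀ i ∈ Finset.range (2 * N),
      b c i * logAvg M (2 * N * g c i) ≤
        (-((1 - 2 * N * g c i) * Real.log (1 - 2 * N * g c i) / (2 * N)) - g c i)
          + (η * Real.log M + 3 / √(M : ℝ) / (2 * N)) := by
    intro c hc i hi
    have h1 := hgb c hc i hi
    have h2 := hnonpos c i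
    have h3 := neg_log_le_logAvg (g_le c i) hM
    have h4 := mul_logAvg_le (mul_nonneg (by positivity) (g_nonneg c i)) (g_le c i) hM
    have h5 : g c i * logAvg M (2 * N * g c i)
        = (2 * N * g c i * logAvg M (2 * N * g c i)) / (2 * N) := by field_simp
    have h6 := div_le_div_of_nonneg_right h4 (by positivity : (0:ℝ) ≤ 2 * N)
    rw [← h5] at h6
    have h7 : (-(1 - 2 * N * g c i) * Real.log (1 - 2 * N * g c i) - 2 * N * g c i
        + 3 / √(M : ℝ)) / (2 * N) = -((1 - 2 * N * g c i) * Real.log (1 - 2 * N * g c i) / (2 * N))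
          - g c i + 3 / √(M : ℝ) / (2 * N) := by field_simp
    rw [h7] at h6
    nlinarith
  refine (Finset.sum_le_sum fun c hc => Finset.sum_le_sum fun i hi => hterm c hc i hi).trans ?_
  simp_rw [Finset.sum_add_distrib, Finset.sum_sub_distrib]
  simp only [Finset.sum_const, Finset.card_range, nsmul_eq_mul]
  have e : ((2 : ℕ) : ℝ) * (((2 * N : ℕ) : ℝ) * (η * Real.log M))
      + ((2 : ℕ) : ℝ) * (((2 * N : ℕ) : ℝ) * (3 / √(M : ℝ) / (2 * N)))
      = 4 * N * η * Real.log M + 6 / √(M : ℝ) := by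
    push_cast; field_simp; ring
  rw [e]
  linarith

end CostEstimate

section CardBound

variable {n : ℕ}

lemma strip_slack {N M : ℕ} (hn : 0 < n) (hN : 0 < N) (k : Fin M) {g b η : ℝ} (hη : 0 ≤ η)
    (hg : 2 * N * g ≤ 1) (hgb : g ≤ b / n + η) :
    (n : ℝ) / (2 * N) + 1 - (k : ℝ) / M * b
      ≤ n / (2 * N) * (1 - 2 * N * g * ((k : ℝ) / M)) * (1 + 2 * N * M * (η + 1 / n)) := by
  have hn' : (0:ℝ) < n := by exact_mod_cast hn
  have hN' : (0:ℝ) < N := by exact_mod_cast hN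
  have hM' : (0:ℝ) < M := by have := k.pos; exact_mod_cast this
  have ht0 : 0 ≤ (k : ℝ) / M := by positivity
  have ht1 : (M : ℝ)⁻¹ ≤ 1 - (k : ℝ) / M := by
    rw [le_sub_iff_add_le, ← one_div, ← add_div, div_le_one hM']
    have := k.2
    have : (k : ℕ) + 1 ≤ M := this
    have h : ((k : ℕ) : ℝ) + 1 ≤ M := by exact_mod_cast this
    linarith
  set t := (k : ℝ) / M
  have h1 : (M : ℝ)⁻¹ ≤ 1 - 2 * N * g * t := by nlinarith
  have h2 : n * (g - η) ≤ b := by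
    have : g - η ≤ b / n := by linarith
    rw [le_div_iff₀ hn'] at this; linarith
  have h3 : (n : ℝ) / (2 * N) * (M : ℝ)⁻¹ * (2 * N * M * (η + 1 / n)) = n * η + 1 := by
    field_simp
  have h4 : (n : ℝ) / (2 * N) * (M : ℝ)⁻¹ * (2 * N * M * (η + 1 / n))
      ≤ n / (2 * N) * (1 - 2 * N * g * t) * (2 * N * M * (η + 1 / n)) := by gcongr
  have h5 : (n : ℝ) / (2 * N) * (1 - 2 * N * g * t) = n / (2 * N) - n * g * t := by
    field_simp
  have h6 : t ≤ 1 := by have : 0 ≤ (M : ℝ)⁻¹ := by positivity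
                        linarith
  have h7 : t * (n * (g - η)) ≤ t * b := mul_le_mul_of_nonneg_left h2 ht0
  have h8 : t * (n * η) ≤ n * η := mul_le_of_le_one_left (by positivity) h6
  rw [mul_add (_ * _) 1, mul_one]
  rw [h5] at h4 ⊢
  linarith

lemma neg_log_cellWeight {u : ℕ → ℕ → ℕ → ℝ} {P Q : ℕ → ℕ → ℝ} {c i j M : ℕ} (k : Fin M)
    (hu : 0 < u c i j) (hP : P c i ≤ 1) (hQ : Q c j ≤ 1) :
    -Real.log (cellWeight u P Q ((k : ℝ) / M) c i j) = -Real.log (u c i j)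
      + Real.log (1 - 1 * ((k : ℝ) / M)) + Real.log (1 - P c i * ((k : ℝ) / M))
      + Real.log (1 - Q c j * ((k : ℝ) / M)) := by
  obtain ⟨h0, -⟩ := one_sub_div_mem k
  have ht : 0 ≤ (k : ℝ) / M := by positivity
  have h1 : 0 < 1 - P c i * ((k : ℝ) / M) := by nlinarith
  have h2 : 0 < 1 - Q c j * ((k : ℝ) / M) := by nlinarith
  unfold cellWeight
  rw [Real.log_div hu.ne' (by positivity), Real.log_mul (by positivity) h2.ne',
    Real.log_mul h0.ne' h1.ne', one_mul]
  ring

lemma cellWeight_pos {u : ℕ → ℕ → ℕ → ℝ} {P Q : ℕ → ℕ → ℝ} {c i j M : ℕ} (k : Fin M)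
    (hu : 0 < u c i j) (hP : P c i ≤ 1) (hQ : Q c j ≤ 1) :
    0 < cellWeight u P Q ((k : ℝ) / M) c i j := by
  obtain ⟨h0, -⟩ := one_sub_div_mem k
  have ht : 0 ≤ (k : ℝ) / M := by positivity
  have h1 : 0 < 1 - P c i * ((k : ℝ) / M) := by nlinarith
  have h2 : 0 < 1 - Q c j * ((k : ℝ) / M) := by nlinarith
  exact div_pos hu (by positivity)

lemma cellWeight_le {u : ℕ → ℕ → ℕ → ℝ} {P Q : ℕ → ℕ → ℝ} {c i j M : ℕ} (k : Fin M) {U : ℝ}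
    (hu : 0 < u c i j) (huU : u c i j ≤ U) (hP : P c i ≤ 1) (hQ : Q c j ≤ 1) :
    cellWeight u P Q ((k : ℝ) / M) c i j ≤ U * M ^ 3 := by
  have hM' : (0:ℝ) < M := by have := k.pos; exact_mod_cast this
  have ht0 : 0 ≤ (k : ℝ) / M := by positivity
  have ht1 : (M : ℝ)⁻¹ ≤ 1 - (k : ℝ) / M := by
    rw [le_sub_iff_add_le, ← one_div, ← add_div, div_le_one hM']
    have := k.2
    have : (k : ℕ) + 1 ≤ M := this
    have h : ((k : ℕ) : ℝ) + 1 ≤ M := by exact_mod_cast this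
    linarith
  have h1 : (M : ℝ)⁻¹ ≤ 1 - P c i * ((k : ℝ) / M) := by nlinarith
  have h2 : (M : ℝ)⁻¹ ≤ 1 - Q c j * ((k : ℝ) / M) := by nlinarith
  have h3 : (0:ℝ) < (M : ℝ)⁻¹ := by positivity
  unfold cellWeight
  calc _ ≤ U / ((M : ℝ)⁻¹ * (M : ℝ)⁻¹ * (M : ℝ)⁻¹) := by
        have h4 : 0 < 1 - (k : ℝ) / M := h3.trans_le ht1
        have h5 : 0 < 1 - P c i * ((k : ℝ) / M) := h3.trans_le h1
        have h6 : 0 ≤ U := hu.le.trans huU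
        gcongr
    _ = U * M ^ 3 := by field_simp

lemma sum_neg_log_cellWeight {N M : ℕ} (hN : 0 < N) (hM : 0 < M) (f : Fin n → Fin n)
    {u : ℕ → ℕ → ℕ → ℝ} {P Q : ℕ → ℕ → ℝ} (hu : ∀ c i j, 0 < u c i j) (hP : ∀ c i, P c i ≤ 1)
    (hQ : ∀ c j, Q c j ≤ 1) :
    (M : ℝ)⁻¹ * ∑ k : Fin M, ∑ x : Fin n, -Real.log (cellWeight u P Q ((k : ℝ) / M)
        (((x : ℕ) + f x) % 2) (((x : ℕ) + f x + 1) * N / n) (((f x : ℕ) + n - x) * N / n))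
      = ∑ c ∈ Finset.range 2, ∑ i ∈ Finset.range (2 * N), ∑ j ∈ Finset.range (2 * N),
          cellCount N f c i j * -Real.log (u c i j) + n * logAvg M 1
        + ∑ c ∈ Finset.range 2, ∑ i ∈ Finset.range (2 * N),
            plusCount N f c i * logAvg M (P c i)
        + ∑ c ∈ Finset.range 2, ∑ j ∈ Finset.range (2 * N),
            minusCount N f c j * logAvg M (Q c j) := by
  have hM' : (M : ℝ) ≠ 0 := by positivity
  rw [← sum_queens_cell hN, ← sum_queens_plus hN f fun c i => logAvg M (P c i),
    ← sum_queens_minus hN f fun c i => logAvg M (Q c i), Finset.sum_comm, Finset.mul_sum]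
  have hn1 : (n : ℝ) * logAvg M 1 = ∑ _x : Fin n, logAvg M 1 := by simp
  rw [hn1, ← Finset.sum_add_distrib, ← Finset.sum_add_distrib, ← Finset.sum_add_distrib]
  refine Finset.sum_congr rfl fun x _ => ?_
  rw [Finset.sum_congr rfl fun k _ => neg_log_cellWeight k (hu _ _ _) (hP _ _) (hQ _ _)]
  simp_rw [Finset.sum_add_distrib]
  unfold logAvg
  simp only [Finset.sum_const, Finset.card_univ, Fintype.card_fin, nsmul_eq_mul]
  field_simp

/-- The limiting cost per queen predicted by the cell data. -/
def cellEntropy (N : ℕ) (a : ℕ → ℕ → ℕ → ℝ) (gP gM : ℕ → ℕ → ℝ) : ℝ :=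
  (∑ c ∈ Finset.range 2, ∑ i ∈ Finset.range (2 * N), ∑ j ∈ Finset.range (2 * N),
      -(a c i j * Real.log (4 * N ^ 2 * a c i j)))
    + (∑ c ∈ Finset.range 2, ∑ i ∈ Finset.range (2 * N),
      -((1 - 2 * N * gP c i) * Real.log (1 - 2 * N * gP c i) / (2 * N)))
    + (∑ c ∈ Finset.range 2, ∑ i ∈ Finset.range (2 * N),
      -((1 - 2 * N * gM c i) * Real.log (1 - 2 * N * gM c i) / (2 * N))) - 3

/-- The error term in the bound on the number of queen functions close to given cell data. -/
def cellError (N M n : ℕ) (η δ Λ : ℝ) : ℝ :=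
  16 * N ^ 2 * η * Λ + 8 * N * η * Real.log M + 15 / √(M : ℝ)
    + ((1 + 2 * N * M * (η + 1 / n)) ^ 2 * (1 + 2 * δ) - 1) + (4 * N ^ 2 + δ) * M ^ 3 / n

lemma cells_cost_le {N : ℕ} (hn : 0 < n) (hN : 0 < N) {a : ℕ → ℕ → ℕ → ℝ} {gP gM : ℕ → ℕ → ℝ}
    (hd : CellData N a gP gM) {η δ Λ : ℝ} (hη : 0 ≤ η) (hδ : 0 < δ)
    (hδΛ : -Real.log δ ≤ Λ) (hNΛ : Real.log (4 * N ^ 2 + δ) ≤ Λ) (hΛ : 0 ≤ Λ)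
    {f : Fin n → Fin n} (hc : CloseTo N a gP gM η f) :
    ∑ c ∈ Finset.range 2, ∑ i ∈ Finset.range (2 * N), ∑ j ∈ Finset.range (2 * N),
        cellCount N f c i j * -Real.log (4 * N ^ 2 * a c i j + δ)
      ≤ n * (∑ c ∈ Finset.range 2, ∑ i ∈ Finset.range (2 * N), ∑ j ∈ Finset.range (2 * N),
          -(a c i j * Real.log (4 * N ^ 2 * a c i j)) + 16 * N ^ 2 * η * Λ) := by
  have hn' : (0:ℝ) < n := by exact_mod_cast hn
  have hu : ∀ c i j, δ ≤ 4 * N ^ 2 * a c i j + δ := fun c i j => by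
    have := hd.a_nonneg c i j
    have : 0 ≤ 4 * (N:ℝ) ^ 2 * a c i j := by positivity
    linarith
  set s := Finset.range 2 ×ˢ Finset.range (2 * N) ×ˢ Finset.range (2 * N) with hs
  have hcard : (s.card : ℝ) = 8 * N ^ 2 := by
    simp [hs]; ring
  have hsum : ∑ c ∈ Finset.range 2, ∑ i ∈ Finset.range (2 * N), ∑ j ∈ Finset.range (2 * N),
      (cellCount N f c i j : ℝ) / n = 1 := by
    have h := sum_queens_cell hN f fun _ _ _ => (n : ℝ)⁻¹
    simp only [Finset.sum_const, Finset.card_univ, Fintype.card_fin, nsmul_eq_mul] at h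
    rw [mul_inv_cancel₀ hn'.ne'] at h
    simpa [div_eq_mul_inv] using h.symm
  have h := cell_cost_le s (fun z => a z.1 z.2.1 z.2.2)
    (fun z => (cellCount N f z.1 z.2.1 z.2.2 : ℝ) / n)
    (fun z => -Real.log (4 * N ^ 2 * a z.1 z.2.1 z.2.2 + δ)) hη (Λ := Λ) ?_ ?_ ?_ hΛ
  · rw [hcard] at h
    simp only [hs, Finset.sum_product] at h
    have h2 : ∀ c i j, a c i j * -Real.log (4 * N ^ 2 * a c i j + δ)
        ≤ -(a c i j * Real.log (4 * N ^ 2 * a c i j)) := by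
      intro c i j
      rcases (hd.a_nonneg c i j).eq_or_lt with h0 | h0
      · simp [← h0]
      · have hN' : (0:ℝ) < N := by exact_mod_cast hN
        have := Real.log_le_log (by positivity : 0 < 4 * (N:ℝ) ^ 2 * a c i j)
          (by linarith : _ ≤ 4 * (N:ℝ) ^ 2 * a c i j + δ)
        nlinarith
    have h3 := Finset.sum_le_sum fun c (_ : c ∈ Finset.range 2) => Finset.sum_le_sum
      fun i (_ : i ∈ Finset.range (2 * N)) => Finset.sum_le_sum
      fun j (_ : j ∈ Finset.range (2 * N)) => h2 c i j
    have h4 := mul_le_mul_of_nonneg_left (h.trans (add_le_add_left h3 _)) hn'.le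
    refine le_trans (le_of_eq ?_) (h4.trans (le_of_eq ?_))
    · simp_rw [Finset.mul_sum]
      refine Finset.sum_congr rfl fun c _ => Finset.sum_congr rfl fun i _ =>
        Finset.sum_congr rfl fun j _ => ?_
      field_simp
    · ring
  · rintro ⟨c, i, j⟩ hz
    simp only [hs, Finset.mem_product] at hz
    exact hc.cell c hz.1 i hz.2.1 j hz.2.2
  · simp only [hs, Finset.sum_product]
    rw [hsum, hd.a_sum]
  · rintro ⟨c, i, j⟩ -
    simp only
    rw [abs_neg, abs_le]
    constructor
    · linarith [Real.log_le_log hδ (hu c i j)]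
    · refine le_trans (Real.log_le_log (hδ.trans_le (hu c i j)) ?_) hNΛ
      have := hd.a_le_one c i j
      have : 4 * (N:ℝ) ^ 2 * a c i j ≤ 4 * (N:ℝ) ^ 2 := mul_le_of_le_one_right (by positivity) this
      linarith

lemma strips_cost_le {N M : ℕ} (hn : 0 < n) (hN : 0 < N) (hM : 0 < M) {g : ℕ → ℕ → ℝ}
    {b : ℕ → ℕ → ℕ} {η : ℝ} (hη : 0 ≤ η)
    (g_nonneg : ∀ c i, 0 ≤ g c i) (g_le : ∀ c i, 2 * N * g c i ≤ 1)
    (g_sum : 1 ≤ ∑ c ∈ Finset.range 2, ∑ i ∈ Finset.range (2 * N), g c i)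
    (hgb : ∀ c ∈ Finset.range 2, ∀ i ∈ Finset.range (2 * N), g c i ≤ (b c i : ℝ) / n + η) :
    ∑ c ∈ Finset.range 2, ∑ i ∈ Finset.range (2 * N), (b c i : ℝ) * logAvg M (2 * N * g c i)
      ≤ n * (∑ c ∈ Finset.range 2, ∑ i ∈ Finset.range (2 * N),
          -((1 - 2 * N * g c i) * Real.log (1 - 2 * N * g c i) / (2 * N)) - 1
        + 4 * N * η * Real.log M + 6 / √(M : ℝ)) := by
  have hn' : (0:ℝ) < n := by exact_mod_cast hn
  refine le_trans (le_of_eq ?_) (mul_le_mul_of_nonneg_left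
    (diag_cost_le hN hM g (fun c i => (b c i : ℝ) / n) hη g_nonneg g_le g_sum hgb) hn'.le)
  simp_rw [Finset.mul_sum]
  refine Finset.sum_congr rfl fun c _ => Finset.sum_congr rfl fun i _ => ?_
  field_simp

/-- The number of queen functions close to given cell data. -/
lemma card_closeTo_le {N M : ℕ} (hn : 0 < n) (hN : 0 < N) (hM : 0 < M) {a : ℕ → ℕ → ℕ → ℝ}
    {gP gM : ℕ → ℕ → ℝ} (hd : CellData N a gP gM) {η δ Λ : ℝ} (hη : 0 ≤ η) (hδ : 0 < δ)
    (hδΛ : -Real.log δ ≤ Λ) (hNΛ : Real.log (4 * N ^ 2 + δ) ≤ Λ) (hΛ : 0 ≤ Λ)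
    (F : Finset (Fin n → Fin n)) (hF : ∀ f ∈ F, IsQueenFun f)
    (hc : ∀ f ∈ F, CloseTo N a gP gM η f) :
    (F.card : ℝ) ≤
      Real.exp (n * (Real.log n + cellEntropy N a gP gM + cellError N M n η δ Λ)) := by
  have hn' : (0:ℝ) < n := by exact_mod_cast hn
  have hN' : (0:ℝ) < N := by exact_mod_cast hN
  have hM' : (0:ℝ) < M := by exact_mod_cast hM
  set u : ℕ → ℕ → ℕ → ℝ := fun c i j => 4 * N ^ 2 * a c i j + δ with hudef
  set P : ℕ → ℕ → ℝ := fun c i => 2 * N * gP c i with hPdef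
  set Q : ℕ → ℕ → ℝ := fun c i => 2 * N * gM c i with hQdef
  have hu : ∀ c i j, 0 < u c i j := fun c i j => by
    have := hd.a_nonneg c i j
    positivity
  have huU : ∀ c i j, u c i j ≤ 4 * N ^ 2 + δ := fun c i j => by
    have : 4 * (N:ℝ) ^ 2 * a c i j ≤ 4 * (N:ℝ) ^ 2 :=
      mul_le_of_le_one_right (by positivity) (hd.a_le_one c i j)
    simp only [hudef]; linarith
  have hP : ∀ c i, P c i ≤ 1 := hd.gP_le
  have hQ : ∀ c i, Q c i ≤ 1 := hd.gM_le
  refine queens_card_le_exp hn hM (fun x y k => cellWeight u P Q ((k : ℝ) / M)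
    (((x : ℕ) + y) % 2) (((x : ℕ) + y + 1) * N / n) (((y : ℕ) + n - x) * N / n))
    (fun x y k => cellWeight_pos k (hu _ _ _) (hP _ _) (hQ _ _)) F hF _ fun f hf => ?_
  have hcl := hc f hf
  set κ := 2 * N * M * (η + 1 / n) with hκ
  have husum : ∑ c ∈ Finset.range 2, ∑ i ∈ Finset.range (2 * N), ∑ j ∈ Finset.range (2 * N),
      u c i j = 4 * N ^ 2 * (1 + 2 * δ) := by
    simp only [hudef, Finset.sum_add_distrib, ← Finset.mul_sum, hd.a_sum]
    simp only [Finset.sum_const, Finset.card_range, nsmul_eq_mul]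
    push_cast; ring
  have htot : ∀ k : Fin M, (n : ℝ)⁻¹ * (∑ x : Fin n, ∑ y : Fin n, cellWeight u P Q ((k : ℝ) / M)
      (((x : ℕ) + y) % 2) (((x : ℕ) + y + 1) * N / n) (((y : ℕ) + n - x) * N / n)
        * (1 - (k : ℝ) / M) ^ (1 + plusOcc f (x + y + 1) + minusOcc f (y + n - x))
      + ∑ x : Fin n, cellWeight u P Q ((k : ℝ) / M)
      (((x : ℕ) + f x) % 2) (((x : ℕ) + f x + 1) * N / n) (((f x : ℕ) + n - x) * N / n))
      ≤ n * (1 + κ) ^ 2 * (1 + 2 * δ) + (4 * N ^ 2 + δ) * M ^ 3 := by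
    intro k
    obtain ⟨h0, -⟩ := one_sub_div_mem k
    have h1 := (hF f hf).total_weight_le hn hN u P Q (fun c i j => (hu c i j).le) hP hQ
      (t := (k : ℝ) / M) (κ := κ) (by positivity) (by linarith)
      (fun c hc i hi => strip_slack hn hN k hη (hd.gP_le c i) (hcl.plus c hc i hi))
      (fun c hc i hi => strip_slack hn hN k hη (hd.gM_le c i) (hcl.minus c hc i hi))
    have h2 : ∑ x : Fin n, cellWeight u P Q ((k : ℝ) / M) (((x : ℕ) + f x) % 2)
        (((x : ℕ) + f x + 1) * N / n) (((f x : ℕ) + n - x) * N / n)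
        ≤ n * ((4 * N ^ 2 + δ) * M ^ 3) := by
      refine (Finset.sum_le_sum fun x _ => cellWeight_le k (hu _ _ _) (huU _ _ _)
        (hP _ _) (hQ _ _)).trans (le_of_eq ?_)
      simp
    rw [husum] at h1
    refine (mul_le_mul_of_nonneg_left (add_le_add h1 h2) (by positivity)).trans (le_of_eq ?_)
    field_simp
    ring
  rw [Finset.sum_add_distrib, mul_add, sum_neg_log_cellWeight hN hM f hu hP hQ]
  have hW : (M : ℝ)⁻¹ * ∑ k : Fin M, ((n : ℝ)⁻¹ * (∑ x : Fin n, ∑ y : Fin n,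
      cellWeight u P Q ((k : ℝ) / M)
      (((x : ℕ) + y) % 2) (((x : ℕ) + y + 1) * N / n) (((y : ℕ) + n - x) * N / n)
        * (1 - (k : ℝ) / M) ^ (1 + plusOcc f (x + y + 1) + minusOcc f (y + n - x))
      + ∑ x : Fin n, cellWeight u P Q ((k : ℝ) / M)
      (((x : ℕ) + f x) % 2) (((x : ℕ) + f x + 1) * N / n) (((f x : ℕ) + n - x) * N / n)))
      ≤ n * (1 + κ) ^ 2 * (1 + 2 * δ) + (4 * N ^ 2 + δ) * M ^ 3 := by
    refine (mul_le_mul_of_nonneg_left (Finset.sum_le_sum fun k _ => htot k)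
      (by positivity)).trans (le_of_eq ?_)
    simp only [Finset.sum_const, Finset.card_univ, Fintype.card_fin, nsmul_eq_mul]
    field_simp
  have hA := cells_cost_le hn hN hd hη hδ hδΛ hNΛ hΛ hcl
  have hPc := strips_cost_le (b := plusCount N f) hn hN hM hη hd.gP_nonneg hd.gP_le hd.gP_sum
    hcl.plus
  have hQc := strips_cost_le (b := minusCount N f) hn hN hM hη hd.gM_nonneg hd.gM_le hd.gM_sum
    hcl.minus
  have h1 : logAvg M 1 ≤ -1 + 3 / √(M : ℝ) := by
    have := mul_logAvg_le zero_le_one le_rfl hM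
    simpa using this
  have h1' := mul_le_mul_of_nonneg_left h1 hn'.le
  refine (sub_le_sub_right (add_le_add_left (add_le_add (add_le_add (add_le_add (add_le_add
    hA h1') hPc) hQc) hW) _) _).trans (le_of_eq ?_)
  unfold cellEntropy cellError
  rw [← hκ]
  generalize (∑ c ∈ Finset.range 2, ∑ i ∈ Finset.range (2 * N), ∑ j ∈ Finset.range (2 * N),
    -(a c i j * Real.log (4 * N ^ 2 * a c i j))) = A
  generalize (∑ c ∈ Finset.range 2, ∑ i ∈ Finset.range (2 * N),
    -((1 - 2 * N * gP c i) * Real.log (1 - 2 * N * gP c i) / (2 * N))) = B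
  generalize (∑ c ∈ Finset.range 2, ∑ i ∈ Finset.range (2 * N),
    -((1 - 2 * N * gM c i) * Real.log (1 - 2 * N * gM c i) / (2 * N))) = C
  field_simp
  ring

end CardBound

section Queenons

lemma queenon_isOpen_le {γ : ProbabilityMeasure (ℝ × ℝ)} (hγ : γ ∈ queenons) {U : Set (ℝ × ℝ)}
    (hU : IsOpen U) {c : ℝ≥0∞}
    (h : ∀ μ : ProbabilityMeasure (ℝ × ℝ), IsPermuton μ.toMeasure → μ.toMeasure U ≤ c) :
    γ.toMeasure U ≤ c := by
  obtain ⟨u, hu, hlim⟩ := mem_closure_iff_ultrafilter.mp hγ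
  have ht : Tendsto (id : ProbabilityMeasure (ℝ × ℝ) → _) u (𝓝 γ) := hlim
  refine (ProbabilityMeasure.le_liminf_measure_open_of_tendsto ht hU).trans
    (liminf_le_of_frequently_le' (Eventually.frequently ?_))
  filter_upwards [hu] with μ hμ
  obtain ⟨_, -, hp, -⟩ := hμ.1
  exact h μ hp

/-- The part of the plane outside the centred square of side `1 - 2r`. -/
def frame (r : ℝ) : Set (ℝ × ℝ) := {p | 1 / 2 - r < |p.1| ∨ 1 / 2 - r < |p.2|}

lemma isOpen_frame (r : ℝ) : IsOpen (frame r) := by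
  have h1 : IsOpen {p : ℝ × ℝ | 1 / 2 - r < |p.1|} := isOpen_lt (by fun_prop) (by fun_prop)
  have h2 : IsOpen {p : ℝ × ℝ | 1 / 2 - r < |p.2|} := isOpen_lt (by fun_prop) (by fun_prop)
  exact h1.union h2

lemma measurableSet_unitSq : MeasurableSet unitSq := measurableSet_Icc.prod measurableSet_Icc

lemma IsPermuton.frame_le {μ : Measure (ℝ × ℝ)} (hμ : IsPermuton μ) {r : ℝ} (h0 : 0 ≤ r)
    (h1 : r ≤ 1) : μ (frame r) ≤ ENNReal.ofReal (4 * r) := by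
  obtain ⟨-, hs, hm⟩ := hμ
  obtain ⟨hr1, hr2⟩ := hm (1 / 2 - r) (1 / 2) (by linarith) (by linarith) (by linarith)
  obtain ⟨hl1, hl2⟩ := hm (-1 / 2) (-1 / 2 + r) (by linarith) (by linarith) (by linarith)
  set I := Set.Icc (-(1:ℝ) / 2) (1 / 2)
  have hsub : frame r ⊆ unitSqᶜ ∪ ((Set.Icc (1 / 2 - r) (1 / 2) ×ˢ I ∪ I ×ˢ Set.Icc (1 / 2 - r) (1 / 2))
      ∪ (Set.Icc (-1 / 2) (-1 / 2 + r) ×ˢ I ∪ I ×ˢ Set.Icc (-1 / 2) (-1 / 2 + r))) := by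
    rintro ⟨x, y⟩ hp
    by_cases hu : (x, y) ∈ unitSq
    · right
      obtain ⟨hx, hy⟩ := hu
      simp only [frame, Set.mem_ofPred_eq, lt_abs] at hp
      simp only [Set.mem_union, Set.mem_prod, Set.mem_Icc, I] at hx hy ⊢
      rcases hp with (h | h) | (h | h)
      · exact Or.inl (Or.inl ⟨⟨h.le, hx.2⟩, hy⟩)
      · exact Or.inr (Or.inl ⟨⟨hx.1, by linarith⟩, hy⟩)
      · exact Or.inl (Or.inr ⟨hx, ⟨h.le, hy.2⟩⟩)
      · exact Or.inr (Or.inr ⟨hx, ⟨hy.1, by linarith⟩⟩)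
    · exact Or.inl hu
  calc μ (frame r) ≤ _ := measure_mono hsub
    _ ≤ μ unitSqᶜ + ((μ _ + μ _) + (μ _ + μ _)) := by
      refine (measure_union_le _ _).trans (add_le_add_right ((measure_union_le _ _).trans ?_) _)
      exact add_le_add (measure_union_le _ _) (measure_union_le _ _)
    _ = ENNReal.ofReal (4 * r) := by
      rw [hs, hr1, hr2, hl1, hl2, zero_add, ← ENNReal.ofReal_add, ← ENNReal.ofReal_add,
        ← ENNReal.ofReal_add] <;> first | linarith | (congr 1; ring)

lemma le_volume_of_Ioc_le {ν : Measure ℝ} (h : ∀ a b, a ≤ b → ν (Set.Ioc a b) ≤ ENNReal.ofReal (b - a)) :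
    ν ≤ volume := by
  rw [Real.volume_eq_stieltjes_id, ← Measure.toOuterMeasure_le, StieltjesFunction.measure_def]
  change ν.toOuterMeasure ≤ StieltjesFunction.id.outer
  unfold StieltjesFunction.outer
  rw [OuterMeasure.le_ofFunction]
  intro s
  rw [StieltjesFunction.length_eq]
  refine le_iInf fun a => le_iInf fun b => le_iInf fun hs => ?_
  have hbot : s \ botSet = s :=
    sdiff_eq_left.mpr (Set.disjoint_left.mpr fun x _ hx => not_isBot x hx)
  rw [hbot] at hs
  refine (measure_mono hs).trans ?_
  rcases le_total a b with hab | hab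
  · exact h a b hab
  · simp [Set.Ioc_eq_empty (not_lt.mpr hab)]

lemma le_half_volume {ν : Measure ℝ} (hs : ν (Set.Icc (-1) 1)ᶜ = 0)
    (h : ∀ a b, -1 ≤ a → a ≤ b → b ≤ 1 → ν (Set.Icc a b) ≤ ENNReal.ofReal ((b - a) / 2)) :
    ν ≤ (2 : ℝ≥0∞)⁻¹ • volume.restrict (Set.Icc (-1:ℝ) 1) := by
  have h2 : (2 : ℝ≥0∞) • ν ≤ volume := by
    refine le_volume_of_Ioc_le fun a b hab => ?_
    have hsub : Set.Ioc a b ⊆ (Set.Icc (-1) 1)ᶜ ∪ Set.Icc (max a (-1)) (min b 1) := by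
      intro x hx
      by_cases hx1 : x ∈ Set.Icc (-1:ℝ) 1
      · exact Or.inr ⟨max_le hx.1.le hx1.1, le_min hx.2 hx1.2⟩
      · exact Or.inl hx1
    have h3 : ν (Set.Ioc a b) ≤ ENNReal.ofReal ((b - a) / 2) := by
      refine (measure_mono hsub).trans ((measure_union_le _ _).trans ?_)
      rw [hs, zero_add]
      rcases le_total (max a (-1)) (min b 1) with hle | hle
      · refine (h _ _ (le_max_right _ _) hle (min_le_right _ _)).trans (ENNReal.ofReal_le_ofReal ?_)
        linarith [min_le_left b 1, le_max_left a (-1)]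
      · rcases hle.eq_or_lt with he | hlt
        · refine (h _ _ (le_max_right _ _) he.ge (min_le_right _ _)).trans
            (ENNReal.ofReal_le_ofReal ?_)
          linarith [min_le_left b 1, le_max_left a (-1)]
        · simp [Set.Icc_eq_empty (not_le.mpr hlt)]
    rw [Measure.smul_apply, smul_eq_mul]
    calc 2 * ν (Set.Ioc a b) ≤ 2 * ENNReal.ofReal ((b - a) / 2) := by gcongr
      _ = ENNReal.ofReal (b - a) := by
        rw [← ENNReal.ofReal_ofNat 2, ← ENNReal.ofReal_mul (by norm_num)]
        congr 1; ring
  have h3 : ν = ν.restrict (Set.Icc (-1:ℝ) 1) :=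
    (Measure.restrict_eq_self_of_ae_mem (mem_ae_iff.mpr hs)).symm
  rw [h3]
  refine Measure.le_iff.mpr fun s hms => ?_
  have h4 := Measure.le_iff'.mp h2 (s ∩ Set.Icc (-1:ℝ) 1)
  rw [Measure.smul_apply, Measure.restrict_apply hms, Measure.restrict_apply hms]
  rw [Measure.smul_apply, smul_eq_mul] at h4
  rw [smul_eq_mul, ← ENNReal.div_eq_inv_mul, ENNReal.le_div_iff_mul_le (by simp) (by simp), mul_comm]
  exact h4

/-- The properties of a BW-decomposition, indexed by colour, that enter the upper bound. -/
structure BWPair (γ : ℕ → Measure (ℝ × ℝ)) : Prop where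
  total : γ 0 Set.univ + γ 1 Set.univ = 1
  finite : ∀ c, IsFiniteMeasure (γ c)
  supp : ∀ c, γ c unitSqᶜ = 0
  frame_le : ∀ r, 0 ≤ r → r ≤ 1 → γ 0 (frame r) + γ 1 (frame r) ≤ ENNReal.ofReal (4 * r)
  plus : ∀ c, (γ c).map (fun p => p.1 + p.2) ≤ (2 : ℝ≥0∞)⁻¹ • volume.restrict (Set.Icc (-1:ℝ) 1)
  minus : ∀ c, (γ c).map (fun p => p.1 - p.2) ≤ (2 : ℝ≥0∞)⁻¹ • volume.restrict (Set.Icc (-1:ℝ) 1)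

lemma memBW.bwPair {γb γw : Measure (ℝ × ℝ)} (h : memBW γb γw) :
    BWPair fun c => if c = 0 then γb else γw := by
  obtain ⟨γ, hγ, hsum, hd⟩ := h
  have happ : ∀ s, γb s + γw s = γ.toMeasure s := fun s => by rw [← hsum, Measure.add_apply]
  have hsupp : γ.toMeasure unitSqᶜ = 0 := by
    refine le_antisymm (queenon_isOpen_le hγ ?_ fun μ hμ => hμ.2.1.le) zero_le
    exact (isClosed_Icc.prod isClosed_Icc).isOpen_compl
  have hle : ∀ (c : ℕ) s, (if c = 0 then γb else γw) s ≤ γ.toMeasure s := by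
    intro c s
    rw [← happ s]
    split_ifs
    · exact le_self_add
    · exact le_add_self
  have hsupp' : ∀ c : ℕ, (if c = 0 then γb else γw) unitSqᶜ = 0 := fun c =>
    le_antisymm ((hle c _).trans hsupp.le) zero_le
  refine ⟨?_, fun c => ⟨(hle c _).trans_lt (measure_lt_top _ _)⟩, hsupp', fun r h0 h1 => ?_,
    fun c => ?_, fun c => ?_⟩
  · simp [happ]
  · simp only [if_true, one_ne_zero, if_false, happ]
    exact queenon_isOpen_le hγ (isOpen_frame r) fun μ hμ => hμ.frame_le h0 h1
  · refine le_half_volume ?_ fun a b ha hab hb => ?_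
    · rw [Measure.map_apply (by fun_prop) measurableSet_Icc.compl]
      refine measure_mono_null ?_ (hsupp' c)
      rintro ⟨x, y⟩ hp hu
      obtain ⟨⟨h1, h2⟩, h3, h4⟩ := hu
      exact hp ⟨by simp only at *; linarith, by simp only at *; linarith⟩
    · rw [Measure.map_apply (by fun_prop) measurableSet_Icc]
      have := hd a b ha hab hb
      split_ifs
      · exact this.1.1
      · exact this.2.1
  · refine le_half_volume ?_ fun a b ha hab hb => ?_
    · rw [Measure.map_apply (by fun_prop) measurableSet_Icc.compl]
      refine measure_mono_null ?_ (hsupp' c)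
      rintro ⟨x, y⟩ hp hu
      obtain ⟨⟨h1, h2⟩, h3, h4⟩ := hu
      exact hp ⟨by simp only at *; linarith, by simp only at *; linarith⟩
    · rw [Measure.map_apply (by fun_prop) measurableSet_Icc]
      have := hd a b ha hab hb
      split_ifs
      · exact this.1.2
      · exact this.2.2

end Queenons

section Cells

lemma mem_INcell_succ {N i j : ℕ} {p : ℝ × ℝ} : p ∈ INcell N (i + 1) (j + 1) ↔
    p ∈ unitSq ∧ (-1 + (i : ℝ) / N ≤ p.1 + p.2 ∧ p.1 + p.2 ≤ -1 + ((i : ℝ) + 1) / N) ∧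
      (-1 + (j : ℝ) / N ≤ p.2 - p.1 ∧ p.2 - p.1 ≤ -1 + ((j : ℝ) + 1) / N) := by
  simp only [INcell, Nat.cast_add, Nat.cast_one, add_sub_cancel_right, Set.mem_ofPred_eq]

lemma JNcell_succ (N i : ℕ) :
    JNcell N (i + 1) = Set.Icc (-1 + (i : ℝ) / N) (-1 + ((i : ℝ) + 1) / N) := by
  simp [JNcell]

lemma measurableSet_INcell (N i j : ℕ) : MeasurableSet (INcell N i j) := by
  have h1 : Measurable fun p : ℝ × ℝ => p.1 + p.2 := by fun_prop
  have h2 : Measurable fun p : ℝ × ℝ => p.2 - p.1 := by fun_prop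
  exact measurableSet_unitSq.inter ((h1 measurableSet_Icc).inter (h2 measurableSet_Icc))

lemma exists_strip {N : ℕ} (hN : 0 < N) {s : ℝ} (h0 : -1 ≤ s) (h1 : s ≤ 1) :
    ∃ i < 2 * N, -1 + (i : ℝ) / N ≤ s ∧ s ≤ -1 + ((i : ℝ) + 1) / N := by
  have hN' : (0:ℝ) < N := by exact_mod_cast hN
  rcases h1.eq_or_lt with rfl | h1
  · refine ⟨2 * N - 1, by omega, ?_, ?_⟩ <;>
      · rw [Nat.cast_sub (by omega)]
        push_cast
        rw [← sub_nonneg]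
        field_simp
        try linarith
  · have hs : 0 ≤ (s + 1) * N := mul_nonneg (by linarith) hN'.le
    refine ⟨⌊(s + 1) * N⌋₊, ?_, ?_, ?_⟩
    · rw [Nat.floor_lt hs]; push_cast; nlinarith
    · have := Nat.floor_le hs
      rw [← div_le_iff₀ hN'] at this
      linarith
    · have := (Nat.lt_floor_add_one ((s + 1) * N)).le
      rw [← le_div_iff₀ hN'] at this
      linarith

lemma unitSq_subset_iUnion_INcell {N : ℕ} (hN : 0 < N) :
    unitSq ⊆ ⋃ z ∈ Finset.range (2 * N) ×ˢ Finset.range (2 * N), INcell N (z.1 + 1) (z.2 + 1) := by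
  rintro ⟨x, y⟩ hp
  obtain ⟨⟨h1, h2⟩, h3, h4⟩ := id hp
  simp only at h1 h2 h3 h4
  obtain ⟨i, hi, hi1, hi2⟩ := exists_strip hN (s := x + y) (by linarith) (by linarith)
  obtain ⟨j, hj, hj1, hj2⟩ := exists_strip hN (s := y - x) (by linarith) (by linarith)
  simp only [Set.mem_iUnion]
  exact ⟨(i, j), by simp [hi, hj], mem_INcell_succ.mpr ⟨hp, ⟨hi1, hi2⟩, hj1, hj2⟩⟩

/-- Distance of the `i`-th strip from the centre, in units of the strip width. -/
def stripRadius (N i : ℕ) : ℕ := max (N - i) (i + 1 - N)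

lemma abs_mem_of_mem_strip {N i : ℕ} (hN : 0 < N) {s : ℝ} (h0 : -1 + (i : ℝ) / N ≤ s)
    (h1 : s ≤ -1 + ((i : ℝ) + 1) / N) :
    ((stripRadius N i : ℝ) - 1) / N ≤ |s| ∧ |s| ≤ (stripRadius N i : ℝ) / N := by
  have hN' : (0:ℝ) < N := by exact_mod_cast hN
  rw [← sub_nonneg] at h0 h1
  rcases lt_or_ge i N with h | h
  · have hm : (stripRadius N i : ℝ) = N - i := by
      rw [stripRadius, max_eq_left (by omega), Nat.cast_sub h.le]
    have hle : ((i : ℝ) + 1) ≤ N := by exact_mod_cast h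
    have hs : s ≤ 0 := by
      have : ((i : ℝ) + 1) / N ≤ 1 := by rwa [div_le_one hN']
      linarith
    rw [hm, abs_of_nonpos hs, ← sub_nonneg, ← sub_nonneg (b := -s)]
    constructor
    · refine h1.trans (le_of_eq ?_); field_simp; ring
    · refine h0.trans (le_of_eq ?_); field_simp; ring
  · have hm : (stripRadius N i : ℝ) = i + 1 - N := by
      rw [stripRadius, max_eq_right (by omega), Nat.cast_sub (by omega)]; push_cast; ring
    have hle : (N : ℝ) ≤ i := by exact_mod_cast h
    have hs : 0 ≤ s := by
      have : 1 ≤ (i : ℝ) / N := by rwa [one_le_div hN']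
      linarith
    rw [hm, abs_of_nonneg hs, ← sub_nonneg, ← sub_nonneg (b := s)]
    constructor
    · refine h0.trans (le_of_eq ?_); field_simp; ring
    · refine h1.trans (le_of_eq ?_); field_simp; ring

/-- Half of the `i`-th strip, the one closer to the centre. -/
lemma exists_half_strip {N i : ℕ} (hN : 0 < N) : ∃ s₀ : ℝ, -1 + (i : ℝ) / N ≤ s₀ ∧
    s₀ + 1 / (2 * N) ≤ -1 + ((i : ℝ) + 1) / N ∧
    ∀ s, s₀ ≤ s → s ≤ s₀ + 1 / (2 * N) → |s| ≤ ((stripRadius N i : ℝ) - 1 / 2) / N := by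
  have hN' : (0:ℝ) < N := by exact_mod_cast hN
  have hpos : (0:ℝ) < 1 / (2 * N) := by positivity
  have e1 : ((i : ℝ) + 1) / N = i / N + 1 / (2 * N) + 1 / (2 * N) := by field_simp; ring
  rcases lt_or_ge i N with h | h
  · have hm : (stripRadius N i : ℝ) = N - i := by
      rw [stripRadius, max_eq_left (by omega), Nat.cast_sub h.le]
    have hle : ((i : ℝ) + 1) ≤ N := by exact_mod_cast h
    have h1 : ((i : ℝ) + 1) / N ≤ 1 := by rwa [div_le_one hN']
    refine ⟨-1 + (i : ℝ) / N + 1 / (2 * N), by linarith, by linarith, fun s hs1 hs2 => ?_⟩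
    have e2 : ((N : ℝ) - i - 1 / 2) / N = 1 - i / N - 1 / (2 * N) := by field_simp
    rw [hm, e2, abs_of_nonpos (by linarith)]
    linarith
  · have hm : (stripRadius N i : ℝ) = i + 1 - N := by
      rw [stripRadius, max_eq_right (by omega), Nat.cast_sub (by omega)]; push_cast; ring
    have hle : (N : ℝ) ≤ i := by exact_mod_cast h
    have h1 : 1 ≤ (i : ℝ) / N := by rwa [one_le_div hN']
    refine ⟨-1 + (i : ℝ) / N, le_rfl, by linarith, fun s hs1 hs2 => ?_⟩
    have e2 : ((i : ℝ) + 1 - N - 1 / 2) / N = i / N - 1 + 1 / (2 * N) := by field_simp; ring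
    rw [hm, e2, abs_of_nonneg (by linarith)]
    linarith

lemma mem_unitSq_of_abs_add_abs_le {p : ℝ × ℝ} (h : |p.1 + p.2| + |p.2 - p.1| ≤ 1) :
    p ∈ unitSq := by
  have h1 := abs_le.mp (show |p.1 + p.2| ≤ 1 - |p.2 - p.1| by linarith)
  have h2 := le_abs_self (p.2 - p.1)
  have h3 := neg_le_abs (p.2 - p.1)
  refine ⟨⟨?_, ?_⟩, ?_, ?_⟩ <;> linarith [h1.1, h1.2]

lemma volume_diamond (s d : ℝ) {h : ℝ} (h0 : 0 ≤ h) :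
    volume {p : ℝ × ℝ | (s ≤ p.1 + p.2 ∧ p.1 + p.2 ≤ s + h) ∧ d ≤ p.2 - p.1 ∧ p.2 - p.1 ≤ d + h}
      = ENNReal.ofReal (h ^ 2 / 2) := by
  set L := Matrix.toLin (Module.Basis.finTwoProd ℝ) (Module.Basis.finTwoProd ℝ)
    !![(1:ℝ), 1; -1, 1] with hL
  have hdet : LinearMap.det L = 2 := by
    rw [hL, LinearMap.det_toLin, Matrix.det_fin_two_of]; norm_num
  have hpre : {p : ℝ × ℝ | (s ≤ p.1 + p.2 ∧ p.1 + p.2 ≤ s + h) ∧ d ≤ p.2 - p.1 ∧ p.2 - p.1 ≤ d + h}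
      = L ⁻¹' (Set.Icc s (s + h) ×ˢ Set.Icc d (d + h)) := by
    ext p
    simp only [hL, Set.mem_preimage, Matrix.toLin_finTwoProd_apply, Set.mem_prod, Set.mem_Icc,
      Set.mem_ofPred_eq]
    rw [show 1 * p.1 + 1 * p.2 = p.1 + p.2 by ring, show -1 * p.1 + 1 * p.2 = p.2 - p.1 by ring]
  rw [hpre, Measure.addHaar_preimage_linearMap _ (by rw [hdet]; norm_num), hdet,
    Measure.volume_eq_prod, Measure.prod_prod, Real.volume_Icc, Real.volume_Icc,
    ← ENNReal.ofReal_mul (by linarith), ← ENNReal.ofReal_mul (by positivity)]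
  congr 1
  rw [abs_of_pos (by norm_num)]
  ring

lemma volume_INcell_lt_top (N i j : ℕ) : volume (INcell N i j) < ⊤ := by
  refine (measure_mono (t := unitSq) fun p hp => hp.1).trans_lt ?_
  exact (isCompact_Icc.prod isCompact_Icc).measure_lt_top

lemma le_volume_INcell_of_interior {N i j : ℕ} (hN : 0 < N)
    (h : stripRadius N i + stripRadius N j ≤ N) :
    1 / (2 * (N:ℝ) ^ 2) ≤ (volume (INcell N (i + 1) (j + 1))).toReal := by
  have hN' : (0:ℝ) < N := by exact_mod_cast hN
  have hv := volume_diamond (-1 + (i : ℝ) / N) (-1 + (j : ℝ) / N) (h := 1 / (N:ℝ)) (by positivity)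
  rw [← ENNReal.ofReal_le_iff_le_toReal (volume_INcell_lt_top _ _ _).ne]
  refine le_trans (le_of_eq ?_) (hv.symm.le.trans (measure_mono ?_))
  · congr 1; field_simp
  · rintro p ⟨⟨h1, h2⟩, h3, h4⟩
    have e : ∀ k : ℕ, -1 + (k : ℝ) / N + 1 / N = -1 + ((k : ℝ) + 1) / N := fun k => by ring
    rw [e] at h2 h4
    refine mem_INcell_succ.mpr ⟨mem_unitSq_of_abs_add_abs_le ?_, ⟨h1, h2⟩, h3, h4⟩
    refine (add_le_add (abs_mem_of_mem_strip hN h1 h2).2 (abs_mem_of_mem_strip hN h3 h4).2).trans ?_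
    rw [← add_div, div_le_one hN']
    exact_mod_cast h

lemma le_volume_INcell_of_boundary {N i j : ℕ} (hN : 0 < N)
    (h : stripRadius N i + stripRadius N j = N + 1) :
    1 / (8 * (N:ℝ) ^ 2) ≤ (volume (INcell N (i + 1) (j + 1))).toReal := by
  have hN' : (0:ℝ) < N := by exact_mod_cast hN
  obtain ⟨s, hs1, hs2, hs⟩ := exists_half_strip (i := i) hN
  obtain ⟨d, hd1, hd2, hd⟩ := exists_half_strip (i := j) hN
  have hv := volume_diamond s d (h := 1 / (2 * (N:ℝ))) (by positivity)
  rw [← ENNReal.ofReal_le_iff_le_toReal (volume_INcell_lt_top _ _ _).ne]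
  refine le_trans (le_of_eq ?_) (hv.symm.le.trans (measure_mono ?_))
  · congr 1; field_simp; norm_num
  · rintro p ⟨⟨h1, h2⟩, h3, h4⟩
    refine mem_INcell_succ.mpr ⟨mem_unitSq_of_abs_add_abs_le ?_, ⟨by linarith, by linarith⟩,
      by linarith, by linarith⟩
    refine (add_le_add (hs _ h1 h2) (hd _ h3 h4)).trans ?_
    rw [← add_div, div_le_one hN']
    have : (stripRadius N i : ℝ) + stripRadius N j = N + 1 := by exact_mod_cast h
    linarith

lemma abs_add_abs_le_of_mem_unitSq {p : ℝ × ℝ} (h : p ∈ unitSq) :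
    |p.1 + p.2| + |p.2 - p.1| ≤ 1 := by
  obtain ⟨⟨h1, h2⟩, h3, h4⟩ := h
  rcases abs_cases (p.1 + p.2) with h5 | h5 <;> rcases abs_cases (p.2 - p.1) with h6 | h6 <;>
    linarith

lemma INcell_subset_frame {N i j : ℕ} (hN : 0 < N)
    (h : stripRadius N i + stripRadius N j = N + 1) :
    INcell N (i + 1) (j + 1) ⊆ frame (1 / N) := by
  have hN' : (0:ℝ) < N := by exact_mod_cast hN
  intro p hp
  obtain ⟨-, ⟨h1, h2⟩, h3, h4⟩ := mem_INcell_succ.mp hp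
  have h5 := add_le_add (abs_mem_of_mem_strip hN h1 h2).1 (abs_mem_of_mem_strip hN h3 h4).1
  have h6 : (stripRadius N i : ℝ) + stripRadius N j = N + 1 := by exact_mod_cast h
  rw [← add_div, show (stripRadius N i : ℝ) - 1 + (stripRadius N j - 1) = N - 1 by linarith] at h5
  have e : ((N:ℝ) - 1) / N = 1 - 1 / N := by field_simp
  rw [e] at h5
  have hpos : (0:ℝ) < 1 / N := by positivity
  by_contra hcon
  simp only [frame, Set.mem_ofPred_eq, not_or, not_lt] at hcon
  obtain ⟨hx, hy⟩ := hcon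
  rw [abs_le] at hx hy
  rcases abs_cases (p.1 + p.2) with h7 | h7 <;> rcases abs_cases (p.2 - p.1) with h8 | h8 <;>
    linarith

end Cells

section Masses

/-- The mass of a cell of colour `c`. -/
def cellMass (γ : ℕ → Measure (ℝ × ℝ)) (N c i j : ℕ) : ℝ :=
  (γ c (INcell N (i + 1) (j + 1))).toReal

/-- The mass of a plus-strip of colour `c`. -/
def plusMass (γ : ℕ → Measure (ℝ × ℝ)) (N c i : ℕ) : ℝ :=
  (γ c ((fun p => p.1 + p.2) ⁻¹' JNcell N (i + 1))).toReal

/-- The mass of a minus-strip of colour `c`. -/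
def minusMass (γ : ℕ → Measure (ℝ × ℝ)) (N c j : ℕ) : ℝ :=
  (γ c ((fun p => p.2 - p.1) ⁻¹' JNcell N (j + 1))).toReal

variable {γ : ℕ → Measure (ℝ × ℝ)}

lemma half_volume_Icc_le (a b : ℝ) :
    ((2 : ℝ≥0∞)⁻¹ • volume.restrict (Set.Icc (-1:ℝ) 1)) (Set.Icc a b)
      ≤ ENNReal.ofReal ((b - a) / 2) := by
  rw [Measure.smul_apply, smul_eq_mul]
  calc (2 : ℝ≥0∞)⁻¹ * volume.restrict (Set.Icc (-1:ℝ) 1) (Set.Icc a b)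
      ≤ (2 : ℝ≥0∞)⁻¹ * volume (Set.Icc a b) := by gcongr; exact Measure.restrict_le_self
    _ = ENNReal.ofReal ((b - a) / 2) := by
      rw [Real.volume_Icc, mul_comm, ← div_eq_mul_inv, ENNReal.ofReal_div_of_pos (by norm_num)]
      simp

lemma BWPair.plus_Icc_le (h : BWPair γ) (c : ℕ) (a b : ℝ) :
    γ c ((fun p => p.1 + p.2) ⁻¹' Set.Icc a b) ≤ ENNReal.ofReal ((b - a) / 2) := by
  rw [← Measure.map_apply (by fun_prop) measurableSet_Icc]
  exact (Measure.le_iff'.mp (h.plus c) _).trans (half_volume_Icc_le a b)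

lemma preimage_sub_Icc (a b : ℝ) : (fun p : ℝ × ℝ => p.2 - p.1) ⁻¹' Set.Icc a b
    = (fun p : ℝ × ℝ => p.1 - p.2) ⁻¹' Set.Icc (-b) (-a) := by
  ext p
  simp only [Set.mem_preimage, Set.mem_Icc]
  constructor <;> rintro ⟨h1, h2⟩ <;> constructor <;> linarith

lemma BWPair.minus_Icc_le (h : BWPair γ) (c : ℕ) (a b : ℝ) :
    γ c ((fun p => p.2 - p.1) ⁻¹' Set.Icc a b) ≤ ENNReal.ofReal ((b - a) / 2) := by
  rw [preimage_sub_Icc, ← Measure.map_apply (by fun_prop) measurableSet_Icc]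
  refine (Measure.le_iff'.mp (h.minus c) _).trans ((half_volume_Icc_le _ _).trans (le_of_eq ?_))
  congr 1; ring

lemma BWPair.plus_line (h : BWPair γ) (c : ℕ) (v : ℝ) : γ c {p | p.1 + p.2 = v} = 0 := by
  have := h.plus_Icc_le c v v
  simpa [Set.preimage] using this

lemma BWPair.minus_line (h : BWPair γ) (c : ℕ) (v : ℝ) : γ c {p | p.2 - p.1 = v} = 0 := by
  have := h.minus_Icc_le c v v
  simpa [Set.preimage] using this

lemma strip_inter_subset {N i i' : ℕ} (hii : i ≠ i') {s : ℝ}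
    (h : -1 + (i : ℝ) / N ≤ s ∧ s ≤ -1 + ((i : ℝ) + 1) / N)
    (h' : -1 + (i' : ℝ) / N ≤ s ∧ s ≤ -1 + ((i' : ℝ) + 1) / N) :
    s = -1 + ((max i i' : ℕ) : ℝ) / N := by
  rcases lt_or_gt_of_ne hii with hlt | hlt
  · rw [max_eq_right hlt.le]
    have h1 : ((i : ℝ) + 1) / N ≤ i' / N := by
      gcongr; exact_mod_cast hlt
    linarith [h.2, h'.1]
  · rw [max_eq_left hlt.le]
    have h1 : ((i' : ℝ) + 1) / N ≤ i / N := by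
      gcongr; exact_mod_cast hlt
    linarith [h'.2, h.1]

lemma BWPair.aedisjoint_INcell (h : BWPair γ) (N c : ℕ) (s : Set (ℕ × ℕ)) :
    s.Pairwise fun z w => AEDisjoint (γ c) (INcell N (z.1 + 1) (z.2 + 1))
      (INcell N (w.1 + 1) (w.2 + 1)) := by
  rintro ⟨i, j⟩ - ⟨i', j'⟩ - hne
  by_cases hi : i = i'
  · have hj : j ≠ j' := fun hj => hne (by rw [hi, hj])
    refine measure_mono_null (fun p hp => ?_) (h.minus_line c (-1 + ((max j j' : ℕ) : ℝ) / N))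
    exact strip_inter_subset hj (mem_INcell_succ.mp hp.1).2.2 (mem_INcell_succ.mp hp.2).2.2
  · refine measure_mono_null (fun p hp => ?_) (h.plus_line c (-1 + ((max i i' : ℕ) : ℝ) / N))
    exact strip_inter_subset hi (mem_INcell_succ.mp hp.1).2.1 (mem_INcell_succ.mp hp.2).2.1

lemma BWPair.sum_cellMass (h : BWPair γ) (N c : ℕ) (T : Finset (ℕ × ℕ)) :
    ∑ z ∈ T, cellMass γ N c z.1 z.2
      = (γ c (⋃ z ∈ T, INcell N (z.1 + 1) (z.2 + 1))).toReal := by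
  have := h.finite c
  rw [measure_biUnion_finset₀ (h.aedisjoint_INcell N c T)
    (fun z _ => (measurableSet_INcell _ _ _).nullMeasurableSet),
    ENNReal.toReal_sum fun z _ => measure_ne_top _ _]
  rfl

lemma BWPair.total_toReal (h : BWPair γ) :
    (γ 0 Set.univ).toReal + (γ 1 Set.univ).toReal = 1 := by
  have := h.finite 0
  have := h.finite 1
  rw [← ENNReal.toReal_add (measure_ne_top _ _) (measure_ne_top _ _), h.total, ENNReal.toReal_one]

lemma BWPair.measure_eq_univ (h : BWPair γ) (c : ℕ) {s : Set (ℝ × ℝ)} (hs : unitSq ⊆ s) :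
    γ c s = γ c Set.univ := by
  refine le_antisymm (measure_mono (Set.subset_univ _)) ?_
  calc γ c Set.univ ≤ γ c (s ∪ unitSqᶜ) := measure_mono fun p _ => by
        by_cases hp : p ∈ unitSq
        · exact Or.inl (hs hp)
        · exact Or.inr hp
    _ ≤ γ c s + γ c unitSqᶜ := measure_union_le _ _
    _ = γ c s := by rw [h.supp c, add_zero]

lemma BWPair.univ_le_sum (h : BWPair γ) {N : ℕ} (c : ℕ) (S : ℕ → Set (ℝ × ℝ))
    (hS : ∀ p ∈ unitSq, ∃ i < 2 * N, p ∈ S i) :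
    (γ c Set.univ).toReal ≤ ∑ i ∈ Finset.range (2 * N), (γ c (S i)).toReal := by
  have := h.finite c
  rw [← ENNReal.toReal_sum fun i _ => measure_ne_top _ _]
  refine ENNReal.toReal_mono (ENNReal.sum_lt_top.mpr fun i _ => measure_lt_top _ _).ne ?_
  rw [← h.measure_eq_univ c (s := ⋃ i ∈ Finset.range (2 * N), S i)]
  · exact measure_biUnion_finset_le _ _
  · intro p hp
    obtain ⟨i, hi, hpi⟩ := hS p hp
    simp only [Set.mem_iUnion]
    exact ⟨i, Finset.mem_range.mpr hi, hpi⟩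

lemma BWPair.cellMass_le_one (h : BWPair γ) (hle : ∀ c, γ c Set.univ ≤ 1) (N c i j : ℕ) :
    cellMass γ N c i j ≤ 1 := by
  have := h.finite c
  exact ENNReal.toReal_le_of_le_ofReal zero_le_one
    (by simpa using (measure_mono (Set.subset_univ _)).trans (hle c))

lemma toReal_strip_le {N : ℕ} (hN : 0 < N) {m : ℝ≥0∞} {i : ℕ}
    (h : m ≤ ENNReal.ofReal (((-1 + ((i : ℝ) + 1) / N) - (-1 + (i : ℝ) / N)) / 2)) :
    2 * N * m.toReal ≤ 1 := by
  have hN' : (0:ℝ) < N := by exact_mod_cast hN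
  have e : ((-1 + ((i : ℝ) + 1) / N) - (-1 + (i : ℝ) / N)) / 2 = 1 / (2 * N) := by field_simp; ring
  rw [e] at h
  have h1 := ENNReal.toReal_le_of_le_ofReal (by positivity) h
  rw [le_div_iff₀ (by positivity)] at h1
  linarith

lemma BWPair.cellData (h : BWPair γ) (hle : ∀ c, γ c Set.univ ≤ 1) {N : ℕ} (hN : 0 < N) :
    CellData N (cellMass γ N) (plusMass γ N) (minusMass γ N) where
  a_nonneg _ _ _ := ENNReal.toReal_nonneg
  a_le_one c i j := h.cellMass_le_one hle N c i j
  a_sum := by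
    have hc : ∀ c, ∑ i ∈ Finset.range (2 * N), ∑ j ∈ Finset.range (2 * N), cellMass γ N c i j
        = (γ c Set.univ).toReal := by
      intro c
      rw [← Finset.sum_product', h.sum_cellMass,
        h.measure_eq_univ c (unitSq_subset_iUnion_INcell hN)]
    simp only [hc, Finset.sum_range_succ, Finset.sum_range_zero, zero_add]
    exact h.total_toReal
  gP_nonneg _ _ := ENNReal.toReal_nonneg
  gP_le c i := toReal_strip_le hN (i := i) (by rw [JNcell_succ]; exact h.plus_Icc_le c _ _)
  gP_sum := by
    simp only [Finset.sum_range_succ (n := 1), Finset.range_one, Finset.sum_singleton]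
    rw [← h.total_toReal]
    refine add_le_add ?_ ?_ <;>
    · refine h.univ_le_sum _ _ fun p hp => ?_
      have := abs_add_abs_le_of_mem_unitSq hp
      have h2 := abs_le.mp (by linarith [abs_nonneg (p.2 - p.1)] : |p.1 + p.2| ≤ 1)
      obtain ⟨i, hi, h3⟩ := exists_strip hN h2.1 h2.2
      exact ⟨i, hi, by rw [JNcell_succ]; exact h3⟩
  gM_nonneg _ _ := ENNReal.toReal_nonneg
  gM_le c i := toReal_strip_le hN (i := i) (by rw [JNcell_succ]; exact h.minus_Icc_le c _ _)
  gM_sum := by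
    simp only [Finset.sum_range_succ (n := 1), Finset.range_one, Finset.sum_singleton]
    rw [← h.total_toReal]
    refine add_le_add ?_ ?_ <;>
    · refine h.univ_le_sum _ _ fun p hp => ?_
      have := abs_add_abs_le_of_mem_unitSq hp
      have h2 := abs_le.mp (by linarith [abs_nonneg (p.1 + p.2)] : |p.2 - p.1| ≤ 1)
      obtain ⟨i, hi, h3⟩ := exists_strip hN h2.1 h2.2
      exact ⟨i, hi, by rw [JNcell_succ]; exact h3⟩

lemma BWPair.cellMass_eq_zero (h : BWPair γ) {N c i j : ℕ} (hN : 0 < N)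
    (hij : N + 1 < stripRadius N i + stripRadius N j) : cellMass γ N c i j = 0 := by
  have hN' : (0:ℝ) < N := by exact_mod_cast hN
  set v : ℝ := ((stripRadius N i : ℝ) - 1) / N with hv
  have : γ c (INcell N (i + 1) (j + 1)) = 0 := by
    refine measure_mono_null (t := {p | p.1 + p.2 = v} ∪ {p | p.1 + p.2 = -v}) (fun p hp => ?_)
      (measure_union_null (h.plus_line c v) (h.plus_line c (-v)))
    obtain ⟨hu, ⟨h1, h2⟩, h3, h4⟩ := mem_INcell_succ.mp hp
    have h5 := (abs_mem_of_mem_strip hN h1 h2).1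
    have h6 := (abs_mem_of_mem_strip hN h3 h4).1
    have h7 := abs_add_abs_le_of_mem_unitSq hu
    have h8 : (N : ℝ) + 2 ≤ stripRadius N i + stripRadius N j := by exact_mod_cast hij
    have h9 : 1 ≤ ((stripRadius N i : ℝ) - 1) / N + ((stripRadius N j : ℝ) - 1) / N := by
      rw [← add_div, one_le_div hN']; linarith
    have h10 : |p.1 + p.2| = v := le_antisymm (by linarith) h5
    exact eq_or_eq_neg_of_abs_eq h10
  simp [cellMass, this]

lemma BWPair.neg_mul_log_le (h : BWPair γ) {N : ℕ} (hN : 0 < N) (c i j : ℕ) :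
    -(cellMass γ N c i j * Real.log (4 * N ^ 2 * cellMass γ N c i j))
      ≤ -(cellMass γ N c i j *
          Real.log (2 * cellMass γ N c i j / (volume (INcell N (i + 1) (j + 1))).toReal))
        + if stripRadius N i + stripRadius N j = N + 1 then cellMass γ N c i j * Real.log 4
          else 0 := by
  have hN' : (0:ℝ) < N := by exact_mod_cast hN
  have hnn : 0 ≤ cellMass γ N c i j := ENNReal.toReal_nonneg
  rcases hnn.eq_or_lt with h0 | h0
  · simp [← h0]
  set m := cellMass γ N c i j with hm
  set v := (volume (INcell N (i + 1) (j + 1))).toReal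
  rcases lt_trichotomy (stripRadius N i + stripRadius N j) (N + 1) with hlt | heq | hgt
  · have hv := le_volume_INcell_of_interior hN (Nat.lt_succ_iff.mp hlt)
    have hvpos : 0 < v := lt_of_lt_of_le (by positivity) hv
    rw [if_neg hlt.ne, add_zero, neg_le_neg_iff]
    refine mul_le_mul_of_nonneg_left (Real.log_le_log (by positivity) ?_) h0.le
    rw [div_le_iff₀ hvpos]
    calc 2 * m = 4 * N ^ 2 * m * (1 / (2 * (N:ℝ) ^ 2)) := by field_simp; ring
      _ ≤ 4 * N ^ 2 * m * v := by gcongr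
  · have hv := le_volume_INcell_of_boundary hN heq
    have hvpos : 0 < v := lt_of_lt_of_le (by positivity) hv
    have hlog : Real.log (2 * m / v) ≤ Real.log 4 + Real.log (4 * N ^ 2 * m) := by
      rw [← Real.log_mul (by norm_num) (by positivity)]
      refine Real.log_le_log (by positivity) ?_
      rw [div_le_iff₀ hvpos]
      calc 2 * m = 4 * (4 * N ^ 2 * m) * (1 / (8 * (N:ℝ) ^ 2)) := by field_simp; ring
        _ ≤ 4 * (4 * N ^ 2 * m) * v := by gcongr
    rw [if_pos heq]
    nlinarith
  · exact absurd (h.cellMass_eq_zero hN hgt) h0.ne'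

lemma BWPair.sum_boundary_le (h : BWPair γ) {N : ℕ} (hN : 0 < N) :
    ∑ c ∈ Finset.range 2, ∑ i ∈ Finset.range (2 * N), ∑ j ∈ Finset.range (2 * N),
      (if stripRadius N i + stripRadius N j = N + 1 then cellMass γ N c i j * Real.log 4 else 0)
      ≤ 4 / N * Real.log 4 := by
  have hN' : (0:ℝ) < N := by exact_mod_cast hN
  have hN1 : (1:ℝ) ≤ N := by exact_mod_cast hN
  have hlog : 0 ≤ Real.log 4 := Real.log_nonneg (by norm_num)
  have hc : ∀ c, ∑ i ∈ Finset.range (2 * N), ∑ j ∈ Finset.range (2 * N),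
      (if stripRadius N i + stripRadius N j = N + 1 then cellMass γ N c i j * Real.log 4 else 0)
      ≤ (γ c (frame (1 / N))).toReal * Real.log 4 := by
    intro c
    have := h.finite c
    rw [← Finset.sum_product', ← Finset.sum_filter, ← Finset.sum_mul, h.sum_cellMass]
    refine mul_le_mul_of_nonneg_right (ENNReal.toReal_mono (measure_ne_top _ _)
      (measure_mono (Set.iUnion₂_subset fun z hz => ?_))) hlog
    exact INcell_subset_frame hN (Finset.mem_filter.mp hz).2
  simp only [Finset.sum_range_succ (n := 1), Finset.range_one, Finset.sum_singleton]
  refine (add_le_add (hc 0) (hc 1)).trans ?_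
  rw [← add_mul]
  refine mul_le_mul_of_nonneg_right ?_ hlog
  have := h.finite 0
  have := h.finite 1
  rw [← ENNReal.toReal_add (measure_ne_top _ _) (measure_ne_top _ _)]
  refine ENNReal.toReal_le_of_le_ofReal (by positivity) ((h.frame_le (1 / N) (by positivity)
    (by rw [div_le_one hN']; exact hN1)).trans (le_of_eq ?_))
  congr 1; ring

lemma half_volume_JNcell {N i : ℕ} (hN : 0 < N) (hi : i < 2 * N) :
    ((2 : ℝ≥0∞)⁻¹ • volume.restrict (Set.Icc (-1:ℝ) 1)) (JNcell N (i + 1))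
      = ENNReal.ofReal (1 / (2 * N)) := by
  have hN' : (0:ℝ) < N := by exact_mod_cast hN
  have hi' : (i : ℝ) + 1 ≤ 2 * N := by exact_mod_cast hi
  rw [Measure.smul_apply, smul_eq_mul, JNcell_succ, Measure.restrict_apply measurableSet_Icc,
    Set.inter_eq_left.mpr, Real.volume_Icc, mul_comm, ← div_eq_mul_inv,
    ← ENNReal.ofReal_ofNat 2, ← ENNReal.ofReal_div_of_pos (by norm_num)]
  · congr 1; field_simp; ring
  · refine Set.Icc_subset_Icc ?_ ?_
    · have : 0 ≤ (i : ℝ) / N := by positivity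
      linarith
    · have : ((i : ℝ) + 1) / N ≤ 2 := by rwa [div_le_iff₀ hN']
      linarith

lemma BWPair.bwBarPlus_toReal (h : BWPair γ) {N i : ℕ} (hN : 0 < N) (hi : i < 2 * N) (c : ℕ) :
    (bwBarPlus (γ c) (JNcell N (i + 1))).toReal = 1 / (2 * N) - plusMass γ N c i := by
  have := h.finite c
  have hm : MeasurableSet (JNcell N (i + 1)) := measurableSet_Icc
  have hle := Measure.le_iff'.mp (h.plus c) (JNcell N (i + 1))
  rw [bwBarPlus, Measure.sub_apply hm (h.plus c), ENNReal.toReal_sub_of_le hle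
    (by rw [half_volume_JNcell hN hi]; exact ENNReal.ofReal_ne_top), half_volume_JNcell hN hi,
    ENNReal.toReal_ofReal (by positivity), Measure.map_apply (by fun_prop) hm]
  rfl

lemma BWPair.bwBarMinus_toReal (h : BWPair γ) {N i : ℕ} (hN : 0 < N) (hi : i < 2 * N) (c : ℕ) :
    (bwBarMinus (γ c) (JNcell N (i + 1))).toReal
      = 1 / (2 * N) - minusMass γ N c (2 * N - 1 - i) := by
  have hN' : (0:ℝ) < N := by exact_mod_cast hN
  have := h.finite c
  have hm : MeasurableSet (JNcell N (i + 1)) := measurableSet_Icc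
  have hle := Measure.le_iff'.mp (h.minus c) (JNcell N (i + 1))
  rw [bwBarMinus, Measure.sub_apply hm (h.minus c), ENNReal.toReal_sub_of_le hle
    (by rw [half_volume_JNcell hN hi]; exact ENNReal.ofReal_ne_top), half_volume_JNcell hN hi,
    ENNReal.toReal_ofReal (by positivity), Measure.map_apply (by fun_prop) hm, minusMass,
    JNcell_succ, JNcell_succ, preimage_sub_Icc]
  have e : ((2 * N - 1 - i : ℕ) : ℝ) = 2 * N - 1 - i := by
    rw [Nat.cast_sub (by omega), Nat.cast_sub (by omega)]; push_cast; ring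
  rw [e]
  congr 5 <;> · field_simp; ring

lemma strip_entropy_le {N : ℕ} (hN : 0 < N) (g : ℕ → ℕ → ℝ) (g_le : ∀ c i, 2 * N * g c i ≤ 1)
    (g_sum : 1 ≤ ∑ c ∈ Finset.range 2, ∑ i ∈ Finset.range (2 * N), g c i) :
    ∑ c ∈ Finset.range 2, ∑ i ∈ Finset.range (2 * N),
        -((1 - 2 * N * g c i) * Real.log (1 - 2 * N * g c i) / (2 * N))
      ≤ -∑ i ∈ Finset.range (2 * N), ((1 / (2 * N) - g 0 i) * Real.log (4 * N * (1 / (2 * N) - g 0 i))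
          + (1 / (2 * N) - g 1 i) * Real.log (4 * N * (1 / (2 * N) - g 1 i))) + Real.log 2 := by
  have hN' : (0:ℝ) < N := by exact_mod_cast hN
  have hterm : ∀ c i, -((1 - 2 * N * g c i) * Real.log (1 - 2 * N * g c i) / (2 * N))
      = -((1 / (2 * N) - g c i) * Real.log (4 * N * (1 / (2 * N) - g c i)))
        + (1 / (2 * N) - g c i) * Real.log 2 := by
    intro c i
    have e1 : 1 / (2 * (N:ℝ)) - g c i = (1 - 2 * N * g c i) / (2 * N) := by field_simp
    have e2 : 4 * N * ((1 - 2 * N * g c i) / (2 * N)) = 2 * (1 - 2 * N * g c i) := by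
      field_simp; ring
    rw [e1, e2]
    rcases (sub_nonneg.mpr (g_le c i)).eq_or_lt with h0 | h0
    · simp [← h0]
    · rw [Real.log_mul (by norm_num) h0.ne']; ring
  have hs : ∑ c ∈ Finset.range 2, ∑ i ∈ Finset.range (2 * N), (1 / (2 * (N:ℝ)) - g c i) ≤ 1 := by
    simp_rw [Finset.sum_sub_distrib]
    simp only [Finset.sum_const, Finset.card_range, nsmul_eq_mul]
    have : ((2 : ℕ) : ℝ) * (((2 * N : ℕ) : ℝ) * (1 / (2 * N))) = 2 := by push_cast; field_simp
    linarith
  simp_rw [hterm, Finset.sum_add_distrib]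
  simp_rw [← Finset.sum_mul]
  refine add_le_add (le_of_eq ?_) ?_
  · simp only [Finset.sum_range_succ (n := 1), Finset.range_one, Finset.sum_singleton]
    simp only [Finset.sum_neg_distrib]; ring
  · have h2 : 0 ≤ Real.log 2 := Real.log_nonneg (by norm_num)
    nlinarith

lemma sum_Icc_one_eq_sum_range (m : ℕ) (g : ℕ → ℝ) :
    ∑ i ∈ Finset.Icc 1 m, g i = ∑ i ∈ Finset.range m, g (i + 1) := by
  rw [Finset.range_eq_Ico, Finset.sum_Ico_add' g 0 m 1]
  rfl

lemma BWPair.cellEntropy_le (h : BWPair γ) (hle : ∀ c, γ c Set.univ ≤ 1) {N : ℕ} (hN : 0 < N) :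
    cellEntropy N (cellMass γ N) (plusMass γ N) (minusMass γ N)
      ≤ GN N (γ 0) (γ 1) + 4 / N * Real.log 4 := by
  have hd := h.cellData hle hN
  have hA : ∑ c ∈ Finset.range 2, ∑ i ∈ Finset.range (2 * N), ∑ j ∈ Finset.range (2 * N),
      -(cellMass γ N c i j * Real.log (4 * N ^ 2 * cellMass γ N c i j)) ≤ _ :=
    Finset.sum_le_sum fun c (_ : c ∈ Finset.range 2) => Finset.sum_le_sum
      fun i (_ : i ∈ Finset.range (2 * N)) => Finset.sum_le_sum
      fun j (_ : j ∈ Finset.range (2 * N)) => h.neg_mul_log_le hN c i j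
  simp_rw [Finset.sum_add_distrib] at hA
  have hB := h.sum_boundary_le hN
  have hP := strip_entropy_le hN (plusMass γ N) hd.gP_le hd.gP_sum
  have hM := strip_entropy_le hN (minusMass γ N) hd.gM_le hd.gM_sum
  have eP : ∑ i ∈ Finset.range (2 * N),
      ((bwBarPlus (γ 0) (JNcell N (i + 1))).toReal *
          Real.log (4 * N * (bwBarPlus (γ 0) (JNcell N (i + 1))).toReal)
        + (bwBarPlus (γ 1) (JNcell N (i + 1))).toReal *
          Real.log (4 * N * (bwBarPlus (γ 1) (JNcell N (i + 1))).toReal))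
      = ∑ i ∈ Finset.range (2 * N),
        ((1 / (2 * N) - plusMass γ N 0 i) * Real.log (4 * N * (1 / (2 * N) - plusMass γ N 0 i))
          + (1 / (2 * N) - plusMass γ N 1 i) *
            Real.log (4 * N * (1 / (2 * N) - plusMass γ N 1 i))) :=
    Finset.sum_congr rfl fun i hi => by
      rw [h.bwBarPlus_toReal hN (Finset.mem_range.mp hi),
        h.bwBarPlus_toReal hN (Finset.mem_range.mp hi)]
  have eM : ∑ i ∈ Finset.range (2 * N),
      ((bwBarMinus (γ 0) (JNcell N (i + 1))).toReal *
          Real.log (4 * N * (bwBarMinus (γ 0) (JNcell N (i + 1))).toReal)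
        + (bwBarMinus (γ 1) (JNcell N (i + 1))).toReal *
          Real.log (4 * N * (bwBarMinus (γ 1) (JNcell N (i + 1))).toReal))
      = ∑ i ∈ Finset.range (2 * N),
        ((1 / (2 * N) - minusMass γ N 0 i) * Real.log (4 * N * (1 / (2 * N) - minusMass γ N 0 i))
          + (1 / (2 * N) - minusMass γ N 1 i) *
            Real.log (4 * N * (1 / (2 * N) - minusMass γ N 1 i))) := by
    rw [← Finset.sum_range_reflect]
    refine Finset.sum_congr rfl fun i hi => ?_
    have hi' : 2 * N - 1 - i < 2 * N := by have := Finset.mem_range.mp hi; omega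
    have e : 2 * N - 1 - (2 * N - 1 - i) = i := by have := Finset.mem_range.mp hi; omega
    rw [h.bwBarMinus_toReal hN hi', h.bwBarMinus_toReal hN hi', e]
  unfold cellEntropy GN
  simp only [sum_Icc_one_eq_sum_range]
  rw [eP, eM]
  have eA : ∑ c ∈ Finset.range 2, ∑ i ∈ Finset.range (2 * N), ∑ j ∈ Finset.range (2 * N),
      -(cellMass γ N c i j *
        Real.log (2 * cellMass γ N c i j / (volume (INcell N (i + 1) (j + 1))).toReal))
      = -∑ i ∈ Finset.range (2 * N), ∑ j ∈ Finset.range (2 * N),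
        ((γ 0 (INcell N (i + 1) (j + 1))).toReal *
          Real.log (2 * (γ 0 (INcell N (i + 1) (j + 1))).toReal /
            (volume (INcell N (i + 1) (j + 1))).toReal) +
        (γ 1 (INcell N (i + 1) (j + 1))).toReal *
          Real.log (2 * (γ 1 (INcell N (i + 1) (j + 1))).toReal /
            (volume (INcell N (i + 1) (j + 1))).toReal)) := by
    simp only [Finset.sum_range_succ (n := 1), Finset.range_one, Finset.sum_singleton,
      Finset.sum_neg_distrib, Finset.sum_add_distrib, cellMass]
    ring
  rw [eA] at hA
  linarith

end Masses

section Configurations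

variable {n : ℕ}

/-- The measure with density `n` on the squares of the queens of `q` of colour `c`. -/
def queenMeasure (n : ℕ) (q : Finset (ℕ × ℕ)) (c : ℕ) : Measure (ℝ × ℝ) :=
  volume.withDensity
    ((⋃ ij ∈ q.filter (fun ij => (ij.1 + ij.2) % 2 = c), gridSq n ij.1 ij.2).indicator
      fun _ => (n : ℝ≥0∞))

/-- The set of queens described by a function from columns to rows. -/
def toConfig (f : Fin n → Fin n) : Finset (ℕ × ℕ) :=
  Finset.univ.image fun x : Fin n => ((x : ℕ) + 1, (f x : ℕ) + 1)

lemma volume_gridSq (n i j : ℕ) :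
    volume (gridSq n i j) = ENNReal.ofReal (1 / n) * ENNReal.ofReal (1 / n) := by
  rw [gridSq, Measure.volume_eq_prod, Measure.prod_prod, Real.volume_Icc, Real.volume_Icc]
  congr 2 <;> ring

lemma measurableSet_gridSq (n i j : ℕ) : MeasurableSet (gridSq n i j) :=
  measurableSet_Icc.prod measurableSet_Icc

open Classical in
lemma queenMeasure_le (hn : 0 < n) (q : Finset (ℕ × ℕ)) (c : ℕ) {R : Set (ℝ × ℝ)}
    (hR : MeasurableSet R) :
    queenMeasure n q c R ≤ ENNReal.ofReal
      (((q.filter fun ij => (ij.1 + ij.2) % 2 = c).filter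
        fun ij => (gridSq n ij.1 ij.2 ∩ R).Nonempty).card / n) := by
  have hn' : (0:ℝ) < n := by exact_mod_cast hn
  set Q := q.filter fun ij => (ij.1 + ij.2) % 2 = c
  have hU : MeasurableSet (⋃ ij ∈ Q, gridSq n ij.1 ij.2) :=
    Finset.measurableSet_biUnion _ fun ij _ => measurableSet_gridSq _ _ _
  rw [queenMeasure, withDensity_indicator hU, withDensity_const, Measure.smul_apply, smul_eq_mul,
    Measure.restrict_apply hR]
  calc (n : ℝ≥0∞) * volume (R ∩ ⋃ ij ∈ Q, gridSq n ij.1 ij.2)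
      ≤ n * volume (⋃ ij ∈ Q.filter fun ij => (gridSq n ij.1 ij.2 ∩ R).Nonempty,
          gridSq n ij.1 ij.2) := by
        gcongr
        rintro p ⟨hp, hq⟩
        simp only [Set.mem_iUnion] at hq ⊢
        obtain ⟨ij, hij, hpq⟩ := hq
        exact ⟨ij, Finset.mem_filter.mpr ⟨hij, p, hpq, hp⟩, hpq⟩
    _ ≤ n * ∑ ij ∈ Q.filter fun ij => (gridSq n ij.1 ij.2 ∩ R).Nonempty,
          volume (gridSq n ij.1 ij.2) := by
        gcongr
        exact measure_biUnion_finset_le _ _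
    _ = _ := by
        simp only [volume_gridSq, Finset.sum_const, nsmul_eq_mul]
        rw [← ENNReal.ofReal_natCast n, ← ENNReal.ofReal_natCast,
          ← ENNReal.ofReal_mul (by positivity), ← ENNReal.ofReal_mul (by positivity),
          ← ENNReal.ofReal_mul (by positivity)]
        congr 1
        field_simp

lemma isFiniteMeasure_queenMeasure (hn : 0 < n) (q : Finset (ℕ × ℕ)) (c : ℕ) :
    IsFiniteMeasure (queenMeasure n q c) :=
  ⟨(queenMeasure_le hn q c MeasurableSet.univ).trans_lt ENNReal.ofReal_lt_top⟩

lemma measurableSet_Rset (a₁ b₁ a₂ b₂ : ℝ) : MeasurableSet (Rset a₁ b₁ a₂ b₂) := by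
  have h1 : Measurable fun p : ℝ × ℝ => p.1 + p.2 := by fun_prop
  have h2 : Measurable fun p : ℝ × ℝ => p.2 - p.1 := by fun_prop
  exact measurableSet_unitSq.inter ((h1 measurableSet_Icc).inter (h2 measurableSet_Icc))

lemma le_add_of_qdist_lt {μ ν : Measure (ℝ × ℝ)} [IsFiniteMeasure μ] [IsFiniteMeasure ν] {ε : ℝ}
    (h : qdist μ ν < ε) {a₁ b₁ a₂ b₂ : ℝ} (ha₁ : a₁ ∈ Set.Icc (-1:ℝ) 1)
    (hb₁ : b₁ ∈ Set.Icc (-1:ℝ) 1) (ha₂ : a₂ ∈ Set.Icc (-1:ℝ) 1) (hb₂ : b₂ ∈ Set.Icc (-1:ℝ) 1) :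
    (ν (Rset a₁ b₁ a₂ b₂)).toReal ≤ (μ (Rset a₁ b₁ a₂ b₂)).toReal + ε := by
  have hmono : ∀ (κ : Measure (ℝ × ℝ)) [IsFiniteMeasure κ] (s : Set (ℝ × ℝ)),
      (κ s).toReal ≤ (κ Set.univ).toReal := fun κ _ s =>
    ENNReal.toReal_mono (measure_ne_top _ _) (measure_mono (Set.subset_univ _))
  have hle : |(μ (Rset a₁ b₁ a₂ b₂)).toReal - (ν (Rset a₁ b₁ a₂ b₂)).toReal| ≤ qdist μ ν := by
    refine le_csSup ⟨(μ Set.univ).toReal + (ν Set.univ).toReal, ?_⟩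
      ⟨a₁, b₁, a₂, b₂, ha₁, hb₁, ha₂, hb₂, rfl⟩
    rintro t ⟨a, b, c, d, -, -, -, -, rfl⟩
    have h1 := hmono μ (Rset a b c d)
    have h2 := hmono ν (Rset a b c d)
    have h3 : 0 ≤ (μ (Rset a b c d)).toReal := ENNReal.toReal_nonneg
    have h4 : 0 ≤ (ν (Rset a b c d)).toReal := ENNReal.toReal_nonneg
    rw [abs_le]
    constructor <;> linarith
  have := neg_abs_le ((μ (Rset a₁ b₁ a₂ b₂)).toReal - (ν (Rset a₁ b₁ a₂ b₂)).toReal)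
  linarith

open Classical in
lemma queenMeasure_toConfig_le (hn : 0 < n) (f : Fin n → Fin n) (c : ℕ) {R : Set (ℝ × ℝ)}
    (hR : MeasurableSet R) :
    (queenMeasure n (toConfig f) c R).toReal ≤
      ((Finset.univ.filter fun x : Fin n => ((x : ℕ) + f x) % 2 = c ∧
        (gridSq n (x + 1) (f x + 1) ∩ R).Nonempty).card : ℝ) / n := by
  refine (ENNReal.toReal_le_of_le_ofReal (by positivity) (queenMeasure_le hn _ c hR)).trans ?_
  gcongr
  rw [Finset.filter_filter, toConfig, Finset.filter_image]
  refine Finset.card_image_le.trans (Finset.card_le_card fun x hx => ?_)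
  simp only [Finset.mem_filter, Finset.mem_univ, true_and] at hx ⊢
  exact ⟨by omega, hx.2⟩

/-- A queen whose diagonal label is `s` has a square meeting the `i`-th closed strip. -/
def MeetsStrip (n N s i : ℕ) : Prop := i * n ≤ (s + 1) * N ∧ s * N ≤ (i + 1) * n + N

lemma meetsStrip_of_le (hn : 0 < n) {N s i : ℕ} (hN : 0 < N)
    (h1 : (i : ℝ) / N ≤ ((s : ℝ) + 1) / n) (h2 : ((s : ℝ) - 1) / n ≤ ((i : ℝ) + 1) / N) :
    MeetsStrip n N s i := by
  have hn' : (0:ℝ) < n := by exact_mod_cast hn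
  have hN' : (0:ℝ) < N := by exact_mod_cast hN
  rw [div_le_div_iff₀ hN' hn'] at h1
  rw [div_le_div_iff₀ hn' hN'] at h2
  refine ⟨by exact_mod_cast h1, ?_⟩
  have : (s : ℝ) * N ≤ (i + 1) * n + N := by linarith
  exact_mod_cast this

lemma meetsStrip_of_nonempty (hn : 0 < n) {N i j : ℕ} (hN : 0 < N) {x y : Fin n}
    {p : ℝ × ℝ} (hp : p ∈ gridSq n (x + 1) (y + 1)) :
    (-1 + (i : ℝ) / N ≤ p.1 + p.2 → p.1 + p.2 ≤ -1 + ((i : ℝ) + 1) / N →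
      MeetsStrip n N (x + y + 1) i) ∧
    (-1 + (j : ℝ) / N ≤ p.2 - p.1 → p.2 - p.1 ≤ -1 + ((j : ℝ) + 1) / N →
      MeetsStrip n N (y + n - x) j) := by
  have hn' : (0:ℝ) < n := by exact_mod_cast hn
  obtain ⟨⟨h1, h2⟩, h3, h4⟩ := hp
  push_cast at h1 h2 h3 h4
  rw [add_sub_cancel_right] at h1 h3
  have hd : (((y : ℕ) + n - x : ℕ) : ℝ) = y + n - x := by
    rw [Nat.cast_sub (by have := x.2; omega)]; push_cast; ring
  have ex : ((x : ℝ) + 1) / n = (x : ℝ) / n + 1 / n := by ring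
  have ey : ((y : ℝ) + 1) / n = (y : ℝ) / n + 1 / n := by ring
  rw [ex] at h2
  rw [ey] at h4
  constructor <;> intro h5 h6 <;> refine meetsStrip_of_le hn hN ?_ ?_
  · have : (((x : ℕ) + y + 1 : ℕ) + 1 : ℝ) / n = x / n + y / n + 1 / n + 1 / n := by
      push_cast; ring
    rw [this]; linarith
  · have : (((x : ℕ) + y + 1 : ℕ) - 1 : ℝ) / n = x / n + y / n := by push_cast; ring
    rw [this]; linarith
  · have : ((((y : ℕ) + n - x : ℕ) : ℝ) + 1) / n = y / n - x / n + 1 / n + 1 := by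
      rw [hd]; field_simp; ring
    rw [this]; linarith
  · have : ((((y : ℕ) + n - x : ℕ) : ℝ) - 1) / n = y / n - x / n - 1 / n + 1 := by
      rw [hd]; field_simp; ring
    rw [this]; linarith

lemma card_near_le {N : ℕ} (hN : 0 < N) {g : Fin n → ℕ} (hg : Function.Injective g) (v : ℕ) :
    (Finset.univ.filter fun x => v ≤ (g x + 1) * N ∧ g x * N ≤ v + N).card ≤ 3 := by
  refine (Finset.card_le_card_of_injOn (t := Finset.Icc (v / N - 1) (v / N + 1)) g
    (fun x hx => ?_) hg.injOn).trans ?_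
  · obtain ⟨h1, h2⟩ := (Finset.mem_filter.mp hx).2
    have h3 : v / N ≤ g x + 1 := Nat.div_le_of_le_mul (by rwa [mul_comm])
    have h4 : g x ≤ v / N + 1 := by
      rw [← Nat.add_div_right v hN]
      exact (Nat.le_div_iff_mul_le hN).mpr h2
    exact Finset.mem_coe.mpr (Finset.mem_Icc.mpr ⟨by omega, h4⟩)
  · rw [Nat.card_Icc]; omega

open Classical in
lemma card_meetsStrip_ne_le (hn : 0 < n) {N : ℕ} (hN : 0 < N) {g : Fin n → ℕ}
    (hg : Function.Injective g) (i : ℕ) :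
    (Finset.univ.filter fun x => MeetsStrip n N (g x) i ∧ g x * N / n ≠ i).card ≤ 6 := by
  calc _ ≤ ((Finset.univ.filter fun x => i * n ≤ (g x + 1) * N ∧ g x * N ≤ i * n + N) ∪
      (Finset.univ.filter fun x => (i + 1) * n ≤ (g x + 1) * N ∧
        g x * N ≤ (i + 1) * n + N)).card := by
        refine Finset.card_le_card fun x hx => ?_
        simp only [Finset.mem_filter, Finset.mem_univ, true_and, Finset.mem_union] at hx ⊢
        obtain ⟨⟨h1, h2⟩, h3⟩ := hx
        rcases lt_or_gt_of_ne h3 with h | h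
        · left
          have := (Nat.div_lt_iff_lt_mul hn).mp h
          exact ⟨h1, by omega⟩
        · right
          have := (Nat.le_div_iff_mul_le hn).mp h
          refine ⟨this.trans (Nat.mul_le_mul_right _ (Nat.le_succ _)), h2⟩
    _ ≤ 3 + 3 := (Finset.card_union_le _ _).trans
        (add_le_add (card_near_le hN hg _) (card_near_le hN hg _))

lemma mem_Icc_of_index_le {N i : ℕ} (hN : 0 < N) (hi : i ≤ 2 * N) :
    -1 + (i : ℝ) / N ∈ Set.Icc (-1:ℝ) 1 := by
  have hN' : (0:ℝ) < N := by exact_mod_cast hN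
  have h1 : (i : ℝ) / N ≤ 2 := by rw [div_le_iff₀ hN']; exact_mod_cast hi
  have h2 : 0 ≤ (i : ℝ) / N := by positivity
  exact ⟨by linarith, by linarith⟩

variable {γ : ℕ → Measure (ℝ × ℝ)}

lemma BWPair.le_Rset (h : BWPair γ) (c : ℕ) {s : Set (ℝ × ℝ)} {a₁ b₁ a₂ b₂ : ℝ}
    (hs : s ∩ unitSq ⊆ Rset a₁ b₁ a₂ b₂) : (γ c s).toReal ≤ (γ c (Rset a₁ b₁ a₂ b₂)).toReal := by
  have := h.finite c
  refine ENNReal.toReal_mono (measure_ne_top _ _) ?_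
  calc γ c s ≤ γ c (Rset a₁ b₁ a₂ b₂ ∪ unitSqᶜ) := measure_mono fun p hp => by
        by_cases hu : p ∈ unitSq
        · exact Or.inl (hs ⟨hp, hu⟩)
        · exact Or.inr hu
    _ ≤ γ c (Rset a₁ b₁ a₂ b₂) + γ c unitSqᶜ := measure_union_le _ _
    _ = γ c (Rset a₁ b₁ a₂ b₂) := by rw [h.supp c, add_zero]

lemma abs_le_one_of_mem_unitSq {p : ℝ × ℝ} (hp : p ∈ unitSq) :
    (-1 ≤ p.1 + p.2 ∧ p.1 + p.2 ≤ 1) ∧ (-1 ≤ p.2 - p.1 ∧ p.2 - p.1 ≤ 1) := by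
  obtain ⟨⟨h1, h2⟩, h3, h4⟩ := hp
  refine ⟨⟨?_, ?_⟩, ?_, ?_⟩ <;> linarith

open Classical in
lemma BWPair.closeTo (h : BWPair γ) (hn : 0 < n) {N : ℕ} (hN : 0 < N) {ε : ℝ}
    {f : Fin n → Fin n} (hf : IsQueenFun f)
    (hdist : ∀ c ∈ Finset.range 2, qdist (queenMeasure n (toConfig f) c) (γ c) < ε) :
    CloseTo N (cellMass γ N) (plusMass γ N) (minusMass γ N) (ε + 12 / n) f := by
  have hn' : (0:ℝ) < n := by exact_mod_cast hn
  have hp : Function.Injective fun x : Fin n => (x : ℕ) + f x + 1 := fun x y hxy =>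
    hf.plus (Nat.add_right_cancel hxy)
  have key : ∀ c ∈ Finset.range 2, ∀ (s : Set (ℝ × ℝ)) (a₁ b₁ a₂ b₂ : ℝ) (k : ℕ),
      s ∩ unitSq ⊆ Rset a₁ b₁ a₂ b₂ → a₁ ∈ Set.Icc (-1:ℝ) 1 → b₁ ∈ Set.Icc (-1:ℝ) 1 →
      a₂ ∈ Set.Icc (-1:ℝ) 1 → b₂ ∈ Set.Icc (-1:ℝ) 1 →
      (Finset.univ.filter fun x : Fin n => ((x : ℕ) + f x) % 2 = c ∧
        (gridSq n (x + 1) (f x + 1) ∩ Rset a₁ b₁ a₂ b₂).Nonempty).card ≤ k + 12 →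
      (γ c s).toReal ≤ (k : ℝ) / n + (ε + 12 / n) := by
    intro c hc s a₁ b₁ a₂ b₂ k hs ha₁ hb₁ ha₂ hb₂ hk
    have := h.finite c
    have := isFiniteMeasure_queenMeasure hn (toConfig f) c
    have h1 := le_add_of_qdist_lt (hdist c hc) ha₁ hb₁ ha₂ hb₂
    have h2 := queenMeasure_toConfig_le hn f c (measurableSet_Rset a₁ b₁ a₂ b₂)
    have h3 : ((Finset.univ.filter fun x : Fin n => ((x : ℕ) + f x) % 2 = c ∧
        (gridSq n (x + 1) (f x + 1) ∩ Rset a₁ b₁ a₂ b₂).Nonempty).card : ℝ) / n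
        ≤ (k : ℝ) / n + 12 / n := by
      rw [← add_div]
      gcongr
      exact_mod_cast hk
    linarith [h.le_Rset c hs]
  have hlow : ∀ i ∈ Finset.range (2 * N), -1 + (i : ℝ) / N ∈ Set.Icc (-1:ℝ) 1 := fun i hi =>
    mem_Icc_of_index_le hN (Finset.mem_range.mp hi).le
  have hupp : ∀ i ∈ Finset.range (2 * N), -1 + ((i : ℝ) + 1) / N ∈ Set.Icc (-1:ℝ) 1 :=
    fun i hi => by exact_mod_cast mem_Icc_of_index_le hN (Finset.mem_range.mp hi)
  have hl : (-1:ℝ) ∈ Set.Icc (-1:ℝ) 1 := by norm_num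
  have hr : (1:ℝ) ∈ Set.Icc (-1:ℝ) 1 := by norm_num
  refine ⟨fun c hc i hi j hj => ?_, fun c hc i hi => ?_, fun c hc j hj => ?_⟩
  · refine key c hc _ _ _ _ _ _ (fun p hp => mem_INcell_succ.mp hp.1) (hlow i hi) (hupp i hi)
      (hlow j hj) (hupp j hj) ?_
    have hi6 := card_meetsStrip_ne_le hn hN hp i
    have hj6 := card_meetsStrip_ne_le hn hN hf.minus j
    refine le_trans ?_ (Nat.add_le_add_left (Nat.add_le_add hi6 hj6) _)
    refine le_trans (Finset.card_le_card fun x hx => ?_)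
      ((Finset.card_union_le _ _).trans (Nat.add_le_add_left (Finset.card_union_le _ _) _))
    simp only [Finset.mem_filter, Finset.mem_univ, true_and, Finset.mem_union] at hx ⊢
    obtain ⟨hcx, p, hpg, -, hpP, hpM⟩ := hx
    obtain ⟨h1, h2⟩ := meetsStrip_of_nonempty (i := i) (j := j) hn hN hpg
    have h1 := h1 hpP.1 hpP.2
    have h2 := h2 hpM.1 hpM.2
    tauto
  · refine key c hc _ _ _ (-1) 1 _ (fun p hp => ⟨hp.2, ?_, (abs_le_one_of_mem_unitSq hp.2).2⟩)
      (hlow i hi) (hupp i hi) hl hr ?_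
    · have := hp.1
      rw [JNcell_succ] at this
      exact this
    have hi6 := card_meetsStrip_ne_le hn hN hp i
    refine le_trans ?_ (Nat.add_le_add_left (hi6.trans (by norm_num)) _)
    refine le_trans (Finset.card_le_card fun x hx => ?_) (Finset.card_union_le _ _)
    simp only [Finset.mem_filter, Finset.mem_univ, true_and, Finset.mem_union] at hx ⊢
    obtain ⟨hcx, p, hpg, -, hpP, -⟩ := hx
    have h1 := (meetsStrip_of_nonempty (i := i) (j := 0) hn hN hpg).1 hpP.1 hpP.2
    tauto
  · refine key c hc _ (-1) 1 _ _ _ (fun p hp => ⟨hp.2, (abs_le_one_of_mem_unitSq hp.2).1, ?_⟩)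
      hl hr (hlow j hj) (hupp j hj) ?_
    · have := hp.1
      rw [JNcell_succ] at this
      exact this
    have hj6 := card_meetsStrip_ne_le hn hN hf.minus j
    refine le_trans ?_ (Nat.add_le_add_left (hj6.trans (by norm_num)) _)
    refine le_trans (Finset.card_le_card fun x hx => ?_) (Finset.card_union_le _ _)
    simp only [Finset.mem_filter, Finset.mem_univ, true_and, Finset.mem_union] at hx ⊢
    obtain ⟨hcx, p, hpg, -, -, hpM⟩ := hx
    have h2 := (meetsStrip_of_nonempty (i := 0) (j := j) hn hN hpg).2 hpM.1 hpM.2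
    tauto

lemma IsQueensConfig.exists_queenFun {q : Finset (ℕ × ℕ)} (h : IsQueensConfig n q) :
    ∃ f : Fin n → Fin n, IsQueenFun f ∧ toConfig f = q := by
  obtain ⟨hmem, hrow, hcol, hplus, hminus⟩ := h
  have hex : ∀ x : Fin n, ∃ y : Fin n, ((x : ℕ) + 1, (y : ℕ) + 1) ∈ q := by
    intro x
    obtain ⟨y, hy, -⟩ := hcol (x + 1) (Finset.mem_Icc.mpr ⟨by omega, by have := x.2; omega⟩)
    have h2 := Finset.mem_Icc.mp (hmem _ hy).2
    dsimp only at h2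
    refine ⟨⟨y - 1, by omega⟩, ?_⟩
    have : y - 1 + 1 = y := by omega
    simpa only [this] using hy
  choose f hf using hex
  refine ⟨f, ⟨fun x y hxy => ?_, fun x y hxy => ?_, fun x y hxy => ?_⟩, ?_⟩
  · have hfy := hf y
    rw [← hxy] at hfy
    have := (hrow (f x + 1) (hmem _ (hf x)).2).unique (hf x) hfy
    exact Fin.ext (by omega)
  · have := congrArg Prod.fst (hplus _ (hf x) _ (hf y) (by dsimp only at hxy ⊢; omega))
    exact Fin.ext (by dsimp only at this; omega)
  · have := congrArg Prod.fst (hminus _ (hf x) _ (hf y) (by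
      have := x.2
      have := y.2
      dsimp only at hxy ⊢
      omega))
    exact Fin.ext (by dsimp only at this; omega)
  · ext ⟨a, b⟩
    simp only [toConfig, Finset.mem_image, Finset.mem_univ, true_and, Prod.mk.injEq]
    constructor
    · rintro ⟨x, rfl, rfl⟩
      exact hf x
    · intro hab
      have h1 := Finset.mem_Icc.mp (hmem _ hab).1
      dsimp only at h1
      have ha : a - 1 + 1 = a := by omega
      refine ⟨⟨a - 1, by omega⟩, ha, ?_⟩
      have h2 := hf ⟨a - 1, by omega⟩
      simp only [ha] at h2
      exact (hcol a (hmem _ hab).1).unique h2 hab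

open Classical in
lemma BWPair.ncard_le (h : BWPair γ) (hn : 0 < n) {N : ℕ} (hN : 0 < N) (ε : ℝ) :
    ∃ F : Finset (Fin n → Fin n), (∀ f ∈ F, IsQueenFun f) ∧
      (∀ f ∈ F, CloseTo N (cellMass γ N) (plusMass γ N) (minusMass γ N) (ε + 12 / n) f) ∧
      (BsetBW n (γ 0) (γ 1) ε).ncard ≤ F.card := by
  refine ⟨Finset.univ.filter fun f => IsQueenFun f ∧ toConfig f ∈ BsetBW n (γ 0) (γ 1) ε,
    fun f hf => (Finset.mem_filter.mp hf).2.1, fun f hf => ?_, ?_⟩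
  · obtain ⟨hq, -, hd⟩ := (Finset.mem_filter.mp hf).2
    refine h.closeTo hn hN hq fun c hc => ?_
    obtain ⟨h0, h1⟩ := max_lt_iff.mp hd
    rcases (by have := Finset.mem_range.mp hc; omega : c = 0 ∨ c = 1) with rfl | rfl
    · exact h0
    · exact h1
  · refine le_trans ?_ (Finset.card_image_le (f := toConfig))
    rw [← Set.ncard_coe_finset]
    refine Set.ncard_le_ncard (fun q hq => ?_) (Finset.finite_toSet _)
    obtain ⟨f, hf, rfl⟩ := hq.1.exists_queenFun
    exact Finset.mem_coe.mpr (Finset.mem_image_of_mem _ (by simp [hf, hq]))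

end Configurations

section Asymptotics

/-- The limit of `cellError` as the board grows. -/
def cellErrorLimit (N M : ℕ) (η δ Λ : ℝ) : ℝ :=
  16 * N ^ 2 * η * Λ + 8 * N * η * Real.log M + 15 / √M + ((1 + 2 * N * M * η) ^ 2 * (1 + 2 * δ) - 1)

lemma tendsto_cellError (N M : ℕ) (ε δ Λ : ℝ) :
    Tendsto (fun n : ℕ => cellError N M n (ε + 12 / n) δ Λ) atTop
      (𝓝 (cellErrorLimit N M ε δ Λ)) := by
  have h : Tendsto (fun n : ℕ => ((n : ℝ))⁻¹) atTop (𝓝 0) := tendsto_inv_atTop_nhds_zero_nat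
  have hcont : Continuous fun z : ℝ => 16 * N ^ 2 * (ε + 12 * z) * Λ
      + 8 * N * (ε + 12 * z) * Real.log M + 15 / √M
      + ((1 + 2 * N * M * ((ε + 12 * z) + z)) ^ 2 * (1 + 2 * δ) - 1)
      + (4 * N ^ 2 + δ) * M ^ 3 * z := by fun_prop
  have h2 := (hcont.tendsto 0).comp h
  refine (h2.congr fun n => ?_).trans (le_of_eq ?_)
  · simp only [Function.comp_apply, cellError, div_eq_mul_inv, one_mul]
  · congr 1
    simp only [cellErrorLimit, mul_zero, add_zero]

variable {v : ℝ}

lemma log_inv_pow_le (hv : 0 < v) : 30 * Real.log v⁻¹ ≤ (v ^ 30)⁻¹ - 1 := by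
  have h := Real.log_le_sub_one_of_pos (inv_pos.mpr (pow_pos hv 30))
  rw [← inv_pow, Real.log_pow] at h
  rw [← inv_pow]
  exact_mod_cast h

lemma log_four_mul_sq_add_le (hv : 0 < v) (hv1 : v ≤ 1) {N : ℕ}
    (hNv : N * v ^ 100 ≤ 1) : Real.log (4 * N ^ 2 + v ^ 30) ≤ 10 * (v ^ 30)⁻¹ := by
  have hN : (N : ℝ) ≤ (v ^ 100)⁻¹ := by rwa [← one_div, le_div_iff₀ (by positivity)]
  have h1 : (1:ℝ) ≤ ((v ^ 100)⁻¹) ^ 2 :=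
    one_le_pow₀ ((one_le_inv₀ (by positivity)).mpr (pow_le_one₀ hv.le hv1))
  have h2 : 4 * (N : ℝ) ^ 2 + v ^ 30 ≤ 5 * v⁻¹ ^ 200 := by
    have e : v⁻¹ ^ 200 = ((v ^ 100)⁻¹) ^ 2 := by rw [← inv_pow, ← pow_mul]
    rw [e]
    have h3 : v ^ 30 ≤ 1 := pow_le_one₀ hv.le hv1
    have h4 : (N : ℝ) ^ 2 ≤ ((v ^ 100)⁻¹) ^ 2 := by gcongr
    linarith
  have h3 := Real.log_le_log (by positivity) h2
  rw [Real.log_mul (by norm_num) (by positivity), Real.log_pow] at h3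
  have h4 := Real.log_le_sub_one_of_pos (by norm_num : (0:ℝ) < 5)
  have h5 := log_inv_pow_le hv
  have h6 : (1:ℝ) ≤ (v ^ 30)⁻¹ := (one_le_inv₀ (by positivity)).mpr (pow_le_one₀ hv.le hv1)
  push_cast at h3
  linarith

lemma cellErrorLimit_le (hv : 0 < v) (hv2 : v ≤ 1 / 2) {N M : ℕ} (hN : 0 < N) (hM : 0 < M)
    (hNv : N * v ^ 100 ≤ 1) (hNv' : 1 ≤ 2 * N * v ^ 100) (hMv : 1 ≤ M * v ^ 30)
    (hMv' : M * v ^ 30 ≤ 2) :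
    cellErrorLimit N M (v ^ 300) (v ^ 30) (10 * (v ^ 30)⁻¹) + 4 / N * Real.log 4 < v ^ 3 := by
  have hv1 : v ≤ 1 := by linarith
  have hN' : (0:ℝ) < N := by exact_mod_cast hN
  have hM' : (0:ℝ) < M := by exact_mod_cast hM
  have hw : 0 < v ^ 15 := by positivity
  have hw1 : v ^ 15 ≤ 1 := pow_le_one₀ hv.le hv1
  have hpow : ∀ k, 15 ≤ k → v ^ k ≤ v ^ 15 := fun k hk => pow_le_pow_of_le_one hv.le hv1 hk
  have t1 : 16 * (N : ℝ) ^ 2 * v ^ 300 * (10 * (v ^ 30)⁻¹) ≤ 160 * v ^ 15 := by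
    have e : 16 * (N : ℝ) ^ 2 * v ^ 300 * (10 * (v ^ 30)⁻¹)
        = 160 * ((N * v ^ 100) ^ 2 * v ^ 70) := by
      field_simp; ring
    rw [e]
    have h1 : (N * v ^ 100) ^ 2 ≤ 1 := pow_le_one₀ (by positivity) hNv
    have h2 : (N * v ^ 100) ^ 2 * v ^ 70 ≤ v ^ 70 := mul_le_of_le_one_left (by positivity) h1
    linarith [hpow 70 (by norm_num)]
  have t2 : 8 * (N : ℝ) * v ^ 300 * Real.log M ≤ 16 * v ^ 15 := by
    have hlog : Real.log M ≤ M := (Real.log_le_sub_one_of_pos hM').trans (by linarith)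
    calc 8 * (N : ℝ) * v ^ 300 * Real.log M ≤ 8 * (N : ℝ) * v ^ 300 * M := by gcongr
      _ = 8 * (N * v ^ 100) * (M * v ^ 30) * v ^ 170 := by ring
      _ ≤ 8 * 1 * 2 * v ^ 15 := by
        gcongr ?_ * ?_
        · gcongr
        · exact hpow 170 (by norm_num)
      _ = 16 * v ^ 15 := by ring
  have t3 : 15 / √(M : ℝ) ≤ 15 * v ^ 15 := by
    have hs : 1 ≤ √(M : ℝ) * v ^ 15 := by
      have h1 := Real.sqrt_le_sqrt hMv
      rw [Real.sqrt_one, Real.sqrt_mul hM'.le, show v ^ 30 = (v ^ 15) ^ 2 by ring,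
        Real.sqrt_sq hw.le] at h1
      exact h1
    rw [div_le_iff₀ (Real.sqrt_pos.mpr hM')]
    linarith
  have t4 : (1 + 2 * (N : ℝ) * M * v ^ 300) ^ 2 * (1 + 2 * v ^ 30) - 1 ≤ 74 * v ^ 15 := by
    have h1 : 2 * (N : ℝ) * M * v ^ 300 ≤ 4 * v ^ 15 := by
      calc 2 * (N : ℝ) * M * v ^ 300 = 2 * (N * v ^ 100) * (M * v ^ 30) * v ^ 170 := by ring
        _ ≤ 2 * 1 * 2 * v ^ 15 := by
          gcongr ?_ * ?_
          · gcongr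
          · exact hpow 170 (by norm_num)
        _ = 4 * v ^ 15 := by ring
    have h2 : (1 + 2 * (N : ℝ) * M * v ^ 300) ^ 2 * (1 + 2 * v ^ 30)
        ≤ (1 + 4 * v ^ 15) ^ 2 * (1 + 2 * v ^ 15) := by
      gcongr ?_ ^ 2 * ?_
      · linarith
      · linarith [hpow 30 (by norm_num)]
    nlinarith [mul_nonneg hw.le (sub_nonneg.mpr hw1),
      mul_nonneg (mul_nonneg hw.le hw.le) (sub_nonneg.mpr hw1)]
  have t5 : 4 / (N : ℝ) * Real.log 4 ≤ 24 * v ^ 15 := by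
    have h4 := Real.log_le_sub_one_of_pos (by norm_num : (0:ℝ) < 4)
    have h1 : 4 / (N : ℝ) ≤ 8 * v ^ 15 := by
      rw [div_le_iff₀ hN']
      have : (N : ℝ) * v ^ 100 ≤ N * v ^ 15 := 
        mul_le_mul_of_nonneg_left (hpow 100 (by norm_num)) hN'.le
      linarith
    calc 4 / (N : ℝ) * Real.log 4 ≤ 8 * v ^ 15 * 3 := by
          gcongr
          linarith
      _ = 24 * v ^ 15 := by ring
  have h12 : v ^ 12 ≤ (1 / 2) ^ 12 := by gcongr
  have h3 : 0 < v ^ 3 := by positivity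
  have hfin : v ^ 15 ≤ (1 / 2) ^ 12 * v ^ 3 := by
    calc v ^ 15 = v ^ 12 * v ^ 3 := by ring
      _ ≤ _ := by gcongr
  unfold cellErrorLimit
  norm_num at hfin
  linarith

lemma rpow_inv_div_le_exp {m n : ℕ} (hn : 0 < n) {x : ℝ}
    (h : (m : ℝ) ≤ Real.exp (n * (Real.log n + x))) : (m : ℝ) ^ (1 / (n : ℝ)) / n ≤ Real.exp x := by
  have hn' : (0:ℝ) < n := by exact_mod_cast hn
  rw [div_le_iff₀ hn']
  calc (m : ℝ) ^ (1 / (n : ℝ)) ≤ Real.exp (n * (Real.log n + x)) ^ (1 / (n : ℝ)) := by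
        gcongr
    _ = Real.exp x * n := by
        rw [← Real.exp_mul, show n * (Real.log n + x) * (1 / (n : ℝ)) = Real.log n + x by field_simp,
          Real.exp_add, Real.exp_log hn', mul_comm]

end Asymptotics

/-- **Lemma (BW upper bound).**
For all sufficiently small `ε > 0`: for every BW-decomposition `(γb, γw)` of a queenon,
with `N = ⌊ε^{−1/3}⌋`, `limsup_n |B_n((γb,γw),ε)|^{1/n}/n ≤ exp(G^N(γb,γw) + ε^{1/100})`. -/
theorem bw_upper_bound :
    ∃ ε₀ : ℝ, 0 < ε₀ ∧ ∀ ε : ℝ, 0 < ε → ε ≤ ε₀ →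
      ∀ γb γw : Measure (ℝ × ℝ), memBW γb γw →
        limsup (fun n : ℕ => (Set.ncard (BsetBW n γb γw ε) : ℝ) ^ (1/(n:ℝ)) / (n : ℝ))
            atTop ≤
          Real.exp (GN (Nat.floor (ε ^ (-(1:ℝ)/3))) γb γw + ε ^ ((1:ℝ)/100)) := by
  refine ⟨(1 / 2) ^ 300, by positivity, fun ε hε hε₀ γb γw hBW => ?_⟩
  obtain ⟨v, hv, rfl⟩ : ∃ v : ℝ, 0 < v ∧ v ^ 300 = ε :=
    ⟨ε ^ ((300 : ℕ) : ℝ)⁻¹, by positivity, Real.rpow_inv_natCast_pow hε.le (by norm_num)⟩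
  have hv2 : v ≤ 1 / 2 := le_of_pow_le_pow_left₀ (by norm_num) (by norm_num) hε₀
  have hv1 : v ≤ 1 := by linarith
  have e1 : (v ^ 300) ^ (-(1:ℝ) / 3) = (v ^ 100)⁻¹ := by
    rw [← Real.rpow_natCast v 300, ← Real.rpow_mul hv.le, ← Real.rpow_natCast v 100,
      ← Real.rpow_neg hv.le]
    norm_num
  have e2 : (v ^ 300) ^ ((1:ℝ) / 100) = v ^ 3 := by
    rw [← Real.rpow_natCast v 300, ← Real.rpow_mul hv.le, ← Real.rpow_natCast v 3]
    norm_num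
  rw [e1, e2]
  have hx : 1 ≤ (v ^ 100)⁻¹ := (one_le_inv₀ (by positivity)).mpr (pow_le_one₀ hv.le hv1)
  have hy : 1 ≤ (v ^ 30)⁻¹ := (one_le_inv₀ (by positivity)).mpr (pow_le_one₀ hv.le hv1)
  set N := Nat.floor (v ^ 100)⁻¹ with hNdef
  set M := Nat.ceil (v ^ 30)⁻¹ with hMdef
  have hN : 0 < N := Nat.floor_pos.mpr hx
  have hM : 0 < M := Nat.ceil_pos.mpr (by linarith)
  have hN1 : (1:ℝ) ≤ N := by exact_mod_cast hN
  have hNv : (N : ℝ) * v ^ 100 ≤ 1 := by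
    calc (N : ℝ) * v ^ 100 ≤ (v ^ 100)⁻¹ * v ^ 100 := by
          gcongr
          exact Nat.floor_le (zero_le_one.trans hx)
      _ = 1 := by field_simp
  have hNv' : 1 ≤ 2 * (N : ℝ) * v ^ 100 := by
    have h1 := (Nat.lt_floor_add_one (v ^ 100)⁻¹).le
    rw [← one_div, div_le_iff₀ (by positivity), one_div, ← hNdef] at h1
    have h2 : ((N : ℝ) + 1) * v ^ 100 ≤ (2 * N) * v ^ 100 := by
      gcongr
      linarith
    linarith
  have hMv : 1 ≤ (M : ℝ) * v ^ 30 := by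
    have := Nat.le_ceil (v ^ 30)⁻¹
    rwa [← one_div, div_le_iff₀ (by positivity), one_div] at this
  have hMv' : (M : ℝ) * v ^ 30 ≤ 2 := by
    have h1 := (Nat.ceil_lt_add_one (zero_le_one.trans hy)).le
    calc (M : ℝ) * v ^ 30 ≤ (2 * (v ^ 30)⁻¹) * v ^ 30 := by
          gcongr
          linarith
      _ = 2 := by field_simp
  have hpair := hBW.bwPair
  set γ : ℕ → Measure (ℝ × ℝ) := fun c => if c = 0 then γb else γw with hγ
  have hle : ∀ c, γ c Set.univ ≤ 1 := by
    intro c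
    rw [← hpair.total]
    by_cases hc : c = 0
    · rw [hc]; exact le_self_add
    · have : γ c = γ 1 := by simp [hγ, hc]
      rw [this]; exact le_add_self
  have hent := hpair.cellEntropy_le hle hN
  have hlim := (tendsto_cellError N M (v ^ 300) (v ^ 30) (10 * (v ^ 30)⁻¹)).eventually_le_const
    (u := v ^ 3 - 4 / N * Real.log 4)
    (by linarith [cellErrorLimit_le hv hv2 hN hM hNv hNv' hMv hMv'])
  refine limsup_le_of_le (isCoboundedUnder_le_of_le atTop (x := 0) fun n => by positivity) ?_
  filter_upwards [hlim, eventually_gt_atTop 0] with n hn hn0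
  refine rpow_inv_div_le_exp hn0 ?_
  obtain ⟨F, hF, hc, hcard⟩ := hpair.ncard_le hn0 hN (v ^ 300)
  have hδΛ : -Real.log (v ^ 30) ≤ 10 * (v ^ 30)⁻¹ := by
    rw [← Real.log_inv]
    have := Real.log_le_sub_one_of_pos (inv_pos.mpr (pow_pos hv 30))
    linarith
  have hmain := card_closeTo_le hn0 hN hM (hpair.cellData hle hN) (by positivity) (by positivity)
    hδΛ (log_four_mul_sq_add_le hv hv1 hNv) (by positivity) F hF hc
  refine ((Nat.cast_le.mpr hcard).trans hmain).trans (Real.exp_le_exp.mpr ?_)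
  refine mul_le_mul_of_nonneg_left ?_ (Nat.cast_nonneg n)
  have : GN N (γ 0) (γ 1) = GN N γb γw := rfl
  linarith

end
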